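/- Let ξ be zeta-distributed with parameter β > 1, i.e. Pr[ξ = ℓ] = ℓ^{−β}/ζ(β) for every integer ℓ ≥ 1, and let φ be a random 2-CNF on n variables drawn from the configuration model C_n^2(ξ). Then there exists β₀ > 3 (the positive solution of E[ξ²] = 3·E[ξ], equivalently of ζ(β−2) = 3·ζ(β−1), numerically β₀ ≈ 3.26) such that, as n → ∞: Pr[φ is satisfiable] → 0 for every β with 1 < β < β₀, and Pr[φ is satisfiable] → 1 for every β > β₀. -/

import Mathlib

/-!
Random `k`-SAT in the configuration model `C_n^k(ξ)` with a power-law degree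
distribution `ξ ∈ P(α)`.

A literal is a variable together with a polarity, a clause is a multiset of
literals and a CNF formula is a multiset of clauses.  The configuration model
first samples the degrees `d₁, …, d_n` as i.i.d. copies of `ξ` conditioned on
`k ∣ d₁ + ⋯ + d_n`, creates `dᵢ` clones of variable `vᵢ`, chooses a uniformly
random partition of the clones into blocks of size `k` (realized here by a
uniformly random bijection `Fin (∑ dᵢ) ≃ clones`, grouping consecutive indices
into blocks, which induces exactly the uniform distribution on partitions) and
finally negates each clone independently with probability `1/2`.
-/

open MeasureTheory ProbabilityTheory Filter
open scoped ENNReal NNReal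

namespace RandomSat

/-- A literal over `n` variables: a variable index together with a polarity. -/
abbrev Lit (n : ℕ) := Fin n × Bool

/-- A clause: a multiset of literals. -/
abbrev Clause (n : ℕ) := Multiset (Lit n)

/-- A CNF formula: a multiset of clauses. -/
abbrev CNF (n : ℕ) := Multiset (Clause n)

instance (n : ℕ) : MeasurableSpace (CNF n) := ⊤

/-- A formula is satisfiable if some assignment makes every clause contain a
true literal. -/
def Satisfiable {n : ℕ} (φ : CNF n) : Prop :=
  ∃ a : Fin n → Bool, ∀ c ∈ φ, ∃ l ∈ c, a l.1 = l.2

/-- The set of clones determined by a degree sequence `d`: variable `i` has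
`d i` clones. -/
abbrev Clones (n : ℕ) (d : Fin n → ℕ) := Σ i : Fin n, Fin (d i)

instance clonesEquivNonempty (n : ℕ) (d : Fin n → ℕ) :
    Nonempty (Fin (∑ i, d i) ≃ Clones n d) :=
  ⟨Fintype.equivOfCardEq (by simp)⟩

/-- The `k`-CNF formula built from a degree sequence `d`, an ordering `e` of the
clones, and polarities `s` for the clones: consecutive blocks of `k` clones
(in the order given by `e`) form the clauses. -/
def cnfOfConfig (n k : ℕ) (d : Fin n → ℕ)
    (e : Fin (∑ i, d i) ≃ Clones n d) (s : Clones n d → Bool) : CNF n :=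
  (Finset.univ : Finset (Fin ((∑ i, d i) / k))).val.map fun j =>
    (Finset.univ : Finset (Fin k)).val.map fun t =>
      letI c := e ⟨j.1 * k + t.1, by
        have h1 : j.1 * k + t.1 < (j.1 + 1) * k := by
          rw [Nat.add_mul, Nat.one_mul]; exact Nat.add_lt_add_left t.2 _
        exact lt_of_lt_of_le h1 (le_trans
          (Nat.mul_le_mul_right k (Nat.succ_le_of_lt j.2))
          (Nat.div_mul_le_self _ _))⟩
      ((c.1, s c) : Lit n)

/-- Given the degree sequence `d`, the random formula: a uniformly random
ordering of the clones (inducing a uniform partition into blocks of size `k`)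
together with independent uniform polarities. -/
noncomputable def formulaPMF (n k : ℕ) (d : Fin n → ℕ) : PMF (CNF n) :=
  (PMF.uniformOfFintype (Fin (∑ i, d i) ≃ Clones n d)).bind fun e =>
    (PMF.uniformOfFintype (Clones n d → Bool)).map fun s => cnfOfConfig n k d e s

/-- The degree sequence: `n` i.i.d. copies of `ξ`, conditioned on the total
degree being divisible by `k`. -/
noncomputable def degreeMeasure (n k : ℕ) (ξ : PMF ℕ) : Measure (Fin n → ℕ) :=
  (Measure.pi fun _ : Fin n => ξ.toMeasure)[|{d | k ∣ ∑ i, d i}]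

/-- The configuration model `C_n^k(ξ)`: the distribution of the random `k`-CNF
formula on `n` variables with degree distribution `ξ`. -/
noncomputable def configurationModel (n k : ℕ) (ξ : PMF ℕ) : Measure (CNF n) :=
  (degreeMeasure n k ξ).bind fun d => (formulaPMF n k d).toMeasure

/-- The tail function `F_ξ(ℓ) = Pr[ξ ≥ ℓ]` of a distribution on `ℕ`. -/
noncomputable def tail (ξ : PMF ℕ) (ℓ : ℕ) : ℝ≥0∞ :=
  ∑' j : ℕ, if ℓ ≤ j then ξ j else 0

/-- The `m`-th moment `E[ξ^m]` of a distribution on `ℕ`. -/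
noncomputable def moment (ξ : PMF ℕ) (m : ℕ) : ℝ≥0∞ :=
  ∑' j : ℕ, (j : ℝ≥0∞) ^ m * ξ j

/-- `ξ ∈ P(α)`: a positive integer-valued distribution whose tail function is
sandwiched between two power laws with exponent `α > 0`. -/
def IsPowerLaw (ξ : PMF ℕ) (α : ℝ) : Prop :=
  0 < α ∧ ξ 0 = 0 ∧ ∃ W V : ℝ, 0 < W ∧ W ≤ V ∧
    ∀ ℓ : ℕ, 1 ≤ ℓ →
      ENNReal.ofReal (W * (ℓ : ℝ) ^ (-α)) ≤ tail ξ ℓ ∧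
      tail ξ ℓ ≤ ENNReal.ofReal (V * (ℓ : ℝ) ^ (-α))

/-- The Riemann zeta function for real arguments, `ζ(s) = ∑_{d ≥ 1} d^{−s}`. -/
noncomputable def zetaR (s : ℝ) : ℝ := ∑' m : ℕ+, (m : ℝ) ^ (-s)

/-- `ξ` is zeta-distributed with parameter `β`:
`Pr[ξ = ℓ] = ℓ^{−β} / ζ(β)` for every integer `ℓ ≥ 1` (and `Pr[ξ = 0] = 0`,
since `(0 : ℝ)^{−β} = 0` for `β > 0`). -/
def IsZeta (ξ : PMF ℕ) (β : ℝ) : Prop :=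
  ∀ ℓ : ℕ, ξ ℓ = ENNReal.ofReal ((ℓ : ℝ) ^ (-β) / zetaR β)


section Matchings
open Equiv Finset

variable {α : Type*} [Fintype α] [DecidableEq α]

/-- Perfect matchings of the finite set `R`, seen as involutions with support `R`. -/
def matchings (R : Finset α) : Finset (Perm α) :=
  univ.filter fun m => m * m = 1 ∧ m.support = R

/-- Number of perfect matchings on `r` points. -/
def dm : ℕ → ℕ
  | 0 => 1
  | 1 => 0
  | (r+2) => (r+1) * dm r

lemma dm_pos {r : ℕ} (h : Even r) : 0 < dm r := by
  obtain ⟨k, rfl⟩ := h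
  induction k with
  | zero => simp [dm]
  | succ k ih =>
    have : k + 1 + (k + 1) = (k + k) + 2 := by ring
    rw [this, dm]; positivity

lemma mem_matchings {R : Finset α} {m : Perm α} :
    m ∈ matchings R ↔ m * m = 1 ∧ m.support = R := by simp [matchings]

lemma matchings_inv {R : Finset α} {m : Perm α} (h : m ∈ matchings R) (x : α) :
    m (m x) = x := by
  have := (mem_matchings.1 h).1
  have := congrArg (fun f : Perm α => f x) this
  simpa using this

lemma matchings_mem {R : Finset α} {m : Perm α} (h : m ∈ matchings R) {x : α} :
    x ∈ R ↔ m x ≠ x := by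
  rw [← (mem_matchings.1 h).2, Perm.mem_support]

lemma matchings_maps {R : Finset α} {m : Perm α} (h : m ∈ matchings R) {x : α} :
    m x ∈ R ↔ x ∈ R := by
  rw [matchings_mem h, matchings_mem h, matchings_inv h]
  exact ne_comm

lemma matchings_mk {R : Finset α} {m : Perm α} (h1 : ∀ x, m (m x) = x)
    (h2 : ∀ x, x ∈ R ↔ m x ≠ x) : m ∈ matchings R := by
  rw [mem_matchings]
  refine ⟨by ext x; simp [h1], ?_⟩
  ext x; rw [Perm.mem_support, h2]

lemma matchings_swap {R : Finset α} {c c' : α} (hc : c ∈ R) (hc' : c' ∈ R.erase c)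
    (m : Perm α) :
    m * swap c c' ∈ matchings R ∧ (m * swap c c') c = c' ↔
      m ∈ matchings ((R.erase c).erase c') := by
  have hne : c' ≠ c := (Finset.mem_erase.1 hc').1
  have hc'R : c' ∈ R := (Finset.mem_erase.1 hc').2
  constructor
  · rintro ⟨h, h1⟩
    have hmc' : m c' = c' := by simpa using h1
    have hmc : m c = c := by
      have := matchings_inv h c
      rw [h1] at this; simpa using this
    have key : ∀ x, x ≠ c → x ≠ c' → (m * swap c c') x = m x := by
      intro x hx hx'; simp [swap_apply_of_ne_of_ne hx hx']
    have hk2 : ∀ x, x ≠ c → x ≠ c' → m x ≠ c ∧ m x ≠ c' := by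
      intro x hx hx'
      refine ⟨fun hh => hx ?_, fun hh => hx' ?_⟩
      · exact m.injective (hh.trans hmc.symm)
      · exact m.injective (hh.trans hmc'.symm)
    apply matchings_mk
    · intro x
      by_cases hx : x = c
      · subst hx; rw [hmc, hmc]
      by_cases hx' : x = c'
      · subst hx'; rw [hmc', hmc']
      have := matchings_inv h x
      rwa [key x hx hx', key _ (hk2 x hx hx').1 (hk2 x hx hx').2] at this
    · intro x
      by_cases hx : x = c
      · subst hx; simp [hmc]
      by_cases hx' : x = c'
      · subst hx'; simp [hmc']
      simp only [Finset.mem_erase, hx, hx', ne_eq, not_false_eq_true, true_and]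
      rw [matchings_mem h, key x hx hx']
  · intro h
    have hmc : m c = c := by
      by_contra hh; have := (matchings_mem h).2 hh; simp at this
    have hmc' : m c' = c' := by
      by_contra hh; have := (matchings_mem h).2 hh; simp at this
    have key : ∀ x, x ≠ c → x ≠ c' → (m * swap c c') x = m x := by
      intro x hx hx'; simp [swap_apply_of_ne_of_ne hx hx']
    have hk2 : ∀ x, x ≠ c → x ≠ c' → m x ≠ c ∧ m x ≠ c' := by
      intro x hx hx'
      refine ⟨fun hh => hx ?_, fun hh => hx' ?_⟩
      · exact m.injective (hh.trans hmc.symm)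
      · exact m.injective (hh.trans hmc'.symm)
    refine ⟨?_, by simp [hmc']⟩
    apply matchings_mk
    · intro x
      by_cases hx : x = c
      · subst hx; simp [hmc', hmc]
      by_cases hx' : x = c'
      · subst hx'; simp [hmc, hmc']
      rw [key x hx hx', key _ (hk2 x hx hx').1 (hk2 x hx hx').2, matchings_inv h]
    · intro x
      by_cases hx : x = c
      · subst hx; simp [hmc', hne, hc]
      by_cases hx' : x = c'
      · subst hx'; simp [hmc, hne.symm, hc'R]
      rw [key x hx hx', ← matchings_mem h]
      simp [hx, hx']

lemma sum_matchings {R : Finset α} {c : α} (hc : c ∈ R) (f : Perm α → ℝ) :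
    ∑ m ∈ matchings R, f m =
      ∑ c' ∈ R.erase c, ∑ m ∈ matchings ((R.erase c).erase c'), f (m * swap c c') := by
  have hmaps : ∀ m ∈ matchings R, m c ∈ R.erase c := by
    intro m hm
    rw [Finset.mem_erase]
    exact ⟨(matchings_mem hm).1 hc, (matchings_maps hm).2 hc⟩
  rw [← Finset.sum_fiberwise_of_maps_to hmaps]
  refine Finset.sum_congr rfl fun c' hc' => ?_
  refine Finset.sum_bij' (fun m _ => m * swap c c') (fun m _ => m * swap c c') ?_ ?_ ?_ ?_ ?_
  · intro m hm
    rw [Finset.mem_filter] at hm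
    rw [← matchings_swap hc hc']
    simpa [mul_assoc] using hm
  · intro m hm
    rw [Finset.mem_filter]
    exact (matchings_swap hc hc' m).2 hm
  · intro m _; simp [mul_assoc]
  · intro m _; simp [mul_assoc]
  · intro m _; simp [mul_assoc]

lemma card_erase2 {R : Finset α} {c c' : α} (hc : c ∈ R) (hc' : c' ∈ R.erase c) :
    ((R.erase c).erase c').card + 2 = R.card := by
  have h1 := Finset.card_erase_add_one hc
  have h2 := Finset.card_erase_add_one hc'
  omega

lemma card_matchings (R : Finset α) : (matchings R).card = dm R.card := by
  induction' h : R.card using Nat.strong_induction_on with r ih generalizing R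
  rcases R.eq_empty_or_nonempty with rfl | ⟨c, hc⟩
  · simp at h; subst h
    have : matchings (∅ : Finset α) = {1} := by
      ext m; rw [mem_matchings, Perm.support_eq_empty_iff, Finset.mem_singleton]
      constructor
      · exact fun h => h.2
      · rintro rfl; simp
    simp [this, dm]
  · have hs := sum_matchings hc (fun _ => (1:ℝ))
    have h2 : ∀ c' ∈ R.erase c,
        ∑ m ∈ matchings ((R.erase c).erase c'), (1:ℝ) = dm (r - 2) := by
      intro c' hc'
      have h3 := card_erase2 hc hc'
      have h4 : ((R.erase c).erase c').card = r - 2 := by omega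
      have := ih (r-2) (by omega) _ h4
      simp [this]
    rw [Finset.sum_congr rfl h2] at hs
    simp only [sum_const, nsmul_eq_mul, mul_one, Finset.card_erase_of_mem hc, h] at hs
    have hs' : (matchings R).card = (r-1) * dm (r-2) := by exact_mod_cast hs
    rw [hs']
    match r, h with
    | 0, h => simp at h; simp [h] at hc
    | 1, h => simp [dm]
    | (r+2), h => simp [dm]

end Matchings

section Prob
open Equiv Finset
open scoped Classical in
/-- Probability of an event under a uniform matching of `R` and uniform signs. -/
noncomputable def prob {α : Type*} [Fintype α] [DecidableEq α] (R : Finset α)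
    (Ev : Perm α → (α → Bool) → Prop) : ℝ :=
  (∑ m ∈ matchings R, ∑ s : α → Bool, if Ev m s then (1:ℝ) else 0) /
    (dm R.card * 2 ^ Fintype.card α)

variable {α : Type*} [Fintype α] [DecidableEq α]

lemma prob_mono {R : Finset α} {E F : Perm α → (α → Bool) → Prop}
    (h : ∀ m ∈ matchings R, ∀ s, E m s → F m s) : prob R E ≤ prob R F := by
  classical
  unfold prob
  gcongr with m hm s _
  by_cases hE : E m s
  · simp [hE, h m hm s hE]
  · simp only [hE, if_false]; split_ifs <;> norm_num

lemma prob_congr {R : Finset α} {E F : Perm α → (α → Bool) → Prop}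
    (h : ∀ m ∈ matchings R, ∀ s, E m s ↔ F m s) : prob R E = prob R F :=
  le_antisymm (prob_mono fun m hm s => (h m hm s).1) (prob_mono fun m hm s => (h m hm s).2)

lemma prob_nonneg (R : Finset α) (E : Perm α → (α → Bool) → Prop) : 0 ≤ prob R E := by
  classical
  unfold prob
  apply div_nonneg _ (by positivity)
  exact Finset.sum_nonneg fun m _ => Finset.sum_nonneg fun s _ => by split_ifs <;> norm_num

lemma prob_true {R : Finset α} (hR : Even R.card) : prob R (fun _ _ => True) = 1 := by
  have := dm_pos hR
  have h : (dm R.card : ℝ) ≠ 0 := by positivity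
  simp only [prob, if_true, Finset.sum_const, card_matchings, Finset.card_univ, nsmul_eq_mul,
    mul_one, Fintype.card_fun, Fintype.card_bool, Nat.cast_pow, Nat.cast_ofNat]
  exact div_self (by positivity)

lemma prob_false (R : Finset α) : prob R (fun _ _ => False) = 0 := by
  simp [prob]

lemma prob_le_one {R : Finset α} (hR : Even R.card) (E : Perm α → (α → Bool) → Prop) :
    prob R E ≤ 1 := by
  rw [← prob_true hR]
  exact prob_mono fun _ _ _ _ => trivial

lemma prob_or (R : Finset α) (E F : Perm α → (α → Bool) → Prop) :
    prob R (fun m s => E m s ∨ F m s) ≤ prob R E + prob R F := by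
  classical
  unfold prob
  rw [← add_div, ← Finset.sum_add_distrib]
  gcongr with m hm
  rw [← Finset.sum_add_distrib]
  gcongr with s
  by_cases hE : E m s <;> by_cases hF : F m s <;> simp [hE, hF]

lemma prob_not {R : Finset α} (hR : Even R.card) (E : Perm α → (α → Bool) → Prop) :
    prob R (fun m s => ¬ E m s) = 1 - prob R E := by
  classical
  rw [← prob_true hR, eq_sub_iff_add_eq]
  unfold prob
  rw [← add_div, ← Finset.sum_add_distrib]
  congr 1
  refine Finset.sum_congr rfl fun m _ => ?_
  rw [← Finset.sum_add_distrib]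
  refine Finset.sum_congr rfl fun s _ => ?_
  by_cases hE : E m s <;> simp [hE]

lemma prob_exists {ι : Type*} (I : Finset ι) (R : Finset α)
    (E : ι → Perm α → (α → Bool) → Prop) :
    prob R (fun m s => ∃ i ∈ I, E i m s) ≤ ∑ i ∈ I, prob R (E i) := by
  classical
  induction I using Finset.induction_on with
  | empty => simp [prob_false]
  | insert i I hi ih =>
    rw [Finset.sum_insert hi]
    refine le_trans (prob_mono (F := fun m s => E i m s ∨ ∃ i ∈ I, E i m s) ?_)
      ((prob_or _ _ _).trans (by gcongr))
    rintro m - s ⟨j, hj, h⟩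
    rcases Finset.mem_insert.1 hj with rfl | hj
    · exact Or.inl h
    · exact Or.inr ⟨j, hj, h⟩

lemma prob_match {R : Finset α} {c : α} (hc : c ∈ R) (E : Perm α → (α → Bool) → Prop) :
    prob R E = (∑ c' ∈ R.erase c, prob ((R.erase c).erase c')
      (fun m s => E (m * swap c c') s)) / ((R.card : ℝ) - 1) := by
  classical
  unfold prob
  rw [sum_matchings hc]
  have h1 : ∀ c' ∈ R.erase c, ((R.erase c).erase c').card = R.card - 2 ∧ 2 ≤ R.card := by
    intro c' hc'
    have := card_erase2 hc hc'
    omega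
  rcases (R.erase c).eq_empty_or_nonempty with he | ⟨x, hx⟩
  · rw [he]; simp
  have h2 := (h1 x hx).2
  have h3 : dm R.card = (R.card - 1) * dm (R.card - 2) := by
    obtain ⟨r, hr⟩ := Nat.exists_eq_add_of_le h2
    rw [hr, show 2 + r = r + 2 by ring, dm]; simp
  rw [h3]
  push_cast [Nat.cast_sub (by omega : 1 ≤ R.card)]
  have h5 : ∀ c' ∈ R.erase c, (∑ m ∈ matchings ((R.erase c).erase c'), ∑ s : α → Bool,
      if E (m * swap c c') s then (1:ℝ) else 0) /
        (dm ((R.erase c).erase c').card * 2 ^ Fintype.card α) =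
      (∑ m ∈ matchings ((R.erase c).erase c'), ∑ s : α → Bool,
      if E (m * swap c c') s then (1:ℝ) else 0) / (dm (R.card - 2) * 2 ^ Fintype.card α) := by
    intro c' hc'; rw [(h1 c' hc').1]
  rw [Finset.sum_congr rfl h5, ← Finset.sum_div, div_div]
  congr 1
  ring

lemma sum_update (c : α) (b : Bool) (f : (α → Bool) → ℝ) :
    ∑ s : α → Bool, f (Function.update s c b) = 2 * ∑ s : α → Bool with s c = b, f s := by
  have h1 : ∑ s : α → Bool with s c = b, f (Function.update s c b) =
      ∑ s : α → Bool with s c = b, f s := by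
    refine Finset.sum_congr rfl fun s hs => ?_
    have : s c = b := by simpa using hs
    rw [← this, Function.update_eq_self]
  have h2 : ∑ s : α → Bool with ¬ s c = b, f (Function.update s c b) =
      ∑ s : α → Bool with s c = b, f s := by
    refine Finset.sum_bij' (fun s _ => Function.update s c b)
      (fun s _ => Function.update s c (!b)) ?_ ?_ ?_ ?_ ?_
    · simp
    · simp
    · intro s hs
      have : s c = !b := by
        have : ¬ s c = b := by simpa using hs
        cases h : s c <;> cases b <;> simp_all
      simp [← this]
    · intro s hs
      have : s c = b := by simpa using hs
      simp [← this]
    · intros; rfl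
  rw [← Finset.sum_filter_add_sum_filter_not univ (fun s : α → Bool => s c = b), h1, h2, two_mul]

lemma prob_sign (R : Finset α) (c : α) (E : Perm α → (α → Bool) → Prop) (b : Bool) :
    prob R E = (prob R (fun m s => E m (Function.update s c b)) +
      prob R (fun m s => E m (Function.update s c (!b)))) / 2 := by
  classical
  unfold prob
  rw [← add_div, div_right_comm]
  congr 1
  rw [← Finset.sum_add_distrib, Finset.sum_div]
  refine Finset.sum_congr rfl fun m _ => ?_
  rw [sum_update c b (fun s => if E m s then 1 else 0),
    sum_update c (!b) (fun s => if E m s then 1 else 0),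
    ← Finset.sum_filter_add_sum_filter_not univ (fun s : α → Bool => s c = b)]
  have : (univ.filter fun s : α → Bool => ¬ s c = b) = univ.filter fun s : α → Bool => s c = !b := by
    ext s; simp
    cases s c <;> cases b <;> simp
  rw [this]
  ring

end Prob



section NoPair
open Equiv Finset
variable {α : Type*} [Fintype α] [DecidableEq α]

/-- No matched pair inside `A` has both its signs equal to the prescribed ones. -/
def NoPair (A : Finset α) (b : α → Bool) (m : Perm α) (s : α → Bool) : Prop :=
  ∀ c ∈ A, m c ∈ A → ¬ (s c = b c ∧ s (m c) = b (m c))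

lemma swap_apply_other {R : Finset α} {c c' x : α} {m : Perm α}
    (hx : x ∈ (R.erase c).erase c') : (m * swap c c') x = m x := by
  simp only [Finset.mem_erase] at hx
  simp [swap_apply_of_ne_of_ne hx.2.1 hx.1]

lemma swap_apply_c {R : Finset α} {c c' : α} {m : Perm α}
    (hm : m ∈ matchings ((R.erase c).erase c')) : (m * swap c c') c = c' := by
  have hmc' : m c' = c' := by
    by_contra hh; have := (matchings_mem hm).2 hh; simp at this
  simp [hmc']

lemma prob_noPair (S a : ℕ) (b : α → Bool) (j : ℕ) :
    ∀ (R A : Finset α), Even R.card → R.card ≤ S → A ⊆ R → 2 * j + a ≤ A.card →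
      prob R (NoPair A b) ≤ (1 - a / (4 * S)) ^ j := by
  induction j with
  | zero => intro R A hR _ _ _; simpa using prob_le_one hR _
  | succ j ih =>
    intro R A hR hS hA hcard
    obtain ⟨c, hc⟩ : A.Nonempty := Finset.card_pos.1 (by omega)
    have hcR := hA hc
    have hAR := Finset.card_le_card hA
    set q : ℝ := 1 - a / (4 * S) with hq
    have hRS : (R.card : ℝ) ≤ S := by exact_mod_cast hS
    have hR2 : (2:ℝ) ≤ R.card := by exact_mod_cast (by omega : 2 ≤ R.card)
    have haS : (a:ℝ) ≤ S := by exact_mod_cast (by omega : a ≤ S)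
    have hq0 : 0 ≤ q := by
      rw [hq, sub_nonneg, div_le_one (by linarith)]; linarith
    rw [prob_match hcR]
    have hev : ∀ c' ∈ R.erase c, Even ((R.erase c).erase c').card := by
      intro c' hc'
      have := card_erase2 hcR hc'
      rw [← this] at hR
      exact (Nat.even_add.1 hR).2 (by decide)
    -- the bound for each partner
    have hb : ∀ c' ∈ R.erase c, prob ((R.erase c).erase c')
        (fun m s => NoPair A b (m * swap c c') s) ≤ (if c' ∈ A then 3/4 else 1) * q ^ j := by
      intro c' hc'
      have hcc := card_erase2 hcR hc'
      have hcard' : 2 * j + a ≤ ((A.erase c).erase c').card := by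
        have h1 := Finset.card_erase_add_one hc
        have h2 := Finset.pred_card_le_card_erase (s := A.erase c) (a := c')
        omega
      have hih := ih ((R.erase c).erase c') ((A.erase c).erase c') (hev c' hc') (by omega)
        (Finset.erase_subset_erase _ (Finset.erase_subset_erase _ hA)) hcard'
      have hred : ∀ m ∈ matchings ((R.erase c).erase c'), ∀ s, NoPair A b (m * swap c c') s →
          NoPair ((A.erase c).erase c') b m s := by
        intro m hm s h x hx hmx
        have hxR : x ∈ (R.erase c).erase c' :=
          (Finset.erase_subset_erase _ (Finset.erase_subset_erase _ hA)) hx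
        have := h x (by simp at hx; exact hx.2.2)
        rw [swap_apply_other hxR] at this
        exact this (by simp at hmx; exact hmx.2.2)
      have hind : ∀ (x : α) (b' : Bool), (x = c ∨ x = c') →
          ∀ (m : Perm α) s, NoPair ((A.erase c).erase c') b m (Function.update s x b') ↔
            NoPair ((A.erase c).erase c') b m s := by
        intro x b' hx m s
        unfold NoPair
        refine forall_congr' fun y => forall_congr' fun hy => forall_congr' fun hmy => ?_
        have h1 : y ≠ x := by
          rintro rfl; rcases hx with rfl | rfl <;> simp at hy
        have h2 : m y ≠ x := by
          rintro rfl; rcases hx with h | h <;> simp [h] at hmy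
        rw [Function.update_of_ne h1, Function.update_of_ne h2]
      by_cases hc'A : c' ∈ A
      · simp only [hc'A, if_true]
        have hne : c' ≠ c := (Finset.mem_erase.1 hc').1
        have hP : ∀ b1 b2, prob ((R.erase c).erase c') (fun m s => NoPair A b (m * swap c c')
            (Function.update (Function.update s c' b2) c b1)) ≤ q ^ j := by
          intro b1 b2
          refine le_trans (prob_mono ?_) hih
          intro m hm s h
          have := hred m hm _ h
          rwa [hind c b1 (Or.inl rfl), hind c' b2 (Or.inr rfl)] at this
        have h0 : prob ((R.erase c).erase c') (fun m s => NoPair A b (m * swap c c')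
            (Function.update (Function.update s c' (b c')) c (b c))) ≤ 0 := by
          rw [← prob_false ((R.erase c).erase c')]
          refine prob_mono ?_
          intro m hm s h
          have := h c hc
          rw [swap_apply_c hm] at this
          exact this hc'A (by simp [Function.update_of_ne hne])
        rw [prob_sign _ c _ (b c), prob_sign _ c' _ (b c'),
          prob_sign _ c' (fun m s => NoPair A b (m * swap c c') (Function.update s c (!b c))) (b c')]
        have e1 := hP (b c) (!b c')
        have e2 := hP (!b c) (b c')
        have e3 := hP (!b c) (!b c')
        linarith
      · simp only [hc'A, if_false, one_mul]
        exact le_trans (prob_mono hred) hih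
    have hsum := Finset.sum_le_sum hb
    rw [← Finset.sum_mul] at hsum
    have hs2 : ∑ c' ∈ R.erase c, (if c' ∈ A then (3/4:ℝ) else 1) =
        (R.card - 1) - (A.card - 1) / 4 := by
      have : ∀ c' ∈ R.erase c, (if c' ∈ A then (3/4:ℝ) else 1) = 1 - (if c' ∈ A then 1/4 else 0) := by
        intro c' _; split_ifs <;> norm_num
      rw [Finset.sum_congr rfl this, Finset.sum_sub_distrib, ← Finset.sum_filter]
      have h3 : (R.erase c).filter (· ∈ A) = A.erase c := by
        ext x; simp only [Finset.mem_filter, Finset.mem_erase]; constructor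
        · rintro ⟨⟨h1, h2⟩, h3⟩; exact ⟨h1, h3⟩
        · rintro ⟨h1, h3⟩; exact ⟨⟨h1, hA h3⟩, h3⟩
      rw [h3]
      simp only [sum_const, nsmul_eq_mul]
      rw [Finset.card_erase_of_mem hc, Finset.card_erase_of_mem hcR, Nat.cast_sub (by omega),
        Nat.cast_sub (by omega)]
      push_cast; ring
    rw [hs2] at hsum
    rw [div_le_iff₀ (by linarith), pow_succ]
    refine hsum.trans ?_
    rw [mul_comm, mul_assoc]
    refine mul_le_mul_of_nonneg_left ?_ (pow_nonneg hq0 _)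
    have hAa : (a:ℝ) ≤ A.card - 1 := by
      have : a + 1 ≤ A.card := by omega
      have : (a:ℝ) + 1 ≤ A.card := by exact_mod_cast this
      linarith
    have : (a:ℝ) / (4 * S) * (R.card - 1) ≤ a / 4 := by
      rw [div_mul_eq_mul_div, div_le_div_iff₀ (by linarith) (by norm_num)]
      nlinarith [Nat.cast_nonneg (α := ℝ) a]
    rw [hq]; linarith

end NoPair


section Explore
open Equiv Finset
variable {α V : Type*} [Fintype α] [DecidableEq α] [DecidableEq V]

/-- The clones of a variable. -/
def clonesOf (var : α → V) (v : V) : Finset α := univ.filter fun c => var c = v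

/-- Partial satisfiability: the matched pairs inside `X` are satisfied by an assignment that
respects the implications along the list `L` (later elements imply earlier ones). -/
def PSat (var : α → V) (X : Finset α) (L : List (V × Bool)) (m : Perm α) (s : α → Bool) : Prop :=
  ∃ a : V → Bool, (∀ c ∈ X, m c ∈ X → a (var c) = s c ∨ a (var (m c)) = s (m c)) ∧
    L.Pairwise (fun w' w => a w.1 = w.2 → a w'.1 = w'.2)

lemma exists_split (var : α → V) (M : ℕ) (L : List (V × Bool)) :
    ∀ (U : Finset α) (r r' : ℕ), (∀ c ∈ U, var c ∈ L.map Prod.fst) →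
      (∀ w ∈ L, (clonesOf var w.1).card ≤ M) → r + r' + M ≤ U.card →
      ∃ L₁ L₂, L = L₁ ++ L₂ ∧ r ≤ (U.filter fun c => var c ∈ L₁.map Prod.fst).card ∧
        r' ≤ (U.filter fun c => var c ∈ L₂.map Prod.fst).card := by
  induction L with
  | nil =>
    intro U r r' h _ hc
    have : U = ∅ := by
      rw [Finset.eq_empty_iff_forall_notMem]; intro c hc; simpa using h c hc
    subst this
    simp at hc
    exact ⟨[], [], rfl, by simp; omega, by simp; omega⟩
  | cons w L ih =>
    intro U r r' h hM hc
    set Uw := U.filter fun c => var c = w.1 with hUw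
    set U' := U.filter fun c => ¬ var c = w.1 with hU'
    have hsum : Uw.card + U'.card = U.card := Finset.card_filter_add_card_filter_not _
    have hx : Uw.card ≤ M := by
      refine le_trans (Finset.card_le_card ?_) (hM w (by simp))
      intro c hc; simp [clonesOf, hUw] at hc ⊢; exact hc.2
    have hU'L : ∀ c ∈ U', var c ∈ L.map Prod.fst := by
      intro c hc
      simp only [hU', Finset.mem_filter] at hc
      have := h c hc.1
      simp only [List.map_cons, List.mem_cons] at this
      exact this.resolve_left hc.2
    by_cases hr : r ≤ Uw.card
    · refine ⟨[w], L, rfl, ?_, ?_⟩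
      · simpa using hr
      · have : U'.card ≤ (U.filter fun c => var c ∈ L.map Prod.fst).card := by
          refine Finset.card_le_card fun c hc => ?_
          rw [Finset.mem_filter]
          exact ⟨(Finset.mem_filter.1 hc).1, hU'L c hc⟩
        omega
    · obtain ⟨L₁, L₂, hL, h1, h2⟩ := ih U' (r - Uw.card) r' hU'L
        (fun w' hw' => hM w' (by simp [hw'])) (by omega)
      refine ⟨w :: L₁, L₂, by simp [hL], ?_, ?_⟩
      · have : (U.filter fun c => var c ∈ (w :: L₁).map Prod.fst).card ≥
            Uw.card + (U'.filter fun c => var c ∈ L₁.map Prod.fst).card := by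
          rw [← Finset.card_union_of_disjoint]
          · refine Finset.card_le_card ?_
            intro c hc
            simp only [hUw, hU', Finset.mem_union, Finset.mem_filter, List.map_cons,
              List.mem_cons] at hc ⊢
            tauto
          · rw [Finset.disjoint_left]
            intro c hc hc'
            simp only [hUw, hU', Finset.mem_filter] at hc hc'
            exact hc'.1.2 hc.2
        omega
      · refine h2.trans (Finset.card_le_card ?_)
        intro c hc
        simp only [hU', Finset.mem_filter] at hc ⊢
        tauto

lemma prob_final (var : α → V) (M S j a : ℕ) (R X U : Finset α) (L : List (V × Bool))
    (hR : Even R.card) (hS : R.card ≤ S) (hX : X ⊆ R) (hU : U ⊆ X)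
    (hUL : ∀ c ∈ U, var c ∈ L.map Prod.fst)
    (hM : ∀ w ∈ L, (clonesOf var w.1).card ≤ M) (hc : 2 * (2 * j + a) + M ≤ U.card) :
    prob R (PSat var X L) ≤ 2 * (1 - a / (4 * S)) ^ j := by
  obtain ⟨L₁, L₂, rfl, h1, h2⟩ := exists_split var M L U (2*j+a) (2*j+a) hUL hM (by omega)
  have hch : ∀ (L : List (V × Bool)), ∃ g : α → Bool, ∀ c, var c ∈ L.map Prod.fst →
      ∃ w ∈ L, w.1 = var c ∧ w.2 = g c := by
    intro L
    have : ∀ c, ∃ b : Bool, var c ∈ L.map Prod.fst → ∃ w ∈ L, w.1 = var c ∧ w.2 = b := by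
      intro c
      by_cases h : var c ∈ L.map Prod.fst
      · obtain ⟨w, hw, hwc⟩ := List.mem_map.1 h
        exact ⟨w.2, fun _ => ⟨w, hw, hwc, rfl⟩⟩
      · exact ⟨true, fun h' => absurd h' h⟩
    choose g hg using this
    exact ⟨g, hg⟩
  obtain ⟨g₁, hg₁⟩ := hch L₁
  obtain ⟨g₂, hg₂⟩ := hch L₂
  set U₁ := U.filter fun c => var c ∈ L₁.map Prod.fst
  set U₂ := U.filter fun c => var c ∈ L₂.map Prod.fst
  have hU₁ : U₁ ⊆ R := (Finset.filter_subset _ _).trans (hU.trans hX)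
  have hU₂ : U₂ ⊆ R := (Finset.filter_subset _ _).trans (hU.trans hX)
  have p1 := prob_noPair S a (fun c => !g₁ c) j R U₁ hR hS hU₁ h1
  have p2 := prob_noPair S a g₂ j R U₂ hR hS hU₂ h2
  rw [two_mul]
  refine le_trans (le_trans (prob_mono ?_) (prob_or R _ _)) (add_le_add p1 p2)
  rintro m hm s ⟨a, ha, hpw⟩
  rw [List.pairwise_append] at hpw
  obtain ⟨-, -, hpw⟩ := hpw
  by_cases hall : ∀ w ∈ L₁, a w.1 = w.2
  · left
    rintro c hc hmc ⟨e1, e2⟩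
    have hc' := Finset.mem_filter.1 hc
    have hmc' := Finset.mem_filter.1 hmc
    obtain ⟨w, hw, hw1, hw2⟩ := hg₁ c hc'.2
    obtain ⟨w', hw', hw1', hw2'⟩ := hg₁ (m c) hmc'.2
    have f1 := hall w hw
    have f2 := hall w' hw'
    rw [hw1, hw2] at f1; rw [hw1', hw2'] at f2
    rcases ha c (hU hc'.1) (hU hmc'.1) with h | h
    · rw [f1, e1] at h; cases g₁ c <;> simp at h
    · rw [f2, e2] at h; cases g₁ (m c) <;> simp at h
  · right
    push Not at hall
    obtain ⟨w0, hw0, hw0'⟩ := hall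
    have hfalse : ∀ w ∈ L₂, a w.1 ≠ w.2 := fun w hw h => hw0' (hpw w0 hw0 w hw h)
    rintro c hc hmc ⟨e1, e2⟩
    have hc' := Finset.mem_filter.1 hc
    have hmc' := Finset.mem_filter.1 hmc
    obtain ⟨w, hw, hw1, hw2⟩ := hg₂ c hc'.2
    obtain ⟨w', hw', hw1', hw2'⟩ := hg₂ (m c) hmc'.2
    have f1 := hfalse w hw
    have f2 := hfalse w' hw'
    rw [hw1, hw2] at f1; rw [hw1', hw2'] at f2
    rcases ha c (hU hc'.1) (hU hmc'.1) with h | h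
    · exact f1 (h.trans e1)
    · exact f2 (h.trans e2)

/-- Invariants of the exploration. -/
structure Inv (var : α → V) (M S : ℕ) (R X U : Finset α) (L : List (V × Bool)) (F : Finset V) :
    Prop where
  even : Even R.card
  le : R.card ≤ S
  XR : X ⊆ R
  UX : U ⊆ X
  UL : ∀ c ∈ U, var c ∈ L.map Prod.fst
  LM : ∀ w ∈ L, (clonesOf var w.1).card ≤ M
  FX : ∀ c, var c ∈ F → c ∈ X
  FL : ∀ w ∈ L, w.1 ∉ F
  FM : ∀ v ∈ F, (clonesOf var v).card ≤ M

/-- total excess degree of the fresh variables -/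
def freshSum (var : α → V) (F : Finset V) : ℕ :=
  ∑ v ∈ F, (clonesOf var v).card * ((clonesOf var v).card - 1)

lemma freshSum_erase (var : α → V) (F : Finset V) {v : V} (hv : v ∈ F) (M : ℕ)
    (h : (clonesOf var v).card ≤ M) : freshSum var F ≤ freshSum var (F.erase v) + M * M := by
  unfold freshSum
  rw [← Finset.add_sum_erase _ _ hv, add_comm]
  gcongr
  omega

lemma freshSum_eq (var : α → V) (F : Finset V) (R : Finset α) (hR : ∀ c, var c ∈ F → c ∈ R) :
    freshSum var F = ∑ c ∈ R.filter (fun c => var c ∈ F), ((clonesOf var (var c)).card - 1) := by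
  unfold freshSum
  have hm : ∀ c ∈ R.filter (fun c => var c ∈ F), var c ∈ F := by
    intro c hc; exact (Finset.mem_filter.1 hc).2
  rw [← Finset.sum_fiberwise_of_maps_to hm]
  refine Finset.sum_congr rfl fun v hv => ?_
  have : (R.filter (fun c => var c ∈ F)).filter (fun c => var c = v) = clonesOf var v := by
    ext c; simp only [Finset.mem_filter, clonesOf, Finset.mem_univ, true_and]
    constructor
    · exact fun h => h.2
    · rintro rfl; exact ⟨⟨hR c hv, hv⟩, rfl⟩
  rw [this]
  rw [Finset.sum_congr rfl (g := fun _ => (clonesOf var v).card - 1)]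
  · simp
  · intro c hc
    simp only [clonesOf, Finset.mem_filter, Finset.mem_univ, true_and] at hc
    rw [hc]

/-- Increment of the number of unexplored clones when the partner is `c'`. -/
noncomputable def incr (var : α → V) (U : Finset α) (F : Finset V) (c' : α) : ℝ :=
  if var c' ∈ F then (clonesOf var (var c')).card - 2 else if c' ∈ U then -2 else -1

lemma sum_incr (var : α → V) (R U : Finset α) (F : Finset V) (c : α) (hc : c ∈ U) (hU : U ⊆ R)
    (hUF : ∀ c ∈ U, var c ∉ F) (hF : ∀ c, var c ∈ F → c ∈ R) :
    -((R.card : ℝ) - 1) + freshSum var F - U.card ≤ ∑ c' ∈ R.erase c, incr var U F c' := by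
  have h : ∀ c' ∈ R.erase c, incr var U F c' =
      -1 + (if var c' ∈ F then (((clonesOf var (var c')).card - 1 : ℕ) : ℝ) else 0) -
        (if c' ∈ U then 1 else 0) := by
    intro c' _
    unfold incr
    by_cases h1 : var c' ∈ F
    · have h2 : c' ∉ U := fun h => hUF c' h h1
      have h3 : 1 ≤ (clonesOf var (var c')).card := Finset.card_pos.2 ⟨c', by simp [clonesOf]⟩
      simp only [h1, h2, if_true, if_false]
      rw [Nat.cast_sub h3]; push_cast; ring
    · by_cases h2 : c' ∈ U <;> simp [h1, h2]
      norm_num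
  rw [Finset.sum_congr rfl h, Finset.sum_sub_distrib, Finset.sum_add_distrib]
  have hcR := hU hc
  have e1 : ∑ c' ∈ R.erase c, (-1:ℝ) = -((R.card : ℝ) - 1) := by
    rw [Finset.sum_const, Finset.card_erase_of_mem hcR, nsmul_eq_mul,
      Nat.cast_sub (Finset.card_pos.2 ⟨c, hcR⟩)]
    push_cast; ring
  have e2 : ∑ c' ∈ R.erase c, (if var c' ∈ F then (((clonesOf var (var c')).card - 1 : ℕ) : ℝ) else 0)
      = freshSum var F := by
    rw [freshSum_eq var F (R.erase c), Nat.cast_sum, ← Finset.sum_filter]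
    intro x hx
    rw [Finset.mem_erase]
    refine ⟨?_, hF x hx⟩
    rintro rfl
    exact hUF _ hc hx
  have e3 : ∑ c' ∈ R.erase c, (if c' ∈ U then (1:ℝ) else 0) ≤ U.card := by
    rw [← Finset.sum_filter, Finset.sum_const, nsmul_eq_mul, mul_one]
    exact_mod_cast Finset.card_le_card (fun x hx => (Finset.mem_filter.1 hx).2)
  rw [e1, e2]
  linarith

end Explore


section Explore2
open Equiv Finset
variable {α V : Type*} [Fintype α] [DecidableEq α] [DecidableEq V]

lemma exp_neg_le {θ x B : ℝ} (hθ : 0 ≤ θ) (hx : |x| ≤ B) (hB : θ * B ≤ 1) :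
    Real.exp (-(θ * x)) ≤ 1 - θ * x + θ ^ 2 * B ^ 2 := by
  have h1 : |-(θ * x)| ≤ 1 := by
    rw [abs_neg, abs_mul, abs_of_nonneg hθ]
    exact (mul_le_mul_of_nonneg_left hx hθ).trans hB
  have h2 := Real.abs_exp_sub_one_sub_id_le h1
  have h3 := (abs_le.1 h2).2
  have h4 : (-(θ * x)) ^ 2 ≤ θ ^ 2 * B ^ 2 := by
    have : x ^ 2 ≤ B ^ 2 := by
      rw [← sq_abs x]; exact pow_le_pow_left₀ (abs_nonneg _) hx 2
    nlinarith [sq_nonneg θ]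
  linarith

lemma abs_incr_le (var : α → V) (U : Finset α) (F : Finset V) (M : ℕ)
    (hFM : ∀ v ∈ F, (clonesOf var v).card ≤ M) (c' : α) : |incr var U F c'| ≤ M + 2 := by
  unfold incr
  have hM0 : (0:ℝ) ≤ M := Nat.cast_nonneg _
  split_ifs with h1 h2
  · have h2 : ((clonesOf var (var c')).card : ℝ) ≤ M := by exact_mod_cast hFM _ h1
    have h3 : (0:ℝ) ≤ (clonesOf var (var c')).card := Nat.cast_nonneg _
    rw [abs_le]; constructor <;> linarith
  · rw [abs_le]; constructor <;> linarith
  · rw [abs_le]; constructor <;> linarith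

/-- The claim proved by induction on the number `k` of remaining exploration steps. -/
def Claim (var : α → V) (M S K t k : ℕ) (θ q err : ℝ) : Prop :=
  ∀ (R X U : Finset α) (L : List (V × Bool)) (F : Finset V), Inv var M S R X U L F →
    K + k * (2 * (M * M + M)) + U.card ≤ freshSum var F →
    prob R (PSat var X L) ≤ Real.exp (θ * (t - U.card)) * q ^ k + err

lemma even_erase2 {R : Finset α} {c c' : α} (hR : Even R.card) (hcR : c ∈ R)
    (hc' : c' ∈ R.erase c) : Even ((R.erase c).erase c').card := by
  have := card_erase2 hcR hc'
  rw [← this] at hR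
  exact (Nat.even_add.1 hR).2 (by decide)

lemma step_query (var : α → V) (M S K t k : ℕ) (θ q err : ℝ)
    (H : Claim var M S K t k θ q err) (R X U : Finset α)
    (L : List (V × Bool)) (w : V × Bool) (F : Finset V) (hI : Inv var M S R X U (w :: L) F)
    (hK : K + k * (2 * (M * M + M)) + (M * M + M) + U.card ≤ freshSum var F)
    (c : α) (hc : c ∈ U) (hcw : var c = w.1) (c' : α) (hc' : c' ∈ R.erase c) :
    prob ((R.erase c).erase c') (fun m s => PSat var X (w :: L) (m * swap c c')
      (Function.update s c (!w.2))) ≤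
      Real.exp (θ * (t - (U.card + incr var U F c'))) * q ^ k + err := by
  have hcX := hI.UX hc
  have hcR := hI.XR hcX
  have hne : c' ≠ c := (Finset.mem_erase.1 hc').1
  have hc'R : c' ∈ R := (Finset.mem_erase.1 hc').2
  have hcc := card_erase2 hcR hc'
  have hev := even_erase2 hI.even hcR hc'
  have hcF : var c ∉ F := by rw [hcw]; exact hI.FL w (by simp)
  have hUF : ∀ x ∈ U, var x ∉ F := by
    intro x hx
    obtain ⟨w', hw', hw2⟩ := List.mem_map.1 (hI.UL x hx)
    rw [← hw2]; exact hI.FL w' hw'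
  have hXR'' : (X.erase c).erase c' ⊆ (R.erase c).erase c' :=
    Finset.erase_subset_erase _ (Finset.erase_subset_erase _ hI.XR)
  have hUc := Finset.card_erase_add_one hc
  by_cases hF : var c' ∈ F
  · have hc'U : c' ∉ U := fun h => hUF c' h hF
    have hincr : incr var U F c' = (clonesOf var (var c')).card - 2 := by simp [incr, hF]
    have hd1 : 1 ≤ (clonesOf var (var c')).card := Finset.card_pos.2 ⟨c', by simp [clonesOf]⟩
    have hdM := hI.FM _ hF
    have key : ∀ b' : Bool, prob ((R.erase c).erase c') (fun m s => PSat var X (w :: L)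
        (m * swap c c') (Function.update (Function.update s c' b') c (!w.2))) ≤
        Real.exp (θ * (t - (U.card + incr var U F c'))) * q ^ k + err := by
      intro b'
      set U'' := U.erase c ∪ (clonesOf var (var c')).erase c' with hU''
      have hdisj : Disjoint (U.erase c) ((clonesOf var (var c')).erase c') := by
        rw [Finset.disjoint_left]
        intro x hx hx'
        simp only [Finset.mem_erase, clonesOf, Finset.mem_filter, Finset.mem_univ, true_and] at hx hx'
        exact hUF x hx.2 (hx'.2 ▸ hF)
      have hcard : U''.card + 2 = U.card + (clonesOf var (var c')).card := by
        rw [hU'', Finset.card_union_of_disjoint hdisj]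
        have := Finset.card_erase_add_one (s := clonesOf var (var c')) (a := c') (by simp [clonesOf])
        omega
      have hI'' : Inv var M S ((R.erase c).erase c') ((X.erase c).erase c') U''
          ((var c', b') :: w :: L) (F.erase (var c')) := by
        refine ⟨hev, by have := hI.le; omega, hXR'', ?_, ?_, ?_, ?_, ?_, ?_⟩
        · intro x hx
          rw [hU'', Finset.mem_union] at hx
          simp only [Finset.mem_erase, clonesOf, Finset.mem_filter, Finset.mem_univ, true_and] at hx ⊢
          rcases hx with hx | hx
          · exact ⟨fun h => hc'U (h ▸ hx.2), hx.1, hI.UX hx.2⟩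
          · exact ⟨hx.1, fun h => hcF (by rw [← h, hx.2]; exact hF), hI.FX x (by rw [hx.2]; exact hF)⟩
        · intro x hx
          rw [hU'', Finset.mem_union] at hx
          simp only [Finset.mem_erase, clonesOf, Finset.mem_filter, Finset.mem_univ, true_and] at hx
          rw [List.map_cons, List.mem_cons]
          rcases hx with hx | hx
          · exact Or.inr (hI.UL x hx.2)
          · exact Or.inl hx.2
        · intro w' hw'
          rw [List.mem_cons] at hw'
          rcases hw' with rfl | hw'
          · exact hdM
          · exact hI.LM w' hw'
        · intro x hx
          simp only [Finset.mem_erase] at hx ⊢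
          exact ⟨fun h => hx.1 (by rw [h]), fun h => hcF (h ▸ hx.2), hI.FX x hx.2⟩
        · intro w' hw'
          rw [List.mem_cons] at hw'
          rcases hw' with rfl | hw'
          · simp
          · exact fun h => hI.FL w' hw' (Finset.mem_of_mem_erase h)
        · intro v hv
          exact hI.FM v (Finset.mem_of_mem_erase hv)
      have hfs := freshSum_erase var F hF M hdM
      have := H _ _ _ _ _ hI'' (by omega)
      have hcr : (U''.card : ℝ) = U.card + incr var U F c' := by
        rw [hincr]
        have : (U''.card : ℝ) + 2 = U.card + (clonesOf var (var c')).card := by exact_mod_cast hcard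
        linarith
      rw [hcr] at this
      refine le_trans (prob_mono ?_) this
      rintro m hm s ⟨a, ha, hpw⟩
      refine ⟨a, ?_, ?_⟩
      · intro x hx hmx
        have hxR := hXR'' hx
        have := ha x (by simp at hx; exact hx.2.2)
        rw [swap_apply_other hxR] at this
        have := this (by simp at hmx; exact hmx.2.2)
        simp only [Finset.mem_erase] at hx hmx
        rwa [Function.update_of_ne hx.2.1, Function.update_of_ne hx.1,
          Function.update_of_ne hmx.2.1, Function.update_of_ne hmx.1] at this
      · have h0 := ha c hcX
        rw [swap_apply_c hm] at h0
        have h0 := h0 (hI.FX c' hF)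
        rw [Function.update_self, Function.update_of_ne hne, Function.update_self, hcw] at h0
        have hstep : a w.1 = w.2 → a (var c') = b' := by
          intro h
          rw [h] at h0
          rcases h0 with h0 | h0
          · cases h2 : w.2 <;> simp [h2] at h0
          · exact h0
        refine List.pairwise_cons.2 ⟨?_, hpw⟩
        intro x hx
        rw [List.mem_cons] at hx
        rcases hx with rfl | hx
        · exact hstep
        · exact fun h => hstep ((List.pairwise_cons.1 hpw).1 x hx h)
    rw [prob_sign _ c' _ true]
    have k1 := key true
    have k2 := key false
    simp only [Bool.not_true] at *
    linarith
  · set U'' := (U.erase c).erase c' with hU''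
    have hI'' : Inv var M S ((R.erase c).erase c') ((X.erase c).erase c') U'' (w :: L) F := by
      refine ⟨hev, by have := hI.le; omega, hXR'', ?_, ?_, hI.LM, ?_, hI.FL, hI.FM⟩
      · exact Finset.erase_subset_erase _ (Finset.erase_subset_erase _ hI.UX)
      · intro x hx
        exact hI.UL x (Finset.mem_of_mem_erase (Finset.mem_of_mem_erase hx))
      · intro x hx
        simp only [Finset.mem_erase]
        exact ⟨fun h => hF (h ▸ hx), fun h => hcF (h ▸ hx), hI.FX x hx⟩
    have hle : U''.card ≤ U.card :=
      Finset.card_le_card ((Finset.erase_subset _ _).trans (Finset.erase_subset _ _))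
    have := H _ _ _ _ _ hI'' (by omega)
    have hcr : (U''.card : ℝ) = U.card + incr var U F c' := by
      unfold incr
      by_cases hc'U : c' ∈ U
      · have : U''.card + 2 = U.card := by
          have := Finset.card_erase_add_one (s := U.erase c) (a := c') (by simp [hne, hc'U])
          rw [← hU''] at this
          omega
        have : (U''.card : ℝ) + 2 = U.card := by exact_mod_cast this
        simp only [hF, hc'U, if_true, if_false]; linarith
      · have : U''.card + 1 = U.card := by
          rw [hU'', Finset.erase_eq_of_notMem (a := c')]
          · exact hUc
          · simp [hc'U]
        have : (U''.card : ℝ) + 1 = U.card := by exact_mod_cast this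
        simp only [hF, hc'U, if_false]; linarith
    rw [hcr] at this
    refine le_trans (prob_mono ?_) this
    rintro m hm s ⟨a, ha, hpw⟩
    refine ⟨a, ?_, hpw⟩
    intro x hx hmx
    have hxR := hXR'' hx
    have := ha x (by simp at hx; exact hx.2.2)
    rw [swap_apply_other hxR] at this
    have := this (by simp at hmx; exact hmx.2.2)
    simp only [Finset.mem_erase] at hx hmx
    rwa [Function.update_of_ne hx.2.1, Function.update_of_ne hmx.2.1] at this

lemma step_pos (var : α → V) (M S K t k : ℕ) (θ q err : ℝ)
    (H : Claim var M S K t k θ q err) (R X U : Finset α)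
    (L : List (V × Bool)) (w : V × Bool) (F : Finset V) (hI : Inv var M S R X U (w :: L) F)
    (hK : K + k * (2 * (M * M + M)) + (M * M + M) + U.card ≤ freshSum var F)
    (c : α) (hc : c ∈ U) (hcw : var c = w.1) :
    prob R (fun m s => PSat var X (w :: L) m (Function.update s c w.2)) ≤
      Real.exp (θ * (t - (U.card - 1))) * q ^ k + err := by
  have hcF : var c ∉ F := by rw [hcw]; exact hI.FL w (by simp)
  have hUc := Finset.card_erase_add_one hc
  have hI'' : Inv var M S R (X.erase c) (U.erase c) (w :: L) F := by
    refine ⟨hI.even, hI.le, (Finset.erase_subset _ _).trans hI.XR,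
      Finset.erase_subset_erase _ hI.UX, ?_, hI.LM, ?_, hI.FL, hI.FM⟩
    · intro x hx; exact hI.UL x (Finset.mem_of_mem_erase hx)
    · intro x hx
      exact Finset.mem_erase.2 ⟨fun h => hcF (h ▸ hx), hI.FX x hx⟩
  have := H _ _ _ _ _ hI'' (by omega)
  have hcr : ((U.erase c).card : ℝ) = U.card - 1 := by
    have : ((U.erase c).card : ℝ) + 1 = U.card := by exact_mod_cast hUc
    linarith
  rw [hcr] at this
  refine le_trans (prob_mono ?_) this
  rintro m hm s ⟨a, ha, hpw⟩
  refine ⟨a, ?_, hpw⟩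
  intro x hx hmx
  simp only [Finset.mem_erase] at hx hmx
  have := ha x hx.2 hmx.2
  rwa [Function.update_of_ne hx.1, Function.update_of_ne hmx.1] at this

lemma step (var : α → V) (M S K t k : ℕ) (θ q err ε : ℝ) (hθ : 0 ≤ θ) (hθM : θ * (M + 2) ≤ 1)
    (hq0 : 0 ≤ q)
    (hq : 1 - θ * ε / 2 + θ ^ 2 * (M + 2) ^ 2 ≤ q) (hε : 0 ≤ ε) (hKS : (2 + ε) * S ≤ K)
    (H : Claim var M S K t k θ q err) (R X U : Finset α)
    (L : List (V × Bool)) (w : V × Bool) (F : Finset V) (hI : Inv var M S R X U (w :: L) F)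
    (hK : K + k * (2 * (M * M + M)) + (M * M + M) + U.card ≤ freshSum var F)
    (c : α) (hc : c ∈ U) (hcw : var c = w.1) :
    prob R (PSat var X (w :: L)) ≤ Real.exp (θ * (t - U.card)) * q ^ (k + 1) + err := by
  have hcR := hI.XR (hI.UX hc)
  have hUF : ∀ x ∈ U, var x ∉ F := by
    intro x hx
    obtain ⟨w', hw', hw2⟩ := List.mem_map.1 (hI.UL x hx)
    rw [← hw2]; exact hI.FL w' hw'
  have hp := step_pos var M S K t k θ q err H R X U L w F hI hK c hc hcw
  rw [prob_sign R c _ w.2, prob_match hcR (fun m s => PSat var X (w :: L) m (Function.update s c (!w.2)))]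
  have hs := Finset.sum_le_sum fun c' hc' =>
    step_query var M S K t k θ q err H R X U L w F hI hK c hc hcw c' hc'
  have hR2 : 2 ≤ R.card := by
    obtain ⟨r, hr⟩ := hI.even
    have := Finset.card_pos.2 ⟨c, hcR⟩
    omega
  have hr : (0:ℝ) < (R.card : ℝ) - 1 := by
    have : (2:ℝ) ≤ R.card := by exact_mod_cast hR2
    linarith
  have hrS : (R.card : ℝ) - 1 ≤ S := by
    have : (R.card : ℝ) ≤ S := by exact_mod_cast hI.le
    linarith
  have hcardE : ((R.erase c).card : ℝ) = R.card - 1 := by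
    rw [Finset.card_erase_of_mem hcR, Nat.cast_sub (by omega)]; simp
  set A := Real.exp (θ * (t - U.card)) with hA
  have hA0 : 0 < A := Real.exp_pos _
  have hs' : ∑ c' ∈ R.erase c, (Real.exp (θ * (t - (U.card + incr var U F c'))) * q ^ k + err) ≤
      ∑ c' ∈ R.erase c,
        (A * q ^ k * (1 - θ * incr var U F c' + θ ^ 2 * ((M:ℝ) + 2) ^ 2) + err) := by
    refine Finset.sum_le_sum fun c' _ => ?_
    have h1 := exp_neg_le hθ (abs_incr_le var U F M hI.FM c') hθM
    have h2 : θ * (t - (U.card + incr var U F c')) = θ * (t - U.card) + -(θ * incr var U F c') := by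
      ring
    rw [h2, Real.exp_add, ← hA]
    have := mul_le_mul_of_nonneg_left h1 (mul_nonneg hA0.le (pow_nonneg hq0 k))
    linarith
  have hs3 := hs.trans hs'
  have heq : ∑ c' ∈ R.erase c,
        (A * q ^ k * (1 - θ * incr var U F c' + θ ^ 2 * ((M:ℝ) + 2) ^ 2) + err) =
      A * q ^ k * (((R.card:ℝ) - 1) * (1 + θ ^ 2 * ((M:ℝ) + 2) ^ 2) -
        θ * ∑ c' ∈ R.erase c, incr var U F c') + (R.card - 1) * err := by
    rw [Finset.sum_add_distrib, ← Finset.mul_sum, Finset.sum_add_distrib, Finset.sum_sub_distrib,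
      ← Finset.mul_sum]
    simp only [Finset.sum_const, nsmul_eq_mul, hcardE]
    ring
  rw [heq] at hs3
  have hinc := sum_incr var R U F c hc (hI.UX.trans hI.XR) hUF (fun x hx => hI.XR (hI.FX x hx))
  have hfs : (2 + ε) * S + U.card ≤ freshSum var F := by
    have : K + U.card ≤ freshSum var F := by omega
    have : (K : ℝ) + U.card ≤ freshSum var F := by exact_mod_cast this
    linarith
  have hinc2 : ((R.card:ℝ) - 1) * (1 + ε) ≤ ∑ c' ∈ R.erase c, incr var U F c' := by
    nlinarith
  have hpos : Real.exp (θ * (t - (U.card - 1))) * q ^ k + err ≤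
      A * q ^ k * (1 + θ + θ ^ 2 * ((M:ℝ) + 2) ^ 2) + err := by
    have h1 := exp_neg_le (x := -1) (B := (M:ℝ) + 2) hθ (by
      rw [abs_neg, abs_one]; linarith [Nat.cast_nonneg (α := ℝ) M]) hθM
    have h2 : θ * ((t:ℝ) - (U.card - 1)) = θ * (t - U.card) + -(θ * -1) := by ring
    rw [h2, Real.exp_add, ← hA]
    have := mul_le_mul_of_nonneg_left h1 (mul_nonneg hA0.le (pow_nonneg hq0 k))
    linarith
  have hquot : (∑ c' ∈ R.erase c, prob ((R.erase c).erase c') (fun m s => PSat var X (w :: L)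
      (m * swap c c') (Function.update s c (!w.2)))) / ((R.card : ℝ) - 1) ≤
      A * q ^ k * (1 + θ ^ 2 * ((M:ℝ) + 2) ^ 2 - θ * (1 + ε)) + err := by
    rw [div_le_iff₀ hr]
    refine hs3.trans ?_
    have hB : 0 ≤ A * q ^ k := mul_nonneg hA0.le (pow_nonneg hq0 k)
    have := mul_le_mul_of_nonneg_left hinc2 (mul_nonneg hB hθ)
    linarith
  have hB : 0 ≤ A * q ^ k := mul_nonneg hA0.le (pow_nonneg hq0 k)
  have hfin := mul_le_mul_of_nonneg_left hq hB
  rw [pow_succ]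
  linarith

lemma claim_all (var : α → V) (M S K j a k : ℕ) (θ q ε : ℝ) (hθ : 0 ≤ θ)
    (hθM : θ * (M + 2) ≤ 1) (hq0 : 0 ≤ q)
    (hq : 1 - θ * ε / 2 + θ ^ 2 * (M + 2) ^ 2 ≤ q) (hε : 0 ≤ ε) (hKS : (2 + ε) * S ≤ K)
    (hK0 : 0 < K) (haS : a ≤ S) :
    Claim var M S K (2 * (2 * j + a) + M) k θ q (2 * (1 - a / (4 * S)) ^ j) := by
  have herr : (0:ℝ) ≤ 2 * (1 - a / (4 * S)) ^ j := by
    have : (a:ℝ) / (4 * S) ≤ 1 := by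
      apply div_le_one_of_le₀ _ (by positivity)
      have : (a:ℝ) ≤ S := by exact_mod_cast haS
      linarith [Nat.cast_nonneg (α := ℝ) S]
    have : (0:ℝ) ≤ 1 - a / (4 * S) := by linarith
    positivity
  induction k with
  | zero =>
    intro R X U L F hI _
    by_cases hU : 2 * (2 * j + a) + M ≤ U.card
    · have := prob_final var M S j a R X U L hI.even hI.le hI.XR hI.UX hI.UL hI.LM hU
      have h2 := (Real.exp_pos (θ * (((2 * (2 * j + a) + M : ℕ) : ℝ) - U.card))).le
      rw [pow_zero, mul_one]
      linarith
    · have h1 := prob_le_one hI.even (PSat var X L)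
      have h2 : (U.card : ℝ) ≤ ((2 * (2 * j + a) + M : ℕ) : ℝ) := by exact_mod_cast (by omega)
      have h3 : 1 ≤ Real.exp (θ * (((2 * (2 * j + a) + M : ℕ) : ℝ) - U.card)) :=
        Real.one_le_exp (mul_nonneg hθ (by linarith))
      rw [pow_zero, mul_one]
      linarith
  | succ k ih =>
    intro R X U L F hI hK
    have hK' : K + k * (2 * (M * M + M)) + 2 * (M * M + M) + U.card ≤ freshSum var F := by
      have : (k + 1) * (2 * (M * M + M)) = k * (2 * (M * M + M)) + 2 * (M * M + M) := by ring
      omega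
    induction L with
    | nil =>
      have hU : U = ∅ := by
        rw [Finset.eq_empty_iff_forall_notMem]; intro c hc; simpa using hI.UL c hc
      subst hU
      have : ∃ v ∈ F, (clonesOf var v).card * ((clonesOf var v).card - 1) ≠ 0 := by
        by_contra hcon
        push Not at hcon
        have : freshSum var F = 0 := Finset.sum_eq_zero hcon
        omega
      obtain ⟨v, hv, hd⟩ := this
      have hd' : (clonesOf var v).card ≠ 0 := fun h => hd (by simp [h])
      obtain ⟨c, hc⟩ := Finset.card_pos.1 (Nat.pos_of_ne_zero hd')
      have hcv : var c = v := by simpa [clonesOf] using hc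
      have hI' : Inv var M S R X (clonesOf var v) [(v, true)] (F.erase v) := by
        refine ⟨hI.even, hI.le, hI.XR, ?_, ?_, ?_, ?_, ?_, ?_⟩
        · intro x hx
          have : var x = v := by simpa [clonesOf] using hx
          exact hI.FX x (this ▸ hv)
        · intro x hx
          have : var x = v := by simpa [clonesOf] using hx
          simp [this]
        · intro w hw
          rw [List.mem_singleton] at hw; subst hw
          exact hI.FM v hv
        · intro x hx; exact hI.FX x (Finset.mem_of_mem_erase hx)
        · intro w hw
          rw [List.mem_singleton] at hw; subst hw
          simp
        · intro u hu; exact hI.FM u (Finset.mem_of_mem_erase hu)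
      have hfs := freshSum_erase var F hv M (hI.FM v hv)
      have hvM := hI.FM v hv
      simp only [Finset.card_empty, add_zero] at hK'
      have := step var M S K _ k θ q _ ε hθ hθM hq0 hq hε hKS ih R X (clonesOf var v) [] (v, true)
        (F.erase v) hI' (by omega) c hc hcv
      have h1 : Real.exp (θ * (((2 * (2 * j + a) + M : ℕ) : ℝ) - (clonesOf var v).card)) ≤
          Real.exp (θ * (((2 * (2 * j + a) + M : ℕ) : ℝ) - (∅ : Finset α).card)) := by
        apply Real.exp_le_exp.2
        apply mul_le_mul_of_nonneg_left _ hθ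
        simp
      have h2 := mul_le_mul_of_nonneg_right h1 (pow_nonneg hq0 (k+1))
      refine le_trans (prob_mono ?_) (this.trans (by linarith))
      rintro m hm s ⟨a, ha, -⟩
      exact ⟨a, ha, List.pairwise_singleton _ _⟩
    | cons w L ihL =>
      by_cases hw : ∃ c ∈ U, var c = w.1
      · obtain ⟨c, hc, hcw⟩ := hw
        exact step var M S K _ k θ q _ ε hθ hθM hq0 hq hε hKS ih R X U L w F hI (by omega) c hc hcw
      · push Not at hw
        have hI' : Inv var M S R X U L F := by
          refine ⟨hI.even, hI.le, hI.XR, hI.UX, ?_, fun w' hw' => hI.LM w' (by simp [hw']), hI.FX,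
            fun w' hw' => hI.FL w' (by simp [hw']), hI.FM⟩
          intro c hc
          have := hI.UL c hc
          rw [List.map_cons, List.mem_cons] at this
          exact this.resolve_left (hw c hc)
        refine le_trans (prob_mono ?_) (ihL hI')
        rintro m hm s ⟨a, ha, hpw⟩
        exact ⟨a, ha, (List.pairwise_cons.1 hpw).2⟩

end Explore2


section UnsatB
open Equiv Finset

/-- Satisfiability in terms of the matching and the signs. -/
def Sat {α V : Type*} (var : α → V) (m : Perm α) (s : α → Bool) : Prop :=
  ∃ a : V → Bool, ∀ c, a (var c) = s c ∨ a (var (m c)) = s (m c)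

lemma one_sub_pow_le_exp {x : ℝ} (hx : x ≤ 1) (j : ℕ) : (1 - x) ^ j ≤ Real.exp (-(x * j)) := by
  have h1 : 1 - x ≤ Real.exp (-x) := by have := Real.add_one_le_exp (-x); linarith
  calc (1 - x) ^ j ≤ (Real.exp (-x)) ^ j := pow_le_pow_left₀ (by linarith) h1 j
    _ = Real.exp (-(x * j)) := by rw [← Real.exp_nat_mul]; congr 1; ring

lemma tendsto_exp_lin (a b : ℝ) (hb : 0 < b) :
    Tendsto (fun S : ℕ => Real.exp (a - b * S)) atTop (nhds 0) := by
  apply Real.tendsto_exp_atBot.comp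
  have : Tendsto (fun S : ℕ => b * (S:ℝ)) atTop atTop :=
    (tendsto_natCast_atTop_atTop).const_mul_atTop hb
  have h2 := tendsto_neg_atTop_atBot.comp this
  have h3 := tendsto_atBot_add_const_left atTop a h2
  refine h3.congr fun S => ?_
  simp [sub_eq_add_neg]

set_option maxHeartbeats 1000000 in
theorem unsat_B (ε : ℝ) (hε : 0 < ε) (M : ℕ) (η : ℝ) (hη : 0 < η) :
    ∃ S0 : ℕ, ∀ (α V : Type) [Fintype α] [DecidableEq α] [DecidableEq V] (var : α → V)
      (F : Finset V), S0 ≤ Fintype.card α → Even (Fintype.card α) →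
      (∀ v ∈ F, (clonesOf var v).card ≤ M) →
      (2 + ε) * Fintype.card α ≤ freshSum var F →
      prob univ (Sat var) ≤ η := by
  obtain ⟨e, he0, he1, heε⟩ : ∃ e : ℝ, 0 < e ∧ e ≤ 1 ∧ e ≤ ε :=
    ⟨min ε 1, lt_min hε one_pos, min_le_right _ _, min_le_left _ _⟩
  set N : ℝ := M + 2 with hN
  have hN2 : 2 ≤ N := by have : (0:ℝ) ≤ M := Nat.cast_nonneg _; linarith
  have hN0 : 0 < N := by linarith
  set θ : ℝ := (e / 2) / (4 * N ^ 2) with hθ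
  have hθ0 : 0 < θ := by positivity
  set σ : ℝ := (e / 2) ^ 2 / (16 * N ^ 2) with hσ
  have hσ0 : 0 < σ := by positivity
  have hσ1 : σ ≤ 1 := by
    rw [hσ, div_le_one (by positivity)]; nlinarith
  set κ : ℝ := e / (8 * N ^ 2) with hκ
  have hκ0 : 0 < κ := by positivity
  obtain ⟨γ, hγ0, hγ1, hγ⟩ : ∃ γ : ℝ, 0 < γ ∧ γ ≤ 1 ∧ θ * 6 * γ ≤ σ * κ / 2 := by
    refine ⟨min (σ * κ / (12 * θ)) 1, lt_min (by positivity) one_pos, min_le_right _ _, ?_⟩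
    calc θ * 6 * min (σ * κ / (12 * θ)) 1 ≤ θ * 6 * (σ * κ / (12 * θ)) := by
          gcongr; exact min_le_left _ _
      _ = σ * κ / 2 := by field_simp; ring
  have hlim : Tendsto (fun S : ℕ => Real.exp ((θ * M + σ) - (σ * κ / 2) * S) +
      2 * Real.exp (γ / 2 - (γ ^ 2 / 4) * S)) atTop (nhds 0) := by
    have := (tendsto_exp_lin (θ * M + σ) (σ * κ / 2) (by positivity)).add
      ((tendsto_exp_lin (γ / 2) (γ ^ 2 / 4) (by positivity)).const_mul 2)
    simpa using this
  have hev := (hlim.eventually (ge_mem_nhds hη)).and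
    ((tendsto_natCast_atTop_atTop (R := ℝ)).eventually (eventually_ge_atTop (4 / e + 1 / γ + 1)))
  obtain ⟨S0, hS0⟩ := eventually_atTop.1 hev
  refine ⟨S0, ?_⟩
  intro α V _ _ _ var F hS hE hF hfs
  set S := Fintype.card α with hSdef
  obtain ⟨hη', hbig⟩ := hS0 S hS
  have h4e : 0 < 4 / e := by positivity
  have h1γ : 0 < 1 / γ := by positivity
  have hSpos : (0:ℝ) < S := by linarith
  have heS : 4 ≤ e * S := by
    have : 4 / e ≤ S := by linarith
    rw [div_le_iff₀ he0] at this; linarith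
  have hγS : 1 ≤ γ * S := by
    have : 1 / γ ≤ S := by linarith
    rw [div_le_iff₀ hγ0] at this; linarith
  set k := ⌊κ * S⌋₊ with hk
  set j := ⌊γ * S⌋₊ with hj
  set K := ⌈(2 + e / 2) * S⌉₊ with hK
  have hk1 : (k:ℝ) ≤ κ * S := Nat.floor_le (by positivity)
  have hk2 : κ * S < k + 1 := Nat.lt_floor_add_one _
  have hj1 : (j:ℝ) ≤ γ * S := Nat.floor_le (by positivity)
  have hj2 : γ * S < j + 1 := Nat.lt_floor_add_one _
  have hK1 : (2 + e / 2) * S ≤ K := Nat.le_ceil _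
  have hK2 : (K:ℝ) < (2 + e / 2) * S + 1 := Nat.ceil_lt_add_one (by positivity)
  have hjS : j ≤ S := by
    have : (j:ℝ) ≤ S := hj1.trans (by nlinarith)
    exact_mod_cast this
  have hK0 : 0 < K := by
    have : (0:ℝ) < K := lt_of_lt_of_le (by positivity) hK1
    exact_mod_cast this
  have hcl := claim_all var M S K j j k θ (1 - σ) (e / 2) hθ0.le
    (by rw [← hN, hθ, div_mul_eq_mul_div, div_le_one (by positivity)]; nlinarith)
    (by linarith)
    (by
      rw [← hN]
      apply le_of_eq
      rw [hθ, hσ]; field_simp; ring)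
    (by positivity) hK1 hK0 hjS
  have hinv : Inv var M S univ univ ∅ [] F := by
    refine ⟨by simpa using hE, by simp [hSdef], subset_rfl, by simp, by simp, by simp,
      by simp, by simp, hF⟩
  have hcond : K + k * (2 * (M * M + M)) + (∅ : Finset α).card ≤ freshSum var F := by
    have : ((K + k * (2 * (M * M + M)) + (∅ : Finset α).card : ℕ) : ℝ) ≤ freshSum var F := by
      push_cast
      refine le_trans ?_ hfs
      have hM0 : (0:ℝ) ≤ M := Nat.cast_nonneg _
      have h1 : (k:ℝ) * (2 * (M * M + M)) ≤ e * S / 4 := by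
        calc (k:ℝ) * (2 * (M * M + M)) ≤ (κ * S) * (2 * N ^ 2) := by
              gcongr; rw [hN]; nlinarith
          _ = e * S / 4 := by rw [hκ]; field_simp; ring
      simp only [Finset.card_empty, Nat.cast_zero]
      have h2 : e * S ≤ ε * S := by gcongr
      linarith
    exact_mod_cast this
  have hp := hcl univ univ ∅ [] F hinv hcond
  have hmono : prob univ (Sat var) ≤ prob univ (PSat var univ []) := by
    apply prob_mono
    rintro m _ s ⟨a, ha⟩
    exact ⟨a, fun c _ _ => ha c, List.Pairwise.nil⟩
  refine hmono.trans (hp.trans (le_trans ?_ hη'))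
  have hA : Real.exp (θ * (((2 * (2 * j + j) + M : ℕ) : ℝ) - (∅ : Finset α).card)) * (1 - σ) ^ k
      ≤ Real.exp ((θ * M + σ) - (σ * κ / 2) * S) := by
    calc _ ≤ Real.exp (θ * (((2 * (2 * j + j) + M : ℕ) : ℝ) - (∅ : Finset α).card)) *
          Real.exp (-(σ * k)) := by gcongr; exact one_sub_pow_le_exp hσ1 k
      _ = Real.exp (θ * (6 * j + M) - σ * k) := by
        rw [← Real.exp_add]; congr 1; push_cast; simp only [Finset.card_empty, Nat.cast_zero]; ring
      _ ≤ _ := by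
        apply Real.exp_le_exp.2
        have h1 : θ * 6 * j ≤ σ * κ / 2 * S := by
          calc θ * 6 * j ≤ θ * 6 * (γ * S) := by gcongr
            _ = (θ * 6 * γ) * S := by ring
            _ ≤ _ := by gcongr
        have h2 : σ * (κ * S) ≤ σ * (k + 1) := by gcongr
        linarith
  have hB : (1 - (j:ℝ) / (4 * S)) ^ j ≤ Real.exp (γ / 2 - (γ ^ 2 / 4) * S) := by
    have hjSr : (j:ℝ) ≤ S := by exact_mod_cast hjS
    refine (one_sub_pow_le_exp (by rw [div_le_one (by positivity)]; linarith) j).trans ?_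
    apply Real.exp_le_exp.2
    have : (γ * S - 1) ^ 2 ≤ (j:ℝ) ^ 2 := by
      apply pow_le_pow_left₀ <;> linarith
    have h3 : γ ^ 2 / 4 * S - γ / 2 ≤ (j:ℝ) / (4 * S) * j := by
      rw [div_mul_eq_mul_div (j:ℝ), le_div_iff₀ (by positivity)]
      nlinarith
    linarith
  linarith

theorem unsat_C (η : ℝ) (hη : 0 < η) :
    ∃ K : ℝ, ∀ (α V : Type) [Fintype α] [DecidableEq α] [DecidableEq V] (var : α → V)
      (v : V), Even (Fintype.card α) → 0 < Fintype.card α →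
      K * Fintype.card α ≤ ((clonesOf var v).card : ℝ) ^ 2 →
      prob univ (Sat var) ≤ η := by
  have hlim := tendsto_exp_lin 0 1 one_pos
  obtain ⟨k0, hk0⟩ := eventually_atTop.1 (hlim.eventually (ge_mem_nhds (half_pos hη)))
  refine ⟨128 * (k0 + 1), ?_⟩
  intro α V _ _ _ var v hE hpos hd
  set S := Fintype.card α with hSdef
  set d := (clonesOf var v).card with hddef
  have hSr : (1:ℝ) ≤ S := by exact_mod_cast hpos
  have hdS : d ≤ S := Finset.card_le_univ _
  have hk00 : (0:ℝ) ≤ k0 := Nat.cast_nonneg _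
  have hd8 : (8:ℝ) ≤ d := by
    by_contra h
    push Not at h
    have : (0:ℝ) ≤ d := Nat.cast_nonneg _
    nlinarith
  set j := d / 4 with hj
  have hj1 : (d:ℝ) ≤ 4 * j + 4 := by
    have : d ≤ 4 * j + 4 := by omega
    exact_mod_cast this
  have hP : ∀ b : Bool, prob univ (NoPair (clonesOf var v) (fun _ => b)) ≤ η / 2 := by
    intro b
    refine (prob_noPair S j (fun _ => b) j univ (clonesOf var v) (by simpa using hE)
      (by simp [hSdef]) (subset_univ _) (by omega)).trans ?_
    have hjS : (j:ℝ) ≤ S := by exact_mod_cast (by omega : j ≤ S)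
    refine (one_sub_pow_le_exp (by rw [div_le_one (by positivity)]; linarith) j).trans ?_
    refine le_trans (Real.exp_le_exp.2 ?_) (hk0 k0 le_rfl)
    have hj8 : (d:ℝ) / 8 ≤ j := by linarith
    have hjd : (d:ℝ) ^ 2 / 64 ≤ (j:ℝ) ^ 2 := by
      have := pow_le_pow_left₀ (by positivity) hj8 2
      linarith
    have : (k0 : ℝ) ≤ (j:ℝ) / (4 * S) * j := by
      rw [div_mul_eq_mul_div, le_div_iff₀ (by positivity)]
      have : (0:ℝ) ≤ k0 * S := by positivity
      nlinarith
    linarith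
  have hmono : prob univ (Sat var) ≤ prob univ (fun m s =>
      NoPair (clonesOf var v) (fun _ => true) m s ∨ NoPair (clonesOf var v) (fun _ => false) m s) := by
    apply prob_mono
    rintro m _ s ⟨a, ha⟩
    cases hav : a v
    · left
      rintro c hc hmc ⟨h1, h2⟩
      simp [clonesOf] at hc hmc
      have := ha c
      rw [hc, hmc, h1, h2, hav] at this
      simp at this
    · right
      rintro c hc hmc ⟨h1, h2⟩
      simp [clonesOf] at hc hmc
      have := ha c
      rw [hc, hmc, h1, h2, hav] at this
      simp at this
  have := prob_or univ (NoPair (clonesOf var v) (fun _ => true))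
    (NoPair (clonesOf var v) (fun _ => false))
  linarith [hP true, hP false]

end UnsatB


section Trails
open Equiv Finset
variable {α : Type*} [Fintype α] [DecidableEq α]

lemma prob_and_compl (R : Finset α) (G H : Perm α → (α → Bool) → Prop) :
    prob R (fun m s => G m s ∧ H m s) + prob R (fun m s => G m s ∧ ¬ H m s) = prob R G := by
  classical
  unfold prob
  rw [← add_div, ← Finset.sum_add_distrib]
  congr 1
  refine Finset.sum_congr rfl fun m _ => ?_
  rw [← Finset.sum_add_distrib]
  refine Finset.sum_congr rfl fun s _ => ?_
  by_cases h1 : G m s <;> by_cases h2 : H m s <;> simp [h1, h2]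

lemma prob_neq (R : Finset α) (i o : α) (hio : i ≠ o) (G : Perm α → (α → Bool) → Prop)
    (hG : ∀ m s b, G m (Function.update s i b) ↔ G m s) :
    prob R (fun m s => s i ≠ s o ∧ G m s) = prob R G / 2 := by
  rw [prob_sign R i _ true]
  congr 1
  rw [← prob_and_compl R G (fun _ s => s o = false)]
  congr 1
  · apply prob_congr
    intro m _ s
    rw [hG, Function.update_self, Function.update_of_ne hio.symm]
    cases s o <;> simp
  · apply prob_congr
    intro m _ s
    rw [hG, Function.update_self, Function.update_of_ne hio.symm]
    cases s o <;> simp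

lemma prob_edge {R : Finset α} {c c' : α} (hc : c ∈ R) (hc' : c' ∈ R) (hne : c' ≠ c)
    (hR : 2 ≤ R.card) (E E' : Perm α → (α → Bool) → Prop)
    (hE : ∀ m ∈ matchings ((R.erase c).erase c'), ∀ s, E (m * swap c c') s → E' m s) :
    prob R (fun m s => m c = c' ∧ E m s) ≤ prob ((R.erase c).erase c') E' / ((R.card : ℝ) - 1) := by
  rw [prob_match hc]
  have : (2:ℝ) ≤ R.card := by exact_mod_cast hR
  apply div_le_div_of_nonneg_right _ (by linarith)
  rw [← Finset.add_sum_erase _ _ (by simp [hne, hc'] : c' ∈ R.erase c)]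
  have h0 : ∑ x ∈ (R.erase c).erase c', prob ((R.erase c).erase x)
      (fun m s => (m * swap c x) c = c' ∧ E (m * swap c x) s) = 0 := by
    apply Finset.sum_eq_zero
    intro x hx
    rw [← prob_false ((R.erase c).erase x)]
    apply prob_congr
    intro m hm s
    rw [swap_apply_c hm]
    have : x ≠ c' := (Finset.mem_erase.1 hx).1
    simp [this]
  rw [h0, add_zero]
  exact prob_mono fun m hm s h => hE m hm s h.2

/-- A trail: starting with the clone `u`, entering and leaving along the pairs of `t`. -/
def Trail (fin : α → Perm α → Prop) : α → List (α × α) → Perm α → (α → Bool) → Prop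
  | u, [], m, _ => fin u m
  | u, p :: t, m, s => m u = p.1 ∧ s p.1 ≠ s p.2 ∧ Trail fin p.2 t m s

/-- all clones in a list of pairs -/
def flat (t : List (α × α)) : List α := t.flatMap fun p => [p.1, p.2]

lemma flat_cons (p : α × α) (t : List (α × α)) : flat (p :: t) = p.1 :: p.2 :: flat t := rfl

lemma trail_update (fin : α → Perm α → Prop) (t : List (α × α)) : ∀ (u i : α) (m : Perm α)
    (s : α → Bool) (b : Bool), i ∉ flat t →
    (Trail fin u t m (Function.update s i b) ↔ Trail fin u t m s) := by
  induction t with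
  | nil => intros; rfl
  | cons p t ih =>
    intro u i m s b hi
    simp only [flat_cons, List.mem_cons, not_or] at hi
    unfold Trail
    rw [ih _ _ _ _ _ hi.2.2, Function.update_of_ne (Ne.symm hi.1), Function.update_of_ne (Ne.symm hi.2.1)]

lemma trail_swap (v : α) (t : List (α × α)) : ∀ (u c c' : α) (m : Perm α)
    (s : α → Bool), (∀ x ∈ u :: flat t, x ≠ c ∧ x ≠ c') →
    (Trail (fun u m => m u = v) u t (m * swap c c') s →
      Trail (fun u m => m u = v) u t m s) := by
  induction t with
  | nil =>
    intro u c c' m s h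
    have := h u (by simp)
    simp [Trail, swap_apply_of_ne_of_ne this.1 this.2]
  | cons p t ih =>
    intro u c c' m s h
    have hu := h u (by simp)
    unfold Trail
    rintro ⟨h1, h2, h3⟩
    refine ⟨?_, h2, ih _ _ _ _ _ ?_ h3⟩
    · simpa [swap_apply_of_ne_of_ne hu.1 hu.2] using h1
    · intro x hx
      apply h
      rw [flat_cons]; simp only [List.mem_cons] at hx ⊢; tauto

lemma trail_swap' (t : List (α × α)) : ∀ (u c c' : α) (m : Perm α)
    (s : α → Bool), (∀ x ∈ u :: flat t, x ≠ c ∧ x ≠ c') →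
    (Trail (fun _ _ => True) u t (m * swap c c') s →
      Trail (fun _ _ => True) u t m s) := by
  induction t with
  | nil =>
    intro u c c' m s h _
    trivial
  | cons p t ih =>
    intro u c c' m s h
    have hu := h u (by simp)
    unfold Trail
    rintro ⟨h1, h2, h3⟩
    refine ⟨?_, h2, ih _ _ _ _ _ ?_ h3⟩
    · simpa [swap_apply_of_ne_of_ne hu.1 hu.2] using h1
    · intro x hx
      apply h
      rw [flat_cons]; simp only [List.mem_cons] at hx ⊢; tauto

lemma prob_trail (v : α) (D : ℝ) (hD : 0 < D) (t : List (α × α)) : ∀ (u : α) (R : Finset α),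
    Even R.card → (∀ x ∈ u :: v :: flat t, x ∈ R) → (u :: v :: flat t).Nodup →
    D + 2 * t.length + 1 ≤ R.card →
    prob R (Trail (fun u m => m u = v) u t) ≤ (1 / (2 * D)) ^ t.length / D := by
  induction t with
  | nil =>
    intro u R hR hm hnd hc
    simp at hc
    have hu : u ∈ R := hm u (by simp)
    have hv : v ∈ R := hm v (by simp)
    have hne : v ≠ u := by rintro rfl; simp at hnd
    have h2 : 2 ≤ R.card := by
      have := Finset.card_le_card (s := {u, v}) (t := R) (by
        intro x hx; simp at hx; rcases hx with rfl | rfl <;> assumption)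
      rwa [Finset.card_pair hne.symm] at this
    have := prob_edge hu hv hne h2 (fun _ _ => True) (fun _ _ => True) (by simp)
    have h3 : prob R (Trail (fun u m => m u = v) u []) ≤ prob R (fun m s => m u = v ∧ True) :=
      prob_mono fun m _ s h => ⟨h, trivial⟩
    refine (h3.trans this).trans ?_
    simp only [List.length_nil, pow_zero]
    have h4 : prob ((R.erase u).erase v) (fun _ _ => True) ≤ 1 :=
      prob_le_one (even_erase2 hR hu (by simp [hne, hv])) _
    exact div_le_div₀ zero_le_one h4 hD (by linarith)
  | cons p t ih =>
    intro u R hR hm hnd hc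
    obtain ⟨i, o⟩ := p
    rw [flat_cons] at hm hnd
    simp only [List.length_cons, Nat.cast_add, Nat.cast_one] at hc
    have hu : u ∈ R := hm u (by simp)
    have hi : i ∈ R := hm i (by simp)
    simp only [List.nodup_cons, List.mem_cons, not_or] at hnd
    obtain ⟨⟨huv, hui, huo, hut⟩, ⟨hvi, hvo, hvt⟩, ⟨hio, hit⟩, hot, hnt⟩ := hnd
    have hne : i ≠ u := Ne.symm hui
    have hiR : i ∈ R.erase u := by simp [hne, hi]
    have hcard := card_erase2 hu hiR
    have ht0 : (0:ℝ) ≤ t.length := Nat.cast_nonneg _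
    have h2 : 2 ≤ R.card := by omega
    have hcr : (((R.erase u).erase i).card : ℝ) + 2 = R.card := by exact_mod_cast hcard
    have key := prob_edge hu hi hne h2
      (fun m s => s i ≠ s o ∧ Trail (fun u m => m u = v) o t m s)
      (fun m s => s i ≠ s o ∧ Trail (fun u m => m u = v) o t m s) (by
        rintro m - s ⟨h1, h3⟩
        refine ⟨h1, trail_swap v t _ _ _ _ _ ?_ h3⟩
        intro x hx
        constructor
        · rintro rfl; simp only [List.mem_cons] at hx; tauto
        · rintro rfl; simp only [List.mem_cons] at hx; tauto)
    rw [prob_neq _ i o hio (Trail (fun u m => m u = v) o t)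
      (fun m s b => trail_update _ t o i m s b hit)] at key
    have hih := ih o ((R.erase u).erase i) (even_erase2 hR hu hiR) (by
      intro x hx
      have hxR := hm x (by simp only [List.mem_cons] at hx ⊢; tauto)
      simp only [Finset.mem_erase]
      refine ⟨?_, ?_, hxR⟩
      · rintro rfl; simp only [List.mem_cons] at hx; tauto
      · rintro rfl; simp only [List.mem_cons] at hx; tauto)
      (by simp only [List.nodup_cons, List.mem_cons, not_or]; tauto)
      (by linarith)
    refine key.trans ?_
    have hR1 : D ≤ (R.card : ℝ) - 1 := by linarith
    calc prob ((R.erase u).erase i) (Trail (fun u m => m u = v) o t) / 2 / ((R.card : ℝ) - 1)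
        ≤ ((1 / (2 * D)) ^ t.length / D) / 2 / D := by
          apply div_le_div₀ (by positivity) _ hD hR1
          linarith
      _ = _ := by rw [List.length_cons, pow_succ]; field_simp

lemma prob_trail' (D : ℝ) (hD : 0 < D) (t : List (α × α)) : ∀ (u : α) (R : Finset α),
    Even R.card → (∀ x ∈ u :: flat t, x ∈ R) → (u :: flat t).Nodup →
    D + 2 * t.length ≤ R.card →
    prob R (Trail (fun _ _ => True) u t) ≤ (1 / (2 * D)) ^ t.length := by
  induction t with
  | nil =>
    intro u R hR hm hnd hc
    simpa using prob_le_one hR _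
  | cons p t ih =>
    intro u R hR hm hnd hc
    obtain ⟨i, o⟩ := p
    rw [flat_cons] at hm hnd
    simp only [List.length_cons, Nat.cast_add, Nat.cast_one] at hc
    have hu : u ∈ R := hm u (by simp)
    have hi : i ∈ R := hm i (by simp)
    simp only [List.nodup_cons, List.mem_cons, not_or] at hnd
    obtain ⟨⟨hui, huo, hut⟩, ⟨hio, hit⟩, hot, hnt⟩ := hnd
    have hne : i ≠ u := Ne.symm hui
    have hiR : i ∈ R.erase u := by simp [hne, hi]
    have hcard := card_erase2 hu hiR
    have ht0 : (0:ℝ) ≤ t.length := Nat.cast_nonneg _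
    have h2 : 2 ≤ R.card := by omega
    have hcr : (((R.erase u).erase i).card : ℝ) + 2 = R.card := by exact_mod_cast hcard
    have key := prob_edge hu hi hne h2
      (fun m s => s i ≠ s o ∧ Trail (fun _ _ => True) o t m s)
      (fun m s => s i ≠ s o ∧ Trail (fun _ _ => True) o t m s) (by
        rintro m - s ⟨h1, h3⟩
        refine ⟨h1, trail_swap' t _ _ _ _ _ ?_ h3⟩
        intro x hx
        constructor
        · rintro rfl; simp only [List.mem_cons] at hx; tauto
        · rintro rfl; simp only [List.mem_cons] at hx; tauto)
    rw [prob_neq _ i o hio (Trail (fun _ _ => True) o t)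
      (fun m s b => trail_update _ t o i m s b hit)] at key
    have hih := ih o ((R.erase u).erase i) (even_erase2 hR hu hiR) (by
      intro x hx
      have hxR := hm x (by simp only [List.mem_cons] at hx ⊢; tauto)
      simp only [Finset.mem_erase]
      refine ⟨?_, ?_, hxR⟩
      · rintro rfl; simp only [List.mem_cons] at hx; tauto
      · rintro rfl; simp only [List.mem_cons] at hx; tauto)
      (by simp only [List.nodup_cons]; tauto)
      (by linarith)
    refine key.trans ?_
    have hR1 : D ≤ (R.card : ℝ) - 1 := by linarith
    calc prob ((R.erase u).erase i) (Trail (fun _ _ => True) o t) / 2 / ((R.card : ℝ) - 1)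
        ≤ ((1 / (2 * D)) ^ t.length) / 2 / D := by
          apply div_le_div₀ (by positivity) _ hD hR1
          linarith
      _ = _ := by rw [List.length_cons, pow_succ]; field_simp

end Trails


section Det
open Equiv Finset
variable {α V : Type*} [Fintype α] [DecidableEq α]

/-- negation of a literal -/
def neg (x : V × Bool) : V × Bool := (x.1, !x.2)

@[simp] lemma neg_neg' (x : V × Bool) : neg (neg x) = x := by simp [neg]
@[simp] lemma neg_fst (x : V × Bool) : (neg x).1 = x.1 := rfl
lemma neg_ne (x : V × Bool) : neg x ≠ x := by
  intro h; have := congrArg Prod.snd h; simp [neg] at this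
lemma eq_or_neg {x y : V × Bool} (h : x.1 = y.1) : x = y ∨ y = neg x := by
  obtain ⟨v, b⟩ := x; obtain ⟨w, b'⟩ := y
  simp at h; subst h
  cases b <;> cases b' <;> simp [neg]

/-- literal of a clone -/
def litc (var : α → V) (s : α → Bool) (c : α) : V × Bool := (var c, s c)

/-- implication relation between literals -/
def Imp (var : α → V) (m : Perm α) (s : α → Bool) (x y : V × Bool) : Prop :=
  ∃ c, x = neg (litc var s c) ∧ y = litc var s (m c)

variable {var : α → V} {m : Perm α} {s : α → Bool}

lemma imp_skew (hm : m ∈ matchings (univ : Finset α)) {x y : V × Bool}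
    (h : Imp var m s x y) : Imp var m s (neg y) (neg x) := by
  obtain ⟨c, h1, h2⟩ := h
  exact ⟨m c, by rw [h2], by rw [h1, matchings_inv hm]; simp⟩

lemma reach_skew (hm : m ∈ matchings (univ : Finset α)) {x y : V × Bool}
    (h : Relation.ReflTransGen (Imp var m s) x y) :
    Relation.ReflTransGen (Imp var m s) (neg y) (neg x) := by
  induction h with
  | refl => exact .refl
  | tail _ h ih => exact Relation.ReflTransGen.head (imp_skew hm h) ih

lemma exists_bad [Finite V] (hm : m ∈ matchings (univ : Finset α)) (h : ¬ Sat var m s) :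
    ∃ x, Relation.ReflTransGen (Imp var m s) x (neg x) ∧
      Relation.ReflTransGen (Imp var m s) (neg x) x := by
  classical
  by_contra hcon
  push Not at hcon
  apply h
  set 𝒯 : Set (Set (V × Bool)) := {T | (∀ x ∈ T, ∀ y, Imp var m s x y → y ∈ T) ∧
    ∀ x ∈ T, neg x ∉ T} with h𝒯
  obtain ⟨T, hT⟩ := (Set.toFinite 𝒯).exists_maximal ⟨∅, by simp [h𝒯]⟩
  have hcl : ∀ x ∈ T, ∀ y, Relation.ReflTransGen (Imp var m s) x y → y ∈ T := by
    intro x hx y hxy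
    induction hxy with
    | refl => exact hx
    | tail _ h ih => exact hT.prop.1 _ ih _ h
  have ext : ∀ x, x ∉ T → neg x ∉ T → ¬ Relation.ReflTransGen (Imp var m s) x (neg x) → False := by
    intro x hx hnx hr
    have hmem : T ∪ {y | Relation.ReflTransGen (Imp var m s) x y} ∈ 𝒯 := by
      constructor
      · rintro y (hy | hy) z hyz
        · exact Or.inl (hT.prop.1 y hy z hyz)
        · exact Or.inr (Relation.ReflTransGen.tail hy hyz)
      · rintro y (hy | hy) (hn | hn)
        · exact hT.prop.2 y hy hn
        · have := reach_skew hm hn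
          rw [neg_neg'] at this
          exact hnx (hcl y hy _ this)
        · have := reach_skew hm hy
          exact hnx (hcl _ hn _ this)
        · have := reach_skew hm hn
          rw [neg_neg'] at this
          exact hr (Relation.ReflTransGen.trans hy this)
    have := hT.le_of_ge hmem Set.subset_union_left
    exact hx (this (Or.inr Relation.ReflTransGen.refl))
  have tot : ∀ x, x ∈ T ∨ neg x ∈ T := by
    intro x
    by_contra hx
    push Not at hx
    by_cases hr : Relation.ReflTransGen (Imp var m s) x (neg x)
    · exact ext (neg x) hx.2 (by simpa using hx.1) (by simpa using hcon x hr)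
    · exact ext x hx.1 hx.2 hr
  have hval : ∀ v b, (v, b) ∈ T → decide ((v, true) ∈ T) = b := by
    intro v b hb
    cases b
    · have := hT.prop.2 _ hb
      simpa [neg] using this
    · simpa using hb
  refine ⟨fun v => decide ((v, true) ∈ T), fun c => ?_⟩
  rcases tot (litc var s c) with h | h
  · left; exact hval _ _ h
  · right
    exact hval _ _ (hT.prop.1 _ h _ ⟨c, rfl, rfl⟩)

/-- literals in a contradictory component -/
def Bad (var : α → V) (m : Perm α) (s : α → Bool) (x : V × Bool) : Prop :=
  Relation.ReflTransGen (Imp var m s) x (neg x) ∧ Relation.ReflTransGen (Imp var m s) (neg x) x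

lemma bad_in (hm : m ∈ matchings (univ : Finset α)) {x : V × Bool} (hx : Bad var m s x) :
    ∃ y, Bad var m s y ∧ Imp var m s y x := by
  obtain ⟨h1, h2⟩ := hx
  rcases Relation.ReflTransGen.cases_tail h2 with h | ⟨y, hy, hyx⟩
  · exact absurd h.symm (neg_ne x)
  · refine ⟨y, ⟨?_, ?_⟩, hyx⟩
    · exact (Relation.ReflTransGen.head hyx h1).tail (imp_skew hm hyx)
    · have := reach_skew hm hy
      rw [neg_neg'] at this
      exact (this.trans h1).trans hy

lemma reach_fun {β : Type*} {r : β → β → Prop} {x y : β} (h : Relation.ReflTransGen r x y) :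
    ∃ (k : ℕ) (f : ℕ → β), f 0 = x ∧ f k = y ∧ ∀ i < k, r (f i) (f (i + 1)) := by
  induction h using Relation.ReflTransGen.head_induction_on with
  | refl => exact ⟨0, fun _ => y, rfl, rfl, by simp⟩
  | head h _ ih =>
    obtain ⟨k, f, h0, hk, hf⟩ := ih
    rename_i a _ _
    refine ⟨k + 1, fun n => Nat.casesOn n a f, rfl, hk, ?_⟩
    intro i hi
    cases i with
    | zero => simpa [h0] using h
    | succ i => exact hf i (by omega)

lemma fun_reach {β : Type*} {r : β → β → Prop} {k : ℕ} {f : ℕ → β}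
    (hf : ∀ i < k, r (f i) (f (i + 1))) (i j : ℕ) (hij : i ≤ j) (hj : j ≤ k) :
    Relation.ReflTransGen r (f i) (f j) := by
  induction j, hij using Nat.le_induction with
  | base => exact .refl
  | succ j hij ih => exact (ih (by omega)).tail (hf j (by omega))

lemma exists_min_walk (hm : m ∈ matchings (univ : Finset α)) {x : V × Bool}
    (hx : Bad var m s x) :
    ∃ (k : ℕ) (f : ℕ → V × Bool), 0 < k ∧ (∀ i ≤ k, Bad var m s (f i)) ∧ f k = neg (f 0) ∧
      (∀ i < k, Imp var m s (f i) (f (i + 1))) ∧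
      ∀ i < k, ∀ j < k, (f i).1 = (f j).1 → i = j := by
  classical
  have hex : ∃ k, ∃ f : ℕ → V × Bool, Bad var m s (f 0) ∧ f k = neg (f 0) ∧
      ∀ i < k, Imp var m s (f i) (f (i + 1)) := by
    obtain ⟨k, f, h0, hk, hf⟩ := reach_fun hx.1
    exact ⟨k, f, h0 ▸ hx, by rw [hk, h0], hf⟩
  set k := Nat.find hex with hk
  obtain ⟨f, hf0, hfk, hf⟩ := Nat.find_spec hex
  have hmin := fun k' => Nat.find_min (H := hex) (m := k')
  rw [← hk] at hfk hf hmin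
  have hbad : ∀ i ≤ k, Bad var m s (f i) := by
    intro i hi
    have h1 := fun_reach hf 0 i (by omega) hi
    have h2 := fun_reach hf i k hi le_rfl
    rw [hfk] at h2
    have h3 := reach_skew hm h1
    have h4 := reach_skew hm h2
    rw [neg_neg'] at h4
    exact ⟨(h2.trans hf0.2).trans h4, (h3.trans hf0.2).trans h1⟩
  have key : ∀ i j, i < j → j < k → (f i).1 = (f j).1 → False := by
    intro i j hij hj hv
    rcases eq_or_neg hv with h | h
    · refine hmin (k - (j - i)) (by omega)
        ⟨fun t => if t ≤ i then f t else f (t + (j - i)), by simpa using hf0, ?_, ?_⟩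
      · have h1 : ¬ (k - (j - i) ≤ i) := by omega
        have h2 : k - (j - i) + (j - i) = k := by omega
        simp [h1, h2, hfk]
      · intro t ht
        by_cases h1 : t + 1 ≤ i
        · simp only [h1, (by omega : t ≤ i), if_true]
          exact hf t (by omega)
        · by_cases h2 : t = i
          · subst h2
            simp only [h1, le_refl, if_true, if_false]
            rw [h, (by omega : t + 1 + (j - t) = j + 1)]
            exact hf j hj
          · have h3 : ¬ t ≤ i := by omega
            beta_reduce
            rw [if_neg h1, if_neg h3]
            rw [(by omega : t + 1 + (j - i) = (t + (j - i)) + 1)]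
            exact hf _ (by omega)
    · refine hmin (j - i) (by omega) ⟨fun t => f (i + t), hbad i (by omega), ?_, ?_⟩
      · simp only [add_zero]; rw [(by omega : i + (j - i) = j), h]
      · intro t ht; exact hf _ (by omega)
  refine ⟨k, f, ?_, hbad, hfk, hf, ?_⟩
  · rcases Nat.eq_zero_or_pos k with h | h
    · rw [h] at hfk; exact absurd hfk.symm (neg_ne _)
    · exact h
  · intro i hi j hj hv
    rcases lt_trichotomy i j with h | h | h
    · exact (key i j h hj hv).elim
    · exact h
    · exact (key j i h hi hv.symm).elim

/-- consecutive out-clones -/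
def Nxt (var : α → V) (m : Perm α) (s : α → Bool) (o o' : α) : Prop :=
  litc var s (m o) = neg (litc var s o')

/-- A window: consecutive out-clones with distinct variables, closing up at its right end. -/
structure Window (var : α → V) (m : Perm α) (s : α → Bool) (W : List α) : Prop where
  ne : W ≠ []
  chain : W.IsChain (Nxt var m s)
  nodup : (W.map var).Nodup
  bad : ∀ o ∈ W, Bad var m s (neg (litc var s o))
  last : ∃ o ∈ W, litc var s (m (W.getLast ne)) = litc var s o

lemma exists_window (hm : m ∈ matchings (univ : Finset α)) {x : V × Bool}
    (hx : Bad var m s x) : ∃ W, Window var m s W := by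
  obtain ⟨k, f, hk, hb, hfk, hf, hinj⟩ := exists_min_walk hm hx
  have : Nonempty α := ⟨(hf 0 hk).choose⟩
  have hf' : ∀ i, ∃ c, i < k → f i = neg (litc var s c) ∧ f (i + 1) = litc var s (m c) := by
    intro i
    by_cases h : i < k
    · obtain ⟨c, hc⟩ := hf i h; exact ⟨c, fun _ => hc⟩
    · exact ⟨Classical.arbitrary α, fun h' => absurd h' h⟩
  choose o ho using hf'
  have hov : ∀ i < k, var (o i) = (f i).1 := by
    intro i hi; rw [(ho i hi).1]; rfl
  have hne : (List.range k).map o ≠ [] := by simp; omega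
  refine ⟨(List.range k).map o, hne, ?_, ?_, ?_, ⟨o 0, ?_, ?_⟩⟩
  · rw [List.isChain_map, List.isChain_iff_getElem]
    intro i hi
    simp at hi
    simp only [List.getElem_range]
    unfold Nxt
    rw [← (ho i (by omega)).2, ← (ho (i + 1) (by omega)).1]
  · rw [List.map_map]
    refine List.Nodup.map_on ?_ List.nodup_range
    intro i hi j hj h
    simp at hi hj h
    rw [hov i hi, hov j hj] at h
    exact hinj i hi j hj h
  · intro c hc
    simp at hc
    obtain ⟨i, hi, rfl⟩ := hc
    rw [← (ho i hi).1]
    exact hb i hi.le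
  · simp; exact ⟨0, hk, rfl⟩
  · have h1 : ((List.range k).map o).getLast hne = o (k - 1) := by
      rw [List.getLast_eq_getElem]; simp
    rw [h1, ← (ho (k - 1) (by omega)).2, (by omega : k - 1 + 1 = k), hfk, (ho 0 hk).1]
    simp

lemma exists_max_window [Finite V] (hm : m ∈ matchings (univ : Finset α)) {x : V × Bool}
    (hx : Bad var m s x) : ∃ W, ∃ hW : Window var m s W, ∃ o, Nxt var m s o (W.head hW.ne) ∧
      var o ∈ W.map var := by
  classical
  have := Fintype.ofFinite V
  by_contra hcon
  push Not at hcon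
  have key : ∀ n, ∃ W, Window var m s W ∧ n ≤ W.length := by
    intro n
    induction n with
    | zero => obtain ⟨W, hW⟩ := exists_window hm hx; exact ⟨W, hW, by omega⟩
    | succ n ih =>
      obtain ⟨W, hW, hn⟩ := ih
      obtain ⟨y, hy, o, ho1, ho2⟩ := bad_in hm (hW.bad _ (List.head_mem hW.ne))
      have hnx : Nxt var m s o (W.head hW.ne) := ho2.symm
      have hnot := hcon W hW o hnx
      refine ⟨o :: W, ⟨by simp, ?_, ?_, ?_, ?_⟩, by simp; omega⟩
      · rw [List.isChain_cons]
        refine ⟨?_, hW.chain⟩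
        intro z hz
        rw [List.head?_eq_some_head hW.ne] at hz
        simp at hz; rw [← hz]; exact hnx
      · rw [List.map_cons, List.nodup_cons]
        exact ⟨hnot, hW.nodup⟩
      · intro c hc
        rcases List.mem_cons.1 hc with rfl | hc
        · rw [← ho1]; exact hy
        · exact hW.bad c hc
      · obtain ⟨z, hz, hl⟩ := hW.last
        refine ⟨z, by simp [hz], ?_⟩
        rw [List.getLast_cons hW.ne]; exact hl
  obtain ⟨W, hW, hn⟩ := key (Fintype.card V + 1)
  have := List.Nodup.length_le_card hW.nodup
  simp at this
  omega

end Det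


section Bicycle
open Equiv Finset
variable {α V : Type*} [Fintype α] [DecidableEq α]
variable {var : α → V} {m : Perm α} {s : α → Bool}

lemma chain_next {r : α → α → Prop} (W : List α) (hne : W ≠ []) (h : W.IsChain r) (c : α)
    (hc : c ∈ W) (hl : c ≠ W.getLast hne) : ∃ c' ∈ W.tail, r c c' := by
  induction W with
  | nil => exact absurd rfl hne
  | cons a W ih =>
    cases W with
    | nil => simp at hc hl; exact absurd hc hl
    | cons b W =>
      rw [List.isChain_cons_cons] at h
      rcases List.mem_cons.1 hc with rfl | hc
      · exact ⟨b, by simp, h.1⟩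
      · obtain ⟨c', hc', hr⟩ := ih (by simp) h.2 hc (by simpa using hl)
        exact ⟨c', List.mem_of_mem_tail hc', hr⟩

/-- The list of (in, out) pairs along a list of out-clones. -/
def pairsOf (m : Perm α) : α → List α → List (α × α)
  | _, [] => []
  | o, o' :: W => (m o, o') :: pairsOf m o' W

lemma trail_pairsOf (W : List α) : ∀ (o : α) , (o :: W).IsChain (Nxt var m s) →
    Trail (fun u m' => m' u = m ((o :: W).getLast (by simp))) o (pairsOf m o W) m s := by
  induction W with
  | nil => intro o _; simp [pairsOf, Trail]
  | cons o' W ih =>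
    intro o h
    rw [List.isChain_cons_cons] at h
    unfold pairsOf Trail
    refine ⟨rfl, ?_, ?_⟩
    · have := congrArg Prod.snd h.1
      simp only [litc, neg] at this
      simp [this]
    · have := ih o' h.2
      simpa using this

lemma flat_pairsOf (W : List α) : ∀ (o : α),
    (o :: (flat (pairsOf m o W) ++ [m ((o :: W).getLast (by simp))])) =
      (o :: W).flatMap fun c => [c, m c] := by
  induction W with
  | nil => intro o; simp [pairsOf, flat]
  | cons o' W ih =>
    intro o
    have := ih o'
    unfold pairsOf
    rw [flat_cons, List.flatMap_cons, ← this]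
    simp

lemma nodup_flatMap_pair (L : List α) (h : L.Nodup) (h2 : ∀ c ∈ L, ∀ c' ∈ L, c ≠ m c') :
    (L.flatMap fun c => [c, m c]).Nodup := by
  induction L with
  | nil => simp
  | cons a L ih =>
    rw [List.nodup_cons] at h
    rw [List.flatMap_cons]
    have := ih h.2 (fun c hc c' hc' => h2 c (by simp [hc]) c' (by simp [hc']))
    simp only [List.cons_append, List.nil_append, List.nodup_cons, List.mem_cons, not_or, List.mem_flatMap]
    refine ⟨⟨h2 a (by simp) a (by simp), ?_⟩, ?_, this⟩
    · rintro ⟨c, hc, hh⟩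
      simp at hh
      rcases hh with rfl | hh
      · exact h.1 hc
      · exact h2 a (by simp) c (by simp [hc]) hh
    · rintro ⟨c, hc, hh⟩
      simp at hh
      rcases hh with hh | rfl
      · exact h2 c (by simp [hc]) a (by simp) hh.symm
      · exact h.1 hc

lemma pairsOf_prop (hm : m ∈ matchings (univ : Finset α)) (W : List α) : ∀ (o : α),
    (o :: W).IsChain (Nxt var m s) →
    (∀ p ∈ pairsOf m o W, p.1 ≠ p.2 ∧ var p.1 = var p.2) := by
  induction W with
  | nil => intro o _ p hp; simp [pairsOf] at hp
  | cons o' W ih =>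
    intro o h p hp
    rw [List.isChain_cons_cons] at h
    unfold pairsOf at hp
    rcases List.mem_cons.1 hp with rfl | hp
    · have h1 := congrArg Prod.fst h.1
      have h2 := congrArg Prod.snd h.1
      simp only [litc, neg] at h1 h2
      refine ⟨?_, h1⟩
      intro he
      simp only at he
      rw [he] at h2
      simp at h2
    · exact ih o' h.2 p hp

lemma pairsOf_snd (W : List α) : ∀ (o : α), (pairsOf m o W).map Prod.snd = W := by
  induction W with
  | nil => intro o; simp [pairsOf]
  | cons o' W ih => intro o; simp [pairsOf, ih]

lemma exists_bicycle [Finite V] (hm : m ∈ matchings (univ : Finset α)) (h : ¬ Sat var m s) :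
    ∃ (u v : α) (t : List (α × α)), Trail (fun u m => m u = v) u t m s ∧
      (u :: v :: flat t).Nodup ∧ (∀ p ∈ t, p.1 ≠ p.2 ∧ var p.1 = var p.2) ∧
      (∃ p ∈ t, var p.2 = var u) ∧ (∃ p ∈ t, var p.2 = var v) := by
  obtain ⟨x, hx⟩ := exists_bad hm h
  obtain ⟨W, hW, o, hno, hvo⟩ := exists_max_window hm hx
  have hfix : ∀ c, m c ≠ c := fun c => (matchings_mem hm).1 (mem_univ c)
  have hinv := matchings_inv hm
  have hinj : ∀ c ∈ W, ∀ c' ∈ W, var c = var c' → c = c' := fun c hc c' hc' =>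
    List.inj_on_of_nodup_map hW.nodup hc hc'
  have hchain : (o :: W).IsChain (Nxt var m s) := by
    rw [List.isChain_cons]
    refine ⟨?_, hW.chain⟩
    intro z hz
    rw [List.head?_eq_some_head hW.ne] at hz
    simp at hz; rw [← hz]; exact hno
  have hnlit : ∀ c ∈ W, ∀ c' ∈ W, litc var s c ≠ neg (litc var s c') := by
    intro c hc c' hc' he
    have := hinj c hc c' hc' (congrArg Prod.fst he)
    subst this
    exact neg_ne _ he.symm
  have hoW : o ∉ W := by
    intro hoW
    by_cases hl : o = W.getLast hW.ne
    · obtain ⟨z, hz, hzl⟩ := hW.last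
      rw [← hl] at hzl
      unfold Nxt at hno
      rw [hzl] at hno
      exact hnlit z hz _ (List.head_mem hW.ne) hno
    · obtain ⟨c', hc', hr⟩ := chain_next W hW.ne hW.chain o hoW hl
      unfold Nxt at hno hr
      rw [hno] at hr
      have h1 := congrArg neg hr
      simp only [neg_neg'] at h1
      have h2 := hinj _ (List.head_mem hW.ne) _ (List.mem_of_mem_tail hc') (congrArg Prod.fst h1)
      have hnd : W.Nodup := List.Nodup.of_map _ hW.nodup
      rw [← List.cons_head_tail hW.ne, List.nodup_cons, h2] at hnd
      exact hnd.1 hc'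
  have hnd : (o :: W).Nodup := List.nodup_cons.2 ⟨hoW, List.Nodup.of_map _ hW.nodup⟩
  set l := (o :: W).getLast (by simp) with hl
  have hlW : l = W.getLast hW.ne := by rw [hl, List.getLast_cons hW.ne]
  have hlmem : l ∈ W := by rw [hlW]; exact List.getLast_mem _
  have claim1 : ∀ c ∈ W, ∀ c' ∈ o :: W, c' ≠ l → c ≠ m c' := by
    intro c hc c' hc' hcl he
    obtain ⟨d, hd, hr⟩ := chain_next _ (by simp) hchain c' hc' hcl
    rw [List.tail_cons] at hd
    unfold Nxt at hr
    rw [← he] at hr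
    exact hnlit c hc d hd hr
  have hsep : ∀ c ∈ o :: W, ∀ c' ∈ o :: W, c ≠ m c' := by
    intro c hc c' hc' he
    have he' : c' = m c := by rw [he, hinv]
    by_cases hcc : c = c'
    · subst hcc; exact hfix c he.symm
    have hol : o ≠ l := fun h => hoW (h ▸ hlmem)
    by_cases hco : c = o
    · have hc'W : c' ∈ W := by
        rcases List.mem_cons.1 hc' with h | h
        · exact absurd (hco.trans h.symm) hcc
        · exact h
      exact claim1 c' hc'W c hc (by rw [hco]; exact hol) he'
    · have hcW : c ∈ W := (List.mem_cons.1 hc).resolve_left hco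
      by_cases hcl : c' = l
      · have hc'W : c' ∈ W := hcl ▸ hlmem
        exact claim1 c' hc'W c hc (fun h => hcc (h.trans hcl.symm)) he'
      · exact claim1 c hcW c' hc' hcl he
  refine ⟨o, m l, pairsOf m o W, trail_pairsOf W o hchain, ?_, pairsOf_prop hm W o hchain, ?_, ?_⟩
  · have := nodup_flatMap_pair (m := m) (o :: W) hnd hsep
    rw [← flat_pairsOf, ← hl] at this
    refine (List.Perm.nodup_iff ?_).1 this
    refine List.Perm.cons _ ?_
    exact List.perm_append_singleton _ _
  · rw [List.mem_map] at hvo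
    obtain ⟨c, hc, hcv⟩ := hvo
    have : c ∈ (pairsOf m o W).map Prod.snd := by rw [pairsOf_snd]; exact hc
    obtain ⟨p, hp, rfl⟩ := List.mem_map.1 this
    exact ⟨p, hp, hcv⟩
  · obtain ⟨z, hz, hzl⟩ := hW.last
    have : z ∈ (pairsOf m o W).map Prod.snd := by rw [pairsOf_snd]; exact hz
    obtain ⟨p, hp, rfl⟩ := List.mem_map.1 this
    refine ⟨p, hp, ?_⟩
    rw [← hlW] at hzl
    exact (congrArg Prod.fst hzl).symm

end Bicycle


section SatA
open Equiv Finset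

section
variable {α V : Type*} [Fintype α] [DecidableEq α] [DecidableEq V]

/-- ordered pairs of distinct clones of the same variable -/
def dpairs (var : α → V) : Finset (α × α) :=
  univ.filter fun p => p.1 ≠ p.2 ∧ var p.1 = var p.2

/-- clones whose variable occurs along `t` -/
def onTrail (var : α → V) {s : ℕ} (t : Fin s → α × α) : Finset α :=
  univ.biUnion fun i => clonesOf var (var (t i).2)

lemma card_onTrail (var : α → V) {s : ℕ} (t : Fin s → α × α) (Δ : ℕ)
    (hΔ : ∀ v, (clonesOf var v).card ≤ Δ) : (onTrail var t).card ≤ s * Δ := by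
  unfold onTrail
  refine Finset.card_biUnion_le.trans ?_
  refine (Finset.sum_le_sum fun i _ => hΔ _).trans ?_
  simp

lemma take_trail (fin : α → Perm α → Prop) (t : List (α × α)) : ∀ (K : ℕ) (u : α) (m : Perm α)
    (s : α → Bool), Trail fin u t m s → Trail (fun _ _ => True) u (t.take K) m s := by
  induction t with
  | nil => intro K u m s _; simp [Trail]
  | cons p t ih =>
    intro K u m s h
    cases K with
    | zero => simp [Trail]
    | succ K =>
      rw [List.take_succ_cons]
      unfold Trail at h ⊢
      exact ⟨h.1, h.2.1, ih K _ _ _ h.2.2⟩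

lemma flat_take_sublist (t : List (α × α)) : ∀ K, (flat (t.take K)).Sublist (flat t) := by
  induction t with
  | nil => simp
  | cons p t ih =>
    intro K
    cases K with
    | zero => simp [flat]
    | succ K =>
      rw [List.take_succ_cons, flat_cons, flat_cons]
      exact ((ih K).cons_cons _).cons_cons _

lemma prob_short (var : α → V) (s Δ : ℕ) (D : ℝ) (hD : 0 < D) (hE : Even (Fintype.card α))
    (hΔ : ∀ v, (clonesOf var v).card ≤ Δ) (hc : D + 2 * s + 1 ≤ Fintype.card α) :
    prob univ (fun m σ => ∃ t ∈ Fintype.piFinset (fun _ : Fin s => dpairs var),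
      ∃ u ∈ onTrail var t, ∃ v ∈ onTrail var t, (u :: v :: flat (List.ofFn t)).Nodup ∧
        Trail (fun u m => m u = v) u (List.ofFn t) m σ) ≤
      (s:ℝ) ^ 2 * ((dpairs var).card / (2 * D)) ^ s * (Δ ^ 2 / D) := by
  refine (prob_exists _ _ _).trans ?_
  have h1 : ∀ t ∈ Fintype.piFinset (fun _ : Fin s => dpairs var),
      prob univ (fun m σ => ∃ u ∈ onTrail var t, ∃ v ∈ onTrail var t,
        (u :: v :: flat (List.ofFn t)).Nodup ∧
        Trail (fun u m => m u = v) u (List.ofFn t) m σ) ≤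
      ((s * Δ : ℕ) : ℝ) * (((s * Δ : ℕ) : ℝ) * ((1 / (2 * D)) ^ s / D)) := by
    intro t _
    have hcT : ((onTrail var t).card : ℝ) ≤ ((s * Δ : ℕ) : ℝ) := by
      exact_mod_cast card_onTrail var t Δ hΔ
    refine (prob_exists _ _ _).trans ?_
    refine (Finset.sum_le_card_nsmul _ _ (((s * Δ : ℕ) : ℝ) * ((1 / (2 * D)) ^ s / D)) ?_).trans ?_
    · intro u _
      refine (prob_exists _ _ _).trans ?_
      refine (Finset.sum_le_card_nsmul _ _ ((1 / (2 * D)) ^ s / D) ?_).trans ?_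
      · intro v _
        by_cases hn : (u :: v :: flat (List.ofFn t)).Nodup
        · have := prob_trail v D hD (List.ofFn t) u univ (by simpa using hE) (by simp) hn
            (by simpa using hc)
          rw [List.length_ofFn] at this
          simpa [hn] using this
        · simp only [hn, false_and]
          rw [prob_false]; positivity
      · rw [nsmul_eq_mul]; gcongr
    · rw [nsmul_eq_mul]; gcongr
  refine (Finset.sum_le_card_nsmul _ _ _ h1).trans ?_
  rw [nsmul_eq_mul, Fintype.card_piFinset_const]
  apply le_of_eq
  push_cast
  rw [div_pow, div_pow]
  field_simp
  simp

lemma prob_long (var : α → V) (K : ℕ) (D : ℝ) (hD : 0 < D) (hE : Even (Fintype.card α))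
    (hc : D + 2 * K ≤ Fintype.card α) :
    prob univ (fun m σ => ∃ t ∈ Fintype.piFinset (fun _ : Fin K => dpairs var),
      ∃ u ∈ (univ : Finset α), (u :: flat (List.ofFn t)).Nodup ∧
        Trail (fun _ _ => True) u (List.ofFn t) m σ) ≤
      Fintype.card α * ((dpairs var).card / (2 * D)) ^ K := by
  refine (prob_exists _ _ _).trans ?_
  have h1 : ∀ t ∈ Fintype.piFinset (fun _ : Fin K => dpairs var),
      prob univ (fun m σ => ∃ u ∈ (univ : Finset α),
        (u :: flat (List.ofFn t)).Nodup ∧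
        Trail (fun _ _ => True) u (List.ofFn t) m σ) ≤
      Fintype.card α * (1 / (2 * D)) ^ K := by
    intro t _
    refine (prob_exists _ _ _).trans ?_
    refine (Finset.sum_le_card_nsmul _ _ ((1 / (2 * D)) ^ K) ?_).trans ?_
    · intro u _
      by_cases hn : (u :: flat (List.ofFn t)).Nodup
      · have := prob_trail' D hD (List.ofFn t) u univ (by simpa using hE) (by simp) hn
          (by simpa using hc)
        rw [List.length_ofFn] at this
        simpa [hn] using this
      · simp only [hn, false_and]
        rw [prob_false]; positivity
    · rw [nsmul_eq_mul]; simp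
  refine (Finset.sum_le_card_nsmul _ _ _ h1).trans ?_
  rw [nsmul_eq_mul, Fintype.card_piFinset_const]
  apply le_of_eq
  push_cast
  rw [div_pow, div_pow]
  field_simp
  simp

lemma prob_unsat_le [Finite V] (var : α → V) (K Δ : ℕ) (D : ℝ) (hD : 0 < D)
    (hE : Even (Fintype.card α))
    (hΔ : ∀ v, (clonesOf var v).card ≤ Δ) (hc : D + 2 * K ≤ Fintype.card α) :
    prob univ (fun m s => ¬ Sat var m s) ≤
      (∑ s ∈ range K, (s:ℝ) ^ 2 * ((dpairs var).card / (2 * D)) ^ s * (Δ ^ 2 / D)) +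
      Fintype.card α * ((dpairs var).card / (2 * D)) ^ K := by
  have key := prob_or (univ : Finset α)
    (fun m σ => ∃ s ∈ range K, ∃ t ∈ Fintype.piFinset (fun _ : Fin s => dpairs var),
      ∃ u ∈ onTrail var t, ∃ v ∈ onTrail var t, (u :: v :: flat (List.ofFn t)).Nodup ∧
        Trail (fun u m => m u = v) u (List.ofFn t) m σ)
    (fun m σ => ∃ t ∈ Fintype.piFinset (fun _ : Fin K => dpairs var),
      ∃ u ∈ (univ : Finset α), (u :: flat (List.ofFn t)).Nodup ∧
        Trail (fun _ _ => True) u (List.ofFn t) m σ)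
  refine le_trans (prob_mono ?_) (key.trans (add_le_add ?_ (prob_long var K D hD hE hc)))
  · intro m hm σ hns
    obtain ⟨u, v, t, htr, hnd, hp, hu, hv⟩ := exists_bicycle hm hns
    by_cases hK : t.length < K
    · left
      have hof : List.ofFn t.get = t := List.ofFn_get t
      refine ⟨t.length, by simpa using hK, t.get, ?_, u, ?_, v, ?_, by rwa [hof], by rwa [hof]⟩
      · rw [Fintype.mem_piFinset]; intro i
        simp only [dpairs, Finset.mem_filter, Finset.mem_univ, true_and]
        exact hp _ (List.get_mem _ _)
      · obtain ⟨p, hp, hpv⟩ := hu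
        obtain ⟨i, rfl⟩ := List.get_of_mem hp
        simp only [onTrail, Finset.mem_biUnion, Finset.mem_univ, true_and, clonesOf, Finset.mem_filter]
        exact ⟨i, hpv.symm⟩
      · obtain ⟨p, hp, hpv⟩ := hv
        obtain ⟨i, rfl⟩ := List.get_of_mem hp
        simp only [onTrail, Finset.mem_biUnion, Finset.mem_univ, true_and, clonesOf, Finset.mem_filter]
        exact ⟨i, hpv.symm⟩
    · right
      have hlen : (t.take K).length = K := by rw [List.length_take]; omega
      have h1 := take_trail _ t K u m σ htr
      have h2 : (u :: flat (t.take K)).Nodup :=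
        hnd.sublist (((flat_take_sublist t K).cons v).cons_cons u)
      have h3 : ∀ p ∈ t.take K, p.1 ≠ p.2 ∧ var p.1 = var p.2 :=
        fun p hp' => hp p (List.mem_of_mem_take hp')
      generalize t.take K = t' at hlen h1 h2 h3
      subst hlen
      have hof : List.ofFn t'.get = t' := List.ofFn_get t'
      refine ⟨t'.get, ?_, u, mem_univ u, by rwa [hof], by rwa [hof]⟩
      rw [Fintype.mem_piFinset]; intro i
      simp only [dpairs, Finset.mem_filter, Finset.mem_univ, true_and]
      exact h3 _ (List.get_mem _ _)
  · refine (prob_exists _ _ _).trans ?_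
    refine Finset.sum_le_sum fun s hs => ?_
    refine prob_short var s Δ D hD hE hΔ ?_
    have : (s:ℝ) + 1 ≤ K := by exact_mod_cast Finset.mem_range.1 hs
    linarith

end

set_option maxHeartbeats 1000000 in
theorem sat_A (ε : ℝ) (hε : 0 < ε) (η : ℝ) (hη : 0 < η) :
    ∃ δ > 0, ∃ S0 : ℕ, ∀ (α V : Type) [Fintype α] [DecidableEq α] [DecidableEq V] [Finite V]
      (var : α → V) (Δ : ℕ), S0 ≤ Fintype.card α → Even (Fintype.card α) →
      (∀ v, (clonesOf var v).card ≤ Δ) →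
      (Δ:ℝ) ^ 2 ≤ δ * Fintype.card α →
      ((dpairs var).card : ℝ) ≤ (2 - ε) * Fintype.card α →
      prob univ (fun m s => ¬ Sat var m s) ≤ η := by
  obtain ⟨e, he0, he1, heε⟩ : ∃ e : ℝ, 0 < e ∧ e ≤ 1 ∧ e ≤ ε :=
    ⟨min ε 1, lt_min hε one_pos, min_le_right _ _, min_le_left _ _⟩
  set r : ℝ := (2 - e) / (2 - e / 2) with hr
  have hr0 : 0 < r := div_pos (by linarith) (by linarith)
  have hr1 : r < 1 := by rw [hr, div_lt_one (by linarith)]; linarith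
  have hsum : Summable fun s : ℕ => (s:ℝ) ^ 2 * r ^ s :=
    summable_pow_mul_geometric_of_norm_lt_one 2 (by rw [Real.norm_of_nonneg hr0.le]; exact hr1)
  set C : ℝ := ∑' s : ℕ, (s:ℝ) ^ 2 * r ^ s with hC
  have hC0 : 0 ≤ C := tsum_nonneg fun s => by positivity
  set κ : ℝ := e / 16 with hκ
  have hκ0 : 0 < κ := by positivity
  have hlim : Tendsto (fun S : ℕ => (S:ℝ) * r ^ ⌊κ * S⌋₊) atTop (nhds 0) := by
    have h1 : Tendsto (fun n : ℕ => (n:ℝ) * r ^ n) atTop (nhds 0) :=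
      tendsto_self_mul_const_pow_of_lt_one hr0.le hr1
    have h2 : Tendsto (fun n : ℕ => r ^ n) atTop (nhds 0) :=
      tendsto_pow_atTop_nhds_zero_of_lt_one hr0.le hr1
    have h3 : Tendsto (fun S : ℕ => ⌊κ * S⌋₊) atTop atTop :=
      tendsto_nat_floor_atTop.comp ((tendsto_natCast_atTop_atTop).const_mul_atTop hκ0)
    have h4 := ((h1.comp h3).add (h2.comp h3)).const_mul (1 / κ)
    simp only [add_zero, mul_zero] at h4
    refine squeeze_zero (fun S => by positivity) (fun S => ?_) h4
    have : κ * S ≤ ⌊κ * S⌋₊ + 1 := (Nat.lt_floor_add_one _).le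
    have h5 : (S:ℝ) ≤ 1 / κ * (⌊κ * S⌋₊ + 1) := by
      rw [one_div, ← div_eq_inv_mul, le_div_iff₀ hκ0]; linarith
    have h6 : (0:ℝ) ≤ r ^ ⌊κ * S⌋₊ := by positivity
    calc (S:ℝ) * r ^ ⌊κ * S⌋₊ ≤ 1 / κ * (⌊κ * S⌋₊ + 1) * r ^ ⌊κ * S⌋₊ := by gcongr
      _ = _ := by simp only [Function.comp]; ring
  have hev := (hlim.eventually (ge_mem_nhds (half_pos hη))).and
    ((tendsto_natCast_atTop_atTop (R := ℝ)).eventually (eventually_ge_atTop (1:ℝ)))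
  obtain ⟨S0, hS0⟩ := eventually_atTop.1 hev
  refine ⟨η / (4 * (C + 1)), by positivity, S0, ?_⟩
  intro α V _ _ _ _ var Δ hS hE hΔ hΔ2 hB
  set S := Fintype.card α with hSdef
  obtain ⟨hη', hbig⟩ := hS0 S hS
  have hSpos : (0:ℝ) < S := by linarith
  set K := ⌊κ * S⌋₊ with hK
  have hK1 : (K:ℝ) ≤ κ * S := Nat.floor_le (by positivity)
  set D : ℝ := (1 - e / 4) * S with hD
  have hD0 : 0 < D := mul_pos (by linarith) hSpos
  have hDS : (S:ℝ) / 2 ≤ D := by rw [hD]; nlinarith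
  have hmain := prob_unsat_le var K Δ D hD0 hE hΔ (by rw [← hSdef, hD]; nlinarith)
  refine hmain.trans ?_
  have hratio : ((dpairs var).card : ℝ) / (2 * D) ≤ r := by
    rw [hr, div_le_div_iff₀ (by positivity) (by linarith)]
    have h1 : ((dpairs var).card : ℝ) ≤ (2 - e) * S := hB.trans (by gcongr)
    have h2 : (0:ℝ) ≤ 2 - e / 2 := by linarith
    calc ((dpairs var).card : ℝ) * (2 - e / 2) ≤ (2 - e) * S * (2 - e / 2) := by gcongr
      _ = _ := by rw [hD]; ring
  have hΔD : (Δ:ℝ) ^ 2 / D ≤ η / (2 * (C + 1)) := by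
    rw [div_le_iff₀ hD0]
    calc (Δ:ℝ) ^ 2 ≤ η / (4 * (C + 1)) * S := hΔ2
      _ = η / (2 * (C + 1)) * (S / 2) := by field_simp; ring
      _ ≤ _ := by gcongr
  have h1 : ∑ s ∈ range K, (s:ℝ) ^ 2 * ((dpairs var).card / (2 * D)) ^ s * (Δ ^ 2 / D) ≤ η / 2 := by
    calc _ ≤ ∑ s ∈ range K, (s:ℝ) ^ 2 * r ^ s * (η / (2 * (C + 1))) := by
          gcongr
      _ = (∑ s ∈ range K, (s:ℝ) ^ 2 * r ^ s) * (η / (2 * (C + 1))) := by rw [Finset.sum_mul]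
      _ ≤ C * (η / (2 * (C + 1))) := by
          gcongr
          exact hsum.sum_le_tsum _ (fun s _ => by positivity)
      _ ≤ η / 2 := by
          rw [mul_div_assoc', div_le_div_iff₀ (by positivity) (by positivity)]
          nlinarith
  have h2 : (S:ℝ) * ((dpairs var).card / (2 * D)) ^ K ≤ η / 2 := by
    refine le_trans ?_ hη'
    gcongr
  linarith

end SatA


section Transfer
open Equiv Finset

/-- pairing of consecutive indices -/
def tauFun (N : ℕ) (hN : 2 ∣ N) (x : Fin N) : Fin N :=
  if h : x.1 % 2 = 0 then ⟨x.1 + 1, by have := x.2; omega⟩ else ⟨x.1 - 1, by have := x.2; omega⟩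

lemma tauFun_inv (N : ℕ) (hN : 2 ∣ N) (x : Fin N) : tauFun N hN (tauFun N hN x) = x := by
  unfold tauFun
  ext
  by_cases h : x.1 % 2 = 0
  · simp [h, Nat.add_mod]
  · have : (x.1 - 1) % 2 = 0 := by omega
    simp [h, this]; omega

/-- pairing of consecutive indices as a permutation -/
def tau (N : ℕ) (hN : 2 ∣ N) : Perm (Fin N) :=
  ⟨tauFun N hN, tauFun N hN, tauFun_inv N hN, tauFun_inv N hN⟩

lemma tau_ne (N : ℕ) (hN : 2 ∣ N) (x : Fin N) : tau N hN x ≠ x := by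
  change tauFun N hN x ≠ x
  unfold tauFun
  intro h
  have := congrArg Fin.val h
  split_ifs at this <;> simp at this <;> omega

variable {α : Type*} [Fintype α] [DecidableEq α]

/-- the matching of the clones induced by an ordering -/
def mOf {N : ℕ} (hN : 2 ∣ N) (e : Fin N ≃ α) : Perm α := e.permCongr (tau N hN)

lemma mOf_apply {N : ℕ} (hN : 2 ∣ N) (e : Fin N ≃ α) (x : Fin N) :
    mOf hN e (e x) = e (tauFun N hN x) := by
  simp [mOf, tau]

lemma mOf_mem {N : ℕ} (hN : 2 ∣ N) (e : Fin N ≃ α) : mOf hN e ∈ matchings (univ : Finset α) := by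
  apply matchings_mk
  · intro x
    obtain ⟨y, rfl⟩ := e.surjective x
    rw [mOf_apply, mOf_apply, tauFun_inv]
  · intro x
    obtain ⟨y, rfl⟩ := e.surjective x
    rw [mOf_apply]
    simp only [mem_univ, true_iff]
    intro h
    exact tau_ne N hN y (e.injective h)

lemma cycleType_matching {m : Perm α} (hm : m ∈ matchings (univ : Finset α)) :
    m.cycleType = Multiset.replicate (Fintype.card α / 2) 2 := by
  obtain ⟨h1, h2⟩ := mem_matchings.1 hm
  have hall : ∀ n ∈ m.cycleType, n = 2 := by
    intro n hn
    have h3 := Perm.two_le_of_mem_cycleType hn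
    have h4 := Perm.dvd_of_mem_cycleType hn
    have h5 : orderOf m ∣ 2 := orderOf_dvd_of_pow_eq_one (by rw [pow_two, h1])
    have := Nat.le_of_dvd (by norm_num) (h4.trans h5)
    omega
  have h6 := Multiset.eq_replicate_card.2 hall
  have h7 := Perm.sum_cycleType m
  rw [h2, h6, Multiset.sum_replicate, Finset.card_univ] at h7
  rw [h6, ← h7]
  simp

lemma card_fiber {N : ℕ} (hN : 2 ∣ N) {m₁ m₂ : Perm α}
    (h1 : m₁ ∈ matchings (univ : Finset α)) (h2 : m₂ ∈ matchings (univ : Finset α)) :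
    (univ.filter fun e : Fin N ≃ α => mOf hN e = m₁).card =
      (univ.filter fun e : Fin N ≃ α => mOf hN e = m₂).card := by
  have hc : IsConj m₁ m₂ := by
    rw [Perm.isConj_iff_cycleType_eq, cycleType_matching h1, cycleType_matching h2]
  obtain ⟨g, hg⟩ := isConj_iff.1 hc
  have key : ∀ e : Fin N ≃ α, mOf hN (e.trans g) = g * mOf hN e * g⁻¹ := by
    intro e
    ext x
    obtain ⟨y, rfl⟩ := (e.trans g).surjective x
    rw [mOf_apply]
    simp [mOf_apply]
  refine Finset.card_bij (fun e _ => e.trans g) ?_ ?_ ?_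
  · intro e he
    simp only [Finset.mem_filter, Finset.mem_univ, true_and] at he ⊢
    rw [key, he, hg]
  · intro e _ e' _ h
    ext x
    have := congrArg (fun f : Fin N ≃ α => f x) h
    simpa using this
  · intro e he
    simp only [Finset.mem_filter, Finset.mem_univ, true_and] at he
    refine ⟨e.trans g.symm, ?_, ?_⟩
    · simp only [Finset.mem_filter, Finset.mem_univ, true_and]
      have := key (e.trans g.symm)
      have h3 : (e.trans g.symm).trans g = e := by ext x; simp
      rw [h3, he, ← hg] at this
      simpa using this.symm
    · ext x; simp

lemma avg_eq {N : ℕ} (hN : 2 ∣ N) (hcard : Fintype.card α = N) (g : Perm α → ℝ) :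
    (∑ e : Fin N ≃ α, g (mOf hN e)) / Fintype.card (Fin N ≃ α) =
      (∑ m ∈ matchings (univ : Finset α), g m) / dm N := by
  classical
  have e0 : Fin N ≃ α := Fintype.equivOfCardEq (by simp [hcard])
  set k := (univ.filter fun e : Fin N ≃ α => mOf hN e = mOf hN e0).card with hk
  have hkpos : 0 < k := Finset.card_pos.2 ⟨e0, by simp⟩
  have hsum : ∀ f : Perm α → ℝ, ∑ e : Fin N ≃ α, f (mOf hN e) =
      k * ∑ m ∈ matchings (univ : Finset α), f m := by
    intro f
    rw [← Finset.sum_fiberwise_of_maps_to (s := univ) (t := matchings (univ : Finset α))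
      (g := fun e : Fin N ≃ α => mOf hN e) (fun e _ => mOf_mem hN e), Finset.mul_sum]
    refine Finset.sum_congr rfl fun m hm => ?_
    rw [Finset.sum_congr rfl (g := fun _ => f m)]
    · rw [Finset.sum_const, nsmul_eq_mul, hk, card_fiber hN hm (mOf_mem hN e0)]
    · intro e he
      rw [(Finset.mem_filter.1 he).2]
  have h1 := hsum (fun _ => 1)
  have h2 := hsum g
  simp only [Finset.sum_const, nsmul_eq_mul, mul_one, Finset.card_univ, card_matchings, hcard] at h1
  rw [h1, h2, mul_div_mul_left]
  exact_mod_cast hkpos.ne'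

lemma sat_iff (n : ℕ) (d : Fin n → ℕ) (hd : 2 ∣ ∑ i, d i) (e : Fin (∑ i, d i) ≃ Clones n d)
    (s : Clones n d → Bool) :
    Satisfiable (cnfOfConfig n 2 d e s) ↔
      Sat (Sigma.fst : Clones n d → Fin n) (mOf hd e) s := by
  unfold Satisfiable Sat cnfOfConfig
  refine exists_congr fun a => ?_
  constructor
  · intro h c
    obtain ⟨x, rfl⟩ := e.surjective c
    rw [mOf_apply]
    have hx := x.2
    have := h _ (Multiset.mem_map_of_mem _ (Finset.mem_univ (⟨x.1 / 2, by omega⟩ : Fin ((∑ i, d i) / 2))))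
    obtain ⟨l, hl, hal⟩ := this
    rw [Multiset.mem_map] at hl
    obtain ⟨t, -, rfl⟩ := hl
    unfold tauFun
    by_cases hp : x.1 % 2 = 0
    · fin_cases t
      · left
        convert hal using 3
        all_goals first | (apply Fin.ext; simp; omega) | (simp; omega) | (congr 2; apply Fin.ext; simp; omega) | (congr 2; simp; omega)
      · right
        rw [dif_pos hp]
        convert hal using 3
        all_goals first | (apply Fin.ext; simp; omega) | (simp; omega) | (congr 2; apply Fin.ext; simp; omega) | (congr 2; simp; omega)
    · fin_cases t
      · right
        rw [dif_neg hp]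
        convert hal using 3
        all_goals first | (apply Fin.ext; simp; omega) | (simp; omega) | (congr 2; apply Fin.ext; simp; omega) | (congr 2; simp; omega)
      · left
        convert hal using 3
        all_goals first | (apply Fin.ext; simp; omega) | (simp; omega) | (congr 2; apply Fin.ext; simp; omega) | (congr 2; simp; omega)
  · intro h c hc
    rw [Multiset.mem_map] at hc
    obtain ⟨j, -, rfl⟩ := hc
    have hj := j.2
    have hx : j.1 * 2 + 0 < ∑ i, d i := by omega
    have := h (e ⟨j.1 * 2 + 0, hx⟩)
    rw [mOf_apply] at this
    have ht : tauFun _ hd ⟨j.1 * 2 + 0, hx⟩ = ⟨j.1 * 2 + 1, by omega⟩ := by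
      unfold tauFun; simp
    rw [ht] at this
    rcases this with h | h
    · exact ⟨_, Multiset.mem_map_of_mem _ (Finset.mem_univ (0 : Fin 2)), h⟩
    · exact ⟨_, Multiset.mem_map_of_mem _ (Finset.mem_univ (1 : Fin 2)), h⟩

lemma formula_prob (n : ℕ) (d : Fin n → ℕ) (hd : 2 ∣ ∑ i, d i) :
    (formulaPMF n 2 d).toMeasure {φ | Satisfiable φ} =
      ENNReal.ofReal (prob univ (Sat (Sigma.fst : Clones n d → Fin n))) := by
  classical
  rw [PMF.toMeasure_apply_eq_toOuterMeasure_apply _ (by trivial)]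
  unfold formulaPMF
  rw [PMF.toOuterMeasure_bind_apply, tsum_fintype]
  have hcard : Fintype.card (Clones n d) = ∑ i, d i := by simp
  have key : ∀ e : Fin (∑ i, d i) ≃ Clones n d,
      (PMF.uniformOfFintype (Fin (∑ i, d i) ≃ Clones n d)) e *
      ((PMF.uniformOfFintype (Clones n d → Bool)).map fun s => cnfOfConfig n 2 d e s).toOuterMeasure
        {φ | Satisfiable φ} = ENNReal.ofReal
        (((∑ s : Clones n d → Bool, if Sat (Sigma.fst : Clones n d → Fin n) (mOf hd e) s then (1:ℝ) else 0)
          / 2 ^ Fintype.card (Clones n d)) / Fintype.card (Fin (∑ i, d i) ≃ Clones n d)) := by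
    intro e
    rw [PMF.toOuterMeasure_map_apply, PMF.toOuterMeasure_uniformOfFintype_apply,
      PMF.uniformOfFintype_apply]
    have hs : Fintype.card ((fun s => cnfOfConfig n 2 d e s) ⁻¹' {φ | Satisfiable φ}) =
        (univ.filter fun s : Clones n d → Bool =>
          Sat (Sigma.fst : Clones n d → Fin n) (mOf hd e) s).card := by
      rw [Fintype.card_subtype]
      congr 1
      ext s
      simp only [Set.mem_preimage, Set.mem_ofPred_eq, Finset.mem_filter, Finset.mem_univ, true_and]
      exact sat_iff n d hd e s
    rw [hs, Finset.sum_boole]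
    have hpos : 0 < Fintype.card (Fin (∑ i, d i) ≃ Clones n d) :=
      Fintype.card_pos_iff.2 (clonesEquivNonempty n d)
    rw [ENNReal.ofReal_div_of_pos (by exact_mod_cast hpos), ENNReal.ofReal_div_of_pos (by positivity),
      ENNReal.ofReal_natCast, ENNReal.ofReal_natCast, ENNReal.ofReal_pow (by norm_num)]
    rw [div_eq_mul_inv (_ / _), mul_comm]
    congr 2
    simp
  rw [Finset.sum_congr rfl fun e _ => key e, ← ENNReal.ofReal_sum_of_nonneg]
  · congr 1
    rw [← Finset.sum_div, avg_eq hd hcard (fun m => (∑ s : Clones n d → Bool, if Sat (Sigma.fst : Clones n d → Fin n) m s then (1:ℝ) else 0)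
          / 2 ^ Fintype.card (Clones n d))]
    unfold prob
    rw [← Finset.sum_div, div_div, Finset.card_univ, hcard, mul_comm]
  · intro e _
    apply div_nonneg (div_nonneg _ (by positivity)) (by positivity)
    exact Finset.sum_nonneg fun s _ => by split_ifs <;> norm_num

end Transfer


section Degrees

lemma clones_card (n : ℕ) (d : Fin n → ℕ) : Fintype.card (Clones n d) = ∑ i, d i := by simp

lemma clonesOf_card (n : ℕ) (d : Fin n → ℕ) (i : Fin n) :
    (clonesOf (Sigma.fst : Clones n d → Fin n) i).card = d i := by
  have : clonesOf (Sigma.fst : Clones n d → Fin n) i =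
      (Finset.univ : Finset (Fin (d i))).map (Function.Embedding.sigmaMk i) := by
    ext ⟨j, t⟩
    simp only [clonesOf, Finset.mem_filter, Finset.mem_univ, true_and, Finset.mem_map,
      Function.Embedding.sigmaMk_apply]
    constructor
    · rintro rfl
      exact ⟨t, rfl⟩
    · rintro ⟨a, h⟩
      cases h
      rfl
  rw [this, Finset.card_map, Finset.card_univ, Fintype.card_fin]

lemma dpairs_card (n : ℕ) (d : Fin n → ℕ) :
    (dpairs (Sigma.fst : Clones n d → Fin n)).card = ∑ i, d i * (d i - 1) := by
  classical
  rw [Finset.card_eq_sum_card_fiberwise (f := fun p => p.1.1) (t := Finset.univ)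
    (fun _ _ => Finset.mem_coe.2 (Finset.mem_univ _))]
  refine Finset.sum_congr rfl fun i _ => ?_
  have : (dpairs (Sigma.fst : Clones n d → Fin n)).filter (fun p => p.1.1 = i) =
      (clonesOf (Sigma.fst : Clones n d → Fin n) i).offDiag := by
    ext ⟨p, q⟩
    simp only [dpairs, clonesOf, Finset.mem_filter, Finset.mem_univ, true_and, Finset.mem_offDiag]
    constructor
    · rintro ⟨⟨h1, h2⟩, h3⟩
      exact ⟨h3, h2 ▸ h3, h1⟩
    · rintro ⟨h1, h2, h3⟩
      exact ⟨⟨h3, h1.trans h2.symm⟩, h1⟩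
  rw [this, Finset.offDiag_card, clonesOf_card, Nat.mul_sub, mul_one]

lemma freshSum_clones (n : ℕ) (d : Fin n → ℕ) (F : Finset (Fin n)) :
    freshSum (Sigma.fst : Clones n d → Fin n) F = ∑ i ∈ F, d i * (d i - 1) := by
  unfold freshSum
  exact Finset.sum_congr rfl fun i _ => by rw [clonesOf_card]

/-- the unconditioned law of the degree sequence -/
noncomputable abbrev degPi (n : ℕ) (ξ : PMF ℕ) : Measure (Fin n → ℕ) :=
  Measure.pi fun _ : Fin n => ξ.toMeasure

lemma parity_bound (ξ : PMF ℕ) (n : ℕ) :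
    min (ξ.toMeasure {x | Even x}) (ξ.toMeasure {x | ¬ Even x}) ≤
      degPi (n+1) ξ {d | 2 ∣ ∑ i, d i} := by
  have hmp := measurePreserving_piFinSuccAbove (fun _ : Fin (n+1) => ξ.toMeasure) 0
  set E : Set (Fin n → ℕ) := {d | Even (∑ i, d i)} with hE
  have hset : {d : Fin (n+1) → ℕ | 2 ∣ ∑ i, d i} =
      (MeasurableEquiv.piFinSuccAbove (fun _ : Fin (n+1) => ℕ) 0) ⁻¹'
        (({x | Even x} ×ˢ E) ∪ ({x | ¬ Even x} ×ˢ Eᶜ)) := by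
    ext d
    simp only [Set.mem_ofPred_eq, Set.mem_preimage, Set.mem_union, Set.mem_prod, hE,
      Set.mem_compl_iff, MeasurableEquiv.piFinSuccAbove_apply, Fin.insertNthEquiv_symm_apply,
      Fin.removeNth, Fin.zero_succAbove]
    rw [← even_iff_two_dvd, Fin.sum_univ_succ, Nat.even_add]
    tauto
  rw [hset, hmp.measure_preimage (MeasurableSet.of_discrete.nullMeasurableSet)]
  rw [measure_union _ MeasurableSet.of_discrete, Measure.prod_prod, Measure.prod_prod]
  · have h1 : degPi n ξ E + degPi n ξ Eᶜ = 1 := prob_add_prob_compl MeasurableSet.of_discrete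
    calc _ = min (ξ.toMeasure {x | Even x}) (ξ.toMeasure {x | ¬ Even x}) * (degPi n ξ E + degPi n ξ Eᶜ) := by
          rw [h1, mul_one]
      _ ≤ _ := by
        rw [mul_add]
        gcongr
        · exact min_le_left _ _
        · exact min_le_right _ _
  · rw [Set.disjoint_left]
    rintro ⟨a, b⟩ h1 h2
    exact h2.1 h1.1

lemma config_apply (n : ℕ) (ξ : PMF ℕ) (E : Set (CNF n)) :
    configurationModel n 2 ξ E =
      ∫⁻ d, (formulaPMF n 2 d).toMeasure E ∂(degreeMeasure n 2 ξ) := by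
  unfold configurationModel
  exact Measure.bind_apply (by trivial) (Measurable.of_discrete.aemeasurable)

lemma config_prob (n : ℕ) (ξ : PMF ℕ) (h : degPi n ξ {d | 2 ∣ ∑ i, d i} ≠ 0) :
    configurationModel n 2 ξ Set.univ = 1 := by
  have : IsProbabilityMeasure (degreeMeasure n 2 ξ) := cond_isProbabilityMeasure h
  rw [config_apply]
  simp

lemma bad_tendsto (ξ : PMF ℕ) (h0 : ξ.toMeasure {x | Even x} ≠ 0)
    (h1 : ξ.toMeasure {x | ¬ Even x} ≠ 0) (E : ∀ n, Set (CNF n))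
    (h : ∀ η : ℝ, 0 < η → ∃ G : ∀ n, Set (Fin n → ℕ),
      Tendsto (fun n => degPi n ξ (G n)ᶜ) atTop (nhds 0) ∧
      ∀ᶠ n in atTop, ∀ d ∈ G n, 2 ∣ ∑ i, d i →
        (formulaPMF n 2 d).toMeasure (E n) ≤ ENNReal.ofReal η) :
    Tendsto (fun n => configurationModel n 2 ξ (E n)) atTop (nhds 0) := by
  set c := min (ξ.toMeasure {x | Even x}) (ξ.toMeasure {x | ¬ Even x}) with hc
  have hc0 : c ≠ 0 := by
    rw [hc]; intro h
    rcases min_choice (ξ.toMeasure {x | Even x}) (ξ.toMeasure {x | ¬ Even x}) with h' | h' <;>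
    rw [h'] at h <;> contradiction
  rw [ENNReal.tendsto_nhds_zero]
  intro ε hε
  obtain ⟨η, hη0, hη⟩ : ∃ η : ℝ, 0 < η ∧ ENNReal.ofReal η ≤ ε / 2 := by
    by_cases htop : ε = ⊤
    · exact ⟨1, one_pos, by rw [htop, ENNReal.top_div_of_ne_top (by norm_num)]; exact le_top⟩
    · refine ⟨(ε/2).toReal, ENNReal.toReal_pos ?_ ?_, ?_⟩
      · simp [hε.ne']
      · exact ENNReal.div_ne_top htop (by norm_num)
      · rw [ENNReal.ofReal_toReal (ENNReal.div_ne_top htop (by norm_num))]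
  obtain ⟨G, hG, hGE⟩ := h η hη0
  have hG' : Tendsto (fun n => c⁻¹ * degPi n ξ (G n)ᶜ) atTop (nhds 0) := by
    have := ENNReal.Tendsto.const_mul hG (a := c⁻¹) (Or.inr (ENNReal.inv_ne_top.2 hc0))
    simpa using this
  rw [ENNReal.tendsto_nhds_zero] at hG'
  filter_upwards [hG' (ε/2) (by simp [hε.ne']), hGE, eventually_ge_atTop 1] with n hn1 hn2 hn3
  obtain ⟨m, rfl⟩ : ∃ m, n = m + 1 := ⟨n - 1, by omega⟩
  have hpar := parity_bound ξ m
  rw [← hc] at hpar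
  have hne : degPi (m+1) ξ {d | 2 ∣ ∑ i, d i} ≠ 0 := by
    intro h; rw [h] at hpar; exact hc0 (le_antisymm hpar (zero_le))
  have hP : IsProbabilityMeasure (degreeMeasure (m+1) 2 ξ) := cond_isProbabilityMeasure hne
  rw [config_apply]
  have hae : ∀ᵐ d ∂(degreeMeasure (m+1) 2 ξ), 2 ∣ ∑ i, d i :=
    ae_cond_mem MeasurableSet.of_discrete
  calc _ ≤ ∫⁻ d, (ENNReal.ofReal η + (G (m+1))ᶜ.indicator 1 d) ∂(degreeMeasure (m+1) 2 ξ) := by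
        apply lintegral_mono_ae
        filter_upwards [hae] with d hd
        by_cases hdG : d ∈ G (m+1)
        · exact (hn2 d hdG hd).trans (le_add_right le_rfl)
        · rw [Set.indicator_of_mem (by exact hdG)]
          exact MeasureTheory.prob_le_one.trans (le_add_left le_rfl)
    _ = ENNReal.ofReal η + degreeMeasure (m+1) 2 ξ (G (m+1))ᶜ := by
        rw [lintegral_add_left measurable_const, lintegral_indicator_one MeasurableSet.of_discrete]
        simp
    _ ≤ ε / 2 + ε / 2 := by
        gcongr
        refine le_trans ?_ hn1
        unfold degreeMeasure
        rw [cond_apply MeasurableSet.of_discrete]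
        gcongr
        · exact Set.inter_subset_right
    _ = ε := ENNReal.add_halves ε

end Degrees


section LLN

lemma lln_pos (ξ : PMF ℕ) (f : ℕ → ℝ) (hfint : Integrable f ξ.toMeasure)
    (hpos : 0 < ∫ x, f x ∂ξ.toMeasure) :
    Tendsto (fun n => degPi n ξ {d | 0 < ∑ i, f (d i)}ᶜ) atTop (nhds 0) := by
  set P : Measure (ℕ → ℕ) := Measure.infinitePi fun _ : ℕ => ξ.toMeasure with hP
  have hmf : Measurable f := Measurable.of_discrete
  let X : ℕ → (ℕ → ℕ) → ℝ := fun i ω => f (ω i)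
  have hXm : ∀ i, Measurable (X i) := fun i => hmf.comp (measurable_pi_apply i)
  have hmp : ∀ i, MeasurePreserving (Function.eval i : (ℕ → ℕ) → ℕ) P ξ.toMeasure := fun i =>
    measurePreserving_eval_infinitePi (fun _ : ℕ => ξ.toMeasure) i
  have hXint : Integrable (X 0) P := (hmp 0).integrable_comp_of_integrable hfint
  have hmean : ∫ ω, X 0 ω ∂P = ∫ x, f x ∂ξ.toMeasure := by
    rw [← (hmp 0).map_eq, integral_map (measurable_pi_apply 0).aemeasurable hmf.aestronglyMeasurable]
  have hind : iIndepFun X P := iIndepFun_infinitePi (X := fun _ => f) (fun _ => hmf)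
  have hid : ∀ i, IdentDistrib (X i) (X 0) P P := fun i =>
    { aemeasurable_fst := (hXm i).aemeasurable
      aemeasurable_snd := (hXm 0).aemeasurable
      map_eq := by
        have h : ∀ j, P.map (X j) = ξ.toMeasure.map f := fun j => by
          rw [← (hmp j).map_eq, Measure.map_map hmf (measurable_pi_apply j)]
          rfl
        rw [h, h] }
  have hsl := strong_law_ae_real X hXint (fun i j hij => hind.indepFun hij) hid
  rw [hmean] at hsl
  set m := ∫ x, f x ∂ξ.toMeasure with hm
  have hmeas := tendstoInMeasure_of_tendsto_ae (μ := P)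
    (f := fun (n : ℕ) ω => (∑ i ∈ Finset.range n, X i ω) / n) (g := fun _ => m)
    (fun n => ((Finset.measurable_sum _ fun i _ => hXm i).div_const _).aestronglyMeasurable) hsl
  have h2 := hmeas (ENNReal.ofReal m) (by simpa using hpos)
  refine tendsto_of_tendsto_of_tendsto_of_le_of_le tendsto_const_nhds h2 (fun _ => zero_le) ?_
  intro n
  have hmap : P.map (fun ω (i : Fin n) => ω i.1) = degPi n ξ := by
    rw [hP, Measure.map_infinitePi_infinitePi_of_inj (f := (Fin.val : Fin n → ℕ)) Fin.val_injective,
      Measure.infinitePi_eq_pi]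
  show degPi n ξ _ ≤ _
  rw [← hmap, Measure.map_apply (measurable_pi_lambda _ fun i => measurable_pi_apply _)
    MeasurableSet.of_discrete]
  apply measure_mono
  intro ω hω
  simp only [Set.mem_preimage, Set.mem_compl_iff, Set.mem_ofPred_eq, not_lt] at hω ⊢
  rw [edist_dist]
  apply ENNReal.ofReal_le_ofReal
  rw [Real.dist_eq]
  have : (∑ i ∈ Finset.range n, X i ω) / n ≤ 0 := by
    apply div_nonpos_of_nonpos_of_nonneg _ (by positivity)
    rw [Finset.sum_range]
    exact hω
  rw [abs_of_nonpos (by linarith)]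
  linarith

lemma integrable_of_summable (ξ : PMF ℕ) (f : ℕ → ℝ)
    (h : Summable fun k => |f k| * (ξ k).toReal) : Integrable f ξ.toMeasure := by
  refine ⟨Measurable.of_discrete.aestronglyMeasurable, ?_⟩
  unfold HasFiniteIntegral
  rw [lintegral_countable']
  have : ∀ k, ‖f k‖ₑ * ξ.toMeasure {k} = ENNReal.ofReal (|f k| * (ξ k).toReal) := by
    intro k
    rw [PMF.toMeasure_apply_singleton _ _ MeasurableSet.of_discrete, ENNReal.ofReal_mul (abs_nonneg _),
      ENNReal.ofReal_toReal (PMF.apply_ne_top _ _), ← Real.norm_eq_abs, ofReal_norm]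
  simp_rw [this]
  exact h.tsum_ofReal_lt_top

variable {ξ : PMF ℕ} {β : ℝ}

lemma zetaR_summable (hβ : 1 < β) : Summable fun m : ℕ => (m : ℝ) ^ (-β) :=
  Real.summable_nat_rpow.2 (by linarith)

lemma zetaR_eq (hβ : 1 < β) : zetaR β = ∑' m : ℕ, (m : ℝ) ^ (-β) := by
  unfold zetaR
  rw [tsum_pnat_eq_tsum_succ (f := fun m : ℕ => (m:ℝ) ^ (-β)), (zetaR_summable hβ).tsum_eq_zero_add]
  simp [Real.zero_rpow (show -β ≠ 0 by linarith)]

lemma zetaR_pos (hβ : 1 < β) : 0 < zetaR β := by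
  rw [zetaR_eq hβ]
  exact (zetaR_summable hβ).tsum_pos (fun i => by positivity) 1 (by simp)

lemma zeta_toReal (hξ : IsZeta ξ β) (hβ : 1 < β) (k : ℕ) :
    (ξ k).toReal = (k : ℝ) ^ (-β) / zetaR β := by
  rw [hξ k, ENNReal.toReal_ofReal]
  exact div_nonneg (by positivity) (zetaR_pos hβ).le

/-- one-sided weak law of large numbers for zeta-distributed degrees -/
lemma lln_zeta (hξ : IsZeta ξ β) (hβ : 1 < β) (f : ℕ → ℝ)
    (hs : Summable fun k : ℕ => f k * (k : ℝ) ^ (-β))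
    (hpos : 0 < ∑' k : ℕ, f k * (k : ℝ) ^ (-β)) :
    Tendsto (fun n => degPi n ξ {d | 0 < ∑ i, f (d i)}ᶜ) atTop (nhds 0) := by
  have hz := zetaR_pos hβ
  have hfint : Integrable f ξ.toMeasure := by
    apply integrable_of_summable
    have := (hs.abs).div_const (zetaR β)
    refine this.congr fun k => ?_
    rw [zeta_toReal hξ hβ, abs_mul, abs_of_nonneg (show 0 ≤ (k:ℝ)^(-β) by positivity)]
    ring
  refine lln_pos ξ f hfint ?_
  rw [PMF.integral_eq_tsum _ _ hfint]
  have : ∀ k, (ξ k).toReal • f k = f k * (k : ℝ) ^ (-β) / zetaR β := by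
    intro k
    rw [zeta_toReal hξ hβ, smul_eq_mul]; ring
  simp_rw [this]
  rw [tsum_div_const]
  positivity

lemma zeta_even_ne (hξ : IsZeta ξ β) (hβ : 1 < β) : ξ.toMeasure {x | Even x} ≠ 0 := by
  intro h
  have : ξ.toMeasure {2} = 0 := measure_mono_null (by simp) h
  rw [PMF.toMeasure_apply_singleton _ _ MeasurableSet.of_discrete, hξ, ENNReal.ofReal_eq_zero] at this
  have h2 : 0 < ((2:ℕ):ℝ)^(-β) / zetaR β := div_pos (by positivity) (zetaR_pos hβ)
  linarith

lemma zeta_odd_ne (hξ : IsZeta ξ β) (hβ : 1 < β) : ξ.toMeasure {x | ¬ Even x} ≠ 0 := by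
  intro h
  have : ξ.toMeasure {1} = 0 := measure_mono_null (by simp) h
  rw [PMF.toMeasure_apply_singleton _ _ MeasurableSet.of_discrete, hξ, ENNReal.ofReal_eq_zero] at this
  have h2 : 0 < ((1:ℕ):ℝ)^(-β) / zetaR β := div_pos (by positivity) (zetaR_pos hβ)
  linarith

lemma zeta_zero (hξ : IsZeta ξ β) (hβ : 1 < β) : ξ 0 = 0 := by
  rw [hξ]; simp [Real.zero_rpow (show -β ≠ 0 by linarith)]

/-- all degrees are positive almost surely -/
lemma degPi_pos (hξ : IsZeta ξ β) (hβ : 1 < β) (n : ℕ) :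
    degPi n ξ {d | ∀ i, 1 ≤ d i}ᶜ = 0 := by
  have : {d : Fin n → ℕ | ∀ i, 1 ≤ d i}ᶜ ⊆ ⋃ i, (Function.eval i) ⁻¹' {0} := by
    intro d hd
    simp only [Set.mem_compl_iff, Set.mem_ofPred_eq, not_forall] at hd
    obtain ⟨i, hi⟩ := hd
    simp only [Set.mem_iUnion]
    exact ⟨i, by simp; omega⟩
  refine measure_mono_null this (measure_iUnion_null fun i => ?_)
  rw [(measurePreserving_eval (fun _ : Fin n => ξ.toMeasure) i).measure_preimage
    MeasurableSet.of_discrete.nullMeasurableSet,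
    PMF.toMeasure_apply_singleton _ _ MeasurableSet.of_discrete, zeta_zero hξ hβ]

lemma inter_whp {n0 : ∀ n : ℕ, Measure (Fin n → ℕ)} {A B : ∀ n, Set (Fin n → ℕ)}
    (hA : Tendsto (fun n => n0 n (A n)ᶜ) atTop (nhds 0))
    (hB : Tendsto (fun n => n0 n (B n)ᶜ) atTop (nhds 0)) :
    Tendsto (fun n => n0 n (A n ∩ B n)ᶜ) atTop (nhds 0) := by
  have := hA.add hB
  rw [add_zero] at this
  refine tendsto_of_tendsto_of_tendsto_of_le_of_le tendsto_const_nhds this (fun _ => zero_le) ?_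
  intro n
  show n0 n _ ≤ _
  rw [Set.compl_inter]
  exact measure_union_le _ _

end LLN


section Regimes
variable {ξ : PMF ℕ} {β : ℝ}

lemma summable_pow_zeta (j : ℕ) (hβ : (j : ℝ) + 1 < β) :
    Summable fun k : ℕ => (k : ℝ) ^ j * (k : ℝ) ^ (-β) := by
  have h : Summable fun k : ℕ => (k : ℝ) ^ (-(β - j)) := zetaR_summable (by linarith)
  refine h.congr fun k => ?_
  rcases Nat.eq_zero_or_pos k with rfl | hk
  · have h1 : -(β - j) ≠ 0 := by linarith
    have h2 : -β ≠ 0 := by have : (0:ℝ) ≤ j := by positivity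
                           linarith
    simp [Real.zero_rpow h2]
    rw [Real.zero_rpow]
    intro h; apply h1; linarith
  · rw [← Real.rpow_natCast, ← Real.rpow_add (by exact_mod_cast hk)]
    congr 1; ring

lemma sum_ge_n {n : ℕ} {d : Fin n → ℕ} (h : ∀ i, 1 ≤ d i) : n ≤ ∑ i, d i := by
  calc n = ∑ _i : Fin n, 1 := by simp
    _ ≤ _ := Finset.sum_le_sum fun i _ => h i

lemma cast_sum_pairs {n : ℕ} {d : Fin n → ℕ} (F : Finset (Fin n)) :
    ((∑ i ∈ F, d i * (d i - 1) : ℕ) : ℝ) = ∑ i ∈ F, ((d i : ℝ) ^ 2 - d i) := by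
  push_cast
  refine Finset.sum_congr rfl fun i _ => ?_
  rcases Nat.eq_zero_or_pos (d i) with h | h
  · simp [h]
  · rw [Nat.cast_sub h]; push_cast; ring

lemma notSat_prob (n : ℕ) (d : Fin n → ℕ) (hd : 2 ∣ ∑ i, d i) :
    (formulaPMF n 2 d).toMeasure {φ | Satisfiable φ}ᶜ =
      ENNReal.ofReal (prob Finset.univ (fun m s => ¬ Sat (Sigma.fst : Clones n d → Fin n) m s)) := by
  rw [prob_compl_eq_one_sub (by trivial), formula_prob n d hd, prob_not]
  · rw [ENNReal.ofReal_sub _ (prob_nonneg _ _), ENNReal.ofReal_one]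
  · rw [Finset.card_univ, clones_card]; exact even_iff_two_dvd.2 hd

lemma regime_sat (hξ : IsZeta ξ β) (hβ : 3 < β)
    (hpos : 0 < ∑' k : ℕ, (3 * (k:ℝ) - (k:ℝ)^2) * (k : ℝ) ^ (-β)) :
    Tendsto (fun n => configurationModel n 2 ξ {φ | Satisfiable φ}) atTop (nhds 1) := by
  have hβ1 : 1 < β := by linarith
  have s0 := zetaR_summable hβ1
  have s1 := summable_pow_zeta (β := β) 1 (by norm_num; linarith)
  have s2 := summable_pow_zeta (β := β) 2 (by norm_num; linarith)
  have hbad : Tendsto (fun n => configurationModel n 2 ξ {φ | Satisfiable φ}ᶜ) atTop (nhds 0) := by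
    apply bad_tendsto ξ (zeta_even_ne hξ hβ1) (zeta_odd_ne hξ hβ1) (fun n => {φ | Satisfiable φ}ᶜ)
    intro η hη
    have hT : 0 < ∑' k : ℕ, (k:ℝ)^1 * (k : ℝ) ^ (-β) :=
      s1.tsum_pos (fun i => by positivity) 1 (by simp)
    have e1 : ∀ ε : ℝ, ∀ k : ℕ, ((3-ε) * (k:ℝ) - (k:ℝ)^2) * (k : ℝ) ^ (-β) =
        (3 - ε) * ((k:ℝ)^1 * (k : ℝ) ^ (-β)) - (k:ℝ)^2 * (k : ℝ) ^ (-β) := fun ε k => by ring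
    have s3 : ∀ ε : ℝ, Summable fun k : ℕ => ((3-ε) * (k:ℝ) - (k:ℝ)^2) * (k : ℝ) ^ (-β) := fun ε =>
      ((s1.mul_left (3-ε)).sub s2).congr fun k => (e1 ε k).symm
    have t3 : ∀ ε : ℝ, ∑' k : ℕ, ((3-ε) * (k:ℝ) - (k:ℝ)^2) * (k : ℝ) ^ (-β) =
        (3 - ε) * ∑' k : ℕ, (k:ℝ)^1 * (k : ℝ) ^ (-β) - ∑' k : ℕ, (k:ℝ)^2 * (k : ℝ) ^ (-β) := fun ε => by
      rw [tsum_congr (e1 ε), (s1.mul_left (3-ε)).tsum_sub s2, tsum_mul_left]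
    have t0 := t3 0
    rw [sub_zero] at t0
    rw [t0] at hpos
    set T := ∑' k : ℕ, (k:ℝ)^1 * (k : ℝ) ^ (-β)
    set U := ∑' k : ℕ, (k:ℝ)^2 * (k : ℝ) ^ (-β)
    obtain ⟨ε, hε, hεT⟩ : ∃ ε : ℝ, 0 < ε ∧ 0 < (3 - ε) * T - U := by
      refine ⟨(3 * T - U) / (2 * T), by positivity, ?_⟩
      have : (3 * T - U) / (2 * T) * T = (3 * T - U) / 2 := by field_simp
      rw [sub_mul, this]; linarith
    obtain ⟨δ, hδ, S0, hA⟩ := sat_A ε hε η hη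
    -- the tail of the second moment
    have htail := (tendsto_sum_nat_add (fun k : ℕ => (k:ℝ)^2 * (k : ℝ) ^ (-β)))
    have hz : 0 < ∑' k : ℕ, (k:ℝ) ^ (-β) := s0.tsum_pos (fun i => by positivity) 1 (by simp)
    obtain ⟨K, hK⟩ := ((htail.eventually (gt_mem_nhds (show (0:ℝ) < δ * ∑' k : ℕ, (k:ℝ) ^ (-β) by positivity)))).exists
    set g : ℕ → ℝ := fun k => if k < K then 0 else (k:ℝ)^2 with hg
    have sg : Summable fun k : ℕ => g k * (k : ℝ) ^ (-β) := by
      refine Summable.of_nonneg_of_le (fun k => ?_) (fun k => ?_) s2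
      · simp only [hg]; split_ifs <;> positivity
      · simp only [hg]; split_ifs
        · rw [zero_mul]; positivity
        · exact le_rfl
    have tg : ∑' k : ℕ, g k * (k : ℝ) ^ (-β) = ∑' k : ℕ, ((k+K:ℕ):ℝ)^2 * ((k+K:ℕ) : ℝ) ^ (-β) := by
      rw [← sg.sum_add_tsum_nat_add K, Finset.sum_eq_zero, zero_add]
      · refine tsum_congr fun k => ?_
        simp only [hg]; rw [if_neg (by omega)]
      · intro k hk
        simp only [hg]; rw [if_pos (Finset.mem_range.1 hk), zero_mul]
    have e2 : ∀ k : ℕ, (δ - g k) * (k : ℝ) ^ (-β) = δ * (k : ℝ) ^ (-β) - g k * (k : ℝ) ^ (-β) :=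
      fun k => by ring
    have L1 := lln_zeta hξ hβ1 (fun k => (3-ε) * (k:ℝ) - (k:ℝ)^2) (s3 ε) (by rw [t3]; exact hεT)
    have L2 := lln_zeta hξ hβ1 (fun k => δ - g k)
      (((s0.mul_left δ).sub sg).congr fun k => (e2 k).symm)
      (by rw [tsum_congr e2, (s0.mul_left δ).tsum_sub sg, tsum_mul_left, tg]; linarith)
    have L3 : Tendsto (fun n => degPi n ξ {d | ∀ i, 1 ≤ d i}ᶜ) atTop (nhds 0) := by
      simp_rw [degPi_pos hξ hβ1]; exact tendsto_const_nhds
    refine ⟨_, inter_whp (inter_whp L1 L2) L3, ?_⟩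
    filter_upwards [eventually_ge_atTop 1, eventually_ge_atTop S0,
      eventually_ge_atTop (⌈(K:ℝ)^2 / δ⌉₊)] with n hn1 hnS hnK
    rintro d ⟨⟨h1, h2⟩, h3⟩ hd
    simp only [Set.mem_ofPred_eq] at h1 h2 h3
    rw [notSat_prob n d hd]
    apply ENNReal.ofReal_le_ofReal
    have hSn := sum_ge_n h3
    have hSnR : (n:ℝ) ≤ ((∑ i, d i : ℕ) : ℝ) := by exact_mod_cast hSn
    have hKn : (K:ℝ)^2 ≤ δ * n := by
      have := Nat.le_of_ceil_le hnK
      rw [div_le_iff₀ hδ] at this; linarith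
    have hcard := clones_card n d
    have hg0 : ∀ k, 0 ≤ g k := fun k => by simp only [hg]; split_ifs <;> positivity
    have hsq : ∀ i, (d i : ℝ)^2 ≤ δ * n := by
      intro i
      by_cases hi : d i < K
      · refine le_trans ?_ hKn
        have : (d i : ℝ) ≤ K := by exact_mod_cast hi.le
        gcongr
      · have h4 : g (d i) ≤ ∑ i, g (d i) :=
          Finset.single_le_sum (f := fun i => g (d i)) (fun i _ => hg0 _) (Finset.mem_univ i)
        have h5 : g (d i) = (d i : ℝ)^2 := by simp only [hg]; rw [if_neg hi]
        rw [Finset.sum_sub_distrib] at h2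
        simp at h2
        rw [h5] at h4
        linarith
    refine hA (Clones n d) (Fin n) Sigma.fst (Finset.univ.sup d) ?_ ?_ ?_ ?_ ?_
    · rw [hcard]; omega
    · rw [hcard]; exact even_iff_two_dvd.2 hd
    · intro v; rw [clonesOf_card]; exact Finset.le_sup (Finset.mem_univ v)
    · have : Nonempty (Fin n) := ⟨⟨0, by omega⟩⟩
      obtain ⟨i, -, hi⟩ := Finset.exists_mem_eq_sup (Finset.univ : Finset (Fin n)) Finset.univ_nonempty d
      rw [hi, hcard]
      refine (hsq i).trans ?_
      gcongr
    · rw [dpairs_card, hcard, cast_sum_pairs]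
      rw [Finset.sum_sub_distrib, ← Finset.mul_sum] at h1
      rw [Finset.sum_sub_distrib]
      push_cast
      linarith
  have h1 : ∀ᶠ n in atTop, configurationModel n 2 ξ {φ | Satisfiable φ} =
      1 - configurationModel n 2 ξ {φ | Satisfiable φ}ᶜ := by
    filter_upwards [eventually_ge_atTop 1] with n hn
    obtain ⟨m, rfl⟩ : ∃ m, n = m + 1 := ⟨n - 1, by omega⟩
    have hne : degPi (m+1) ξ {d | 2 ∣ ∑ i, d i} ≠ 0 := by
      intro h
      have hpar := parity_bound ξ m
      rw [h] at hpar
      have := le_antisymm hpar (zero_le)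
      rcases min_choice (ξ.toMeasure {x | Even x}) (ξ.toMeasure {x | ¬ Even x}) with h' | h' <;>
        rw [h'] at this
      · exact zeta_even_ne hξ hβ1 this
      · exact zeta_odd_ne hξ hβ1 this
    have : IsProbabilityMeasure (configurationModel (m+1) 2 ξ) := ⟨config_prob _ ξ hne⟩
    rw [← prob_compl_eq_one_sub (by trivial), compl_compl]
  rw [tendsto_congr' h1]
  have := ENNReal.Tendsto.sub (tendsto_const_nhds (x := (1:ℝ≥0∞)) (f := (atTop : Filter ℕ))) hbad (Or.inl (by norm_num))
  simpa using this

lemma regime_B (hξ : IsZeta ξ β) (hβ : 2 < β) (M : ℕ) (ε : ℝ) (hε : 0 < ε)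
    (hpos : (2 + ε) * (∑' k : ℕ, (k:ℝ)^1 * (k : ℝ) ^ (-β)) <
      ∑ k ∈ Finset.range (M+1), ((k:ℝ)^2 - k) * (k : ℝ) ^ (-β)) :
    Tendsto (fun n => configurationModel n 2 ξ {φ | Satisfiable φ}) atTop (nhds 0) := by
  have hβ1 : 1 < β := by linarith
  have s1 := summable_pow_zeta (β := β) 1 (by norm_num; linarith)
  apply bad_tendsto ξ (zeta_even_ne hξ hβ1) (zeta_odd_ne hξ hβ1) (fun n => {φ | Satisfiable φ})
  intro η hη
  obtain ⟨S0, hB⟩ := unsat_B ε hε M η hη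
  set g : ℕ → ℝ := fun k => if k ≤ M then (k:ℝ)^2 - k else 0 with hg
  have hsup : ∀ k ∉ Finset.range (M+1), g k * (k : ℝ) ^ (-β) = 0 := by
    intro k hk
    simp only [hg]; rw [if_neg (by simpa using hk), zero_mul]
  have sg : Summable fun k : ℕ => g k * (k : ℝ) ^ (-β) := summable_of_ne_finset_zero hsup
  have tg : ∑' k : ℕ, g k * (k : ℝ) ^ (-β) =
      ∑ k ∈ Finset.range (M+1), ((k:ℝ)^2 - k) * (k : ℝ) ^ (-β) := by
    rw [tsum_eq_sum hsup]
    refine Finset.sum_congr rfl fun k hk => ?_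
    simp only [hg]; rw [if_pos (by simp at hk; omega)]
  have e2 : ∀ k : ℕ, (g k - (2+ε) * (k:ℝ)) * (k : ℝ) ^ (-β) =
      g k * (k : ℝ) ^ (-β) - (2+ε) * ((k:ℝ)^1 * (k : ℝ) ^ (-β)) := fun k => by ring
  have L1 := lln_zeta hξ hβ1 (fun k => g k - (2+ε) * (k:ℝ))
    ((sg.sub (s1.mul_left (2+ε))).congr fun k => (e2 k).symm)
    (by rw [tsum_congr e2, sg.tsum_sub (s1.mul_left (2+ε)), tsum_mul_left, tg]; linarith)
  have L3 : Tendsto (fun n => degPi n ξ {d | ∀ i, 1 ≤ d i}ᶜ) atTop (nhds 0) := by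
    simp_rw [degPi_pos hξ hβ1]; exact tendsto_const_nhds
  refine ⟨_, inter_whp L1 L3, ?_⟩
  filter_upwards [eventually_ge_atTop S0] with n hnS
  rintro d ⟨h1, h3⟩ hd
  simp only [Set.mem_ofPred_eq] at h1 h3
  rw [formula_prob n d hd]
  apply ENNReal.ofReal_le_ofReal
  have hSn := sum_ge_n h3
  have hcard := clones_card n d
  refine hB (Clones n d) (Fin n) Sigma.fst (Finset.univ.filter fun i => d i ≤ M) ?_ ?_ ?_ ?_
  · rw [hcard]; omega
  · rw [hcard]; exact even_iff_two_dvd.2 hd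
  · intro v hv; rw [clonesOf_card]; exact (Finset.mem_filter.1 hv).2
  · rw [freshSum_clones, hcard, cast_sum_pairs, Finset.sum_filter]
    rw [Finset.sum_sub_distrib, ← Finset.mul_sum] at h1
    push_cast
    simp only [hg] at h1
    linarith

end Regimes


section RegimeC
variable {ξ : PMF ℕ} {β : ℝ}

lemma tail_lower (hξ : IsZeta ξ β) (hβ1 : 1 < β) (hβ2 : β ≤ 2) (T : ℕ) (hT : 1 ≤ T) :
    ENNReal.ofReal (1 / (4 * T * zetaR β)) ≤ ξ.toMeasure (Set.Iio T)ᶜ := by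
  have hz := zetaR_pos hβ1
  have hTR : (1:ℝ) ≤ T := by exact_mod_cast hT
  have hsub : ((Finset.Ico T (2*T) : Finset ℕ) : Set ℕ) ⊆ (Set.Iio T)ᶜ := by
    intro k hk
    simp at hk ⊢; omega
  refine le_trans ?_ (measure_mono hsub)
  rw [PMF.toMeasure_apply_finset _ _]
  have hk : ∀ k ∈ Finset.Ico T (2*T), ENNReal.ofReal (1 / (4 * T^2 * zetaR β)) ≤ ξ k := by
    intro k hk
    rw [hξ k]
    apply ENNReal.ofReal_le_ofReal
    rw [Finset.mem_Ico] at hk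
    have hk1 : (1:ℝ) ≤ k := by exact_mod_cast (by omega : 1 ≤ k)
    have hk2 : (k:ℝ) ≤ 2 * T := by exact_mod_cast hk.2.le
    have h1 : (k:ℝ)^(-(2:ℝ)) ≤ (k:ℝ)^(-β) := Real.rpow_le_rpow_of_exponent_le hk1 (by linarith)
    have h2 : 1 / (4 * (T:ℝ)^2) ≤ (k:ℝ)^(-(2:ℝ)) := by
      rw [Real.rpow_neg (by linarith), one_div]
      have : (k:ℝ)^(2:ℝ) = (k:ℝ)^2 := by norm_cast
      rw [this]
      apply inv_anti₀ (by positivity)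
      nlinarith
    rw [← div_div]
    gcongr
    exact h2.trans h1
  refine le_trans ?_ (Finset.sum_le_sum hk)
  rw [Finset.sum_const, Nat.card_Ico, nsmul_eq_mul, ← ENNReal.ofReal_natCast,
    ← ENNReal.ofReal_mul (by positivity)]
  apply ENNReal.ofReal_le_ofReal
  have : 2 * T - T = T := by omega
  rw [this]
  apply le_of_eq
  field_simp

lemma max_whp (hξ : IsZeta ξ β) (hβ1 : 1 < β) (hβ2 : β ≤ 2) (γ : ℝ) (hγ0 : 0 < γ) (hγ1 : γ < 1) :
    Tendsto (fun n => degPi n ξ {d | ∃ i, (n:ℝ)^γ ≤ d i}ᶜ) atTop (nhds 0) := by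
  have hz := zetaR_pos hβ1
  have hlim : Tendsto (fun n : ℕ => ENNReal.ofReal (Real.exp (-((n:ℝ)^(1-γ) / (8 * zetaR β))))) atTop (nhds 0) := by
    rw [← ENNReal.ofReal_zero]
    apply ENNReal.tendsto_ofReal
    apply Real.tendsto_exp_neg_atTop_nhds_zero.comp
    apply Tendsto.atTop_div_const (by positivity)
    exact (tendsto_rpow_atTop (by linarith)).comp tendsto_natCast_atTop_atTop
  refine tendsto_of_tendsto_of_tendsto_of_le_of_le' tendsto_const_nhds hlim
    (Eventually.of_forall fun _ => zero_le) ?_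
  filter_upwards [eventually_ge_atTop 1] with n hn
  have hnR : (1:ℝ) ≤ n := by exact_mod_cast hn
  have hnγ : 1 ≤ (n:ℝ)^γ := Real.one_le_rpow hnR hγ0.le
  set T := ⌈(n:ℝ)^γ⌉₊ with hT
  have hT1 : 1 ≤ T := Nat.one_le_iff_ne_zero.2 (by rw [hT]; exact (Nat.ceil_pos.2 (by linarith)).ne')
  have hTR : (1:ℝ) ≤ T := by exact_mod_cast hT1
  have hT2 : (T:ℝ) ≤ 2 * (n:ℝ)^γ := by
    have := Nat.ceil_lt_add_one (show 0 ≤ (n:ℝ)^γ by positivity)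
    linarith
  have hset : {d : Fin n → ℕ | ∃ i, (n:ℝ)^γ ≤ d i}ᶜ ⊆ Set.pi Set.univ fun _ => Set.Iio T := by
    intro d hd i _
    simp only [Set.mem_compl_iff, Set.mem_ofPred_eq, not_exists, not_le] at hd
    rw [Set.mem_Iio, hT, Nat.lt_ceil]
    exact hd i
  refine (measure_mono hset).trans ?_
  rw [Measure.pi_pi, Finset.prod_const, Finset.card_univ, Fintype.card_fin]
  set q : ℝ := 1 / (4 * T * zetaR β) with hq
  have hlow := tail_lower hξ hβ1 hβ2 T hT1
  have h1 : ξ.toMeasure (Set.Iio T) ≤ ENNReal.ofReal (Real.exp (-q)) := by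
    have h2 : ξ.toMeasure (Set.Iio T) = 1 - ξ.toMeasure (Set.Iio T)ᶜ := by
      rw [← prob_compl_eq_one_sub MeasurableSet.of_discrete, compl_compl]
    rw [h2]
    refine (tsub_le_tsub_left hlow 1).trans ?_
    rw [← ENNReal.ofReal_one, ← ENNReal.ofReal_sub _ (by positivity)]
    apply ENNReal.ofReal_le_ofReal
    have := Real.add_one_le_exp (-q)
    linarith
  calc _ ≤ (ENNReal.ofReal (Real.exp (-q)))^n := by gcongr
    _ = ENNReal.ofReal (Real.exp (-(n * q))) := by
      rw [← ENNReal.ofReal_pow (by positivity), ← Real.exp_nat_mul]; congr 2; ring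
    _ ≤ _ := by
      apply ENNReal.ofReal_le_ofReal
      apply Real.exp_le_exp.2
      apply neg_le_neg
      rw [hq, Real.rpow_sub (by linarith), Real.rpow_one, div_div, mul_one_div]
      apply div_le_div_of_nonneg_left (by positivity) (by positivity)
      nlinarith

lemma regime_C (hξ : IsZeta ξ β) (hβ1 : 1 < β) (hβ2 : β ≤ 2) :
    Tendsto (fun n => configurationModel n 2 ξ {φ | Satisfiable φ}) atTop (nhds 0) := by
  apply bad_tendsto ξ (zeta_even_ne hξ hβ1) (zeta_odd_ne hξ hβ1) (fun n => {φ | Satisfiable φ})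
  intro η hη
  obtain ⟨K, hC⟩ := unsat_C η hη
  set p : ℝ := (β - 1) / 2 with hp
  have hp0 : 0 < p := by rw [hp]; linarith
  have hp1 : p ≤ 1 := by rw [hp]; linarith
  have s0 := zetaR_summable hβ1
  have hz : 0 < ∑' k : ℕ, (k:ℝ) ^ (-β) := s0.tsum_pos (fun i => by positivity) 1 (by simp)
  have sp : Summable fun k : ℕ => (k:ℝ)^p * (k : ℝ) ^ (-β) := by
    have h : Summable fun k : ℕ => (k : ℝ) ^ (-(β - p)) := zetaR_summable (by rw [hp]; linarith)
    refine h.congr fun k => ?_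
    rcases Nat.eq_zero_or_pos k with rfl | hk
    · have h1 : -(β - p) ≠ 0 := by rw [hp]; linarith
      rw [Nat.cast_zero, Real.zero_rpow h1, Real.zero_rpow hp0.ne', zero_mul]
    · rw [← Real.rpow_add (by exact_mod_cast hk)]
      congr 1; ring
  set Z := ∑' k : ℕ, (k:ℝ) ^ (-β)
  set W := ∑' k : ℕ, (k:ℝ)^p * (k : ℝ) ^ (-β) with hW
  have hW0 : 0 ≤ W := tsum_nonneg fun k => by positivity
  set C : ℝ := (W + 1) / Z with hCdef
  have hC0 : 0 < C := by positivity
  have hCZ : C * Z = W + 1 := by rw [hCdef]; field_simp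
  have e2 : ∀ k : ℕ, (C - (k:ℝ)^p) * (k : ℝ) ^ (-β) = C * (k : ℝ) ^ (-β) - (k:ℝ)^p * (k : ℝ) ^ (-β) :=
    fun k => by ring
  have L1 := lln_zeta hξ hβ1 (fun k => C - (k:ℝ)^p)
    (((s0.mul_left C).sub sp).congr fun k => (e2 k).symm)
    (by rw [tsum_congr e2, (s0.mul_left C).tsum_sub sp, tsum_mul_left, hCZ, ← hW]; linarith)
  set γ : ℝ := (1 / (1 + p) + 1) / 2 with hγ
  have hγa : 1 / (1 + p) < 1 := by rw [div_lt_one (by linarith)]; linarith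
  have hγb : 0 < 1 / (1 + p) := by positivity
  have hγ1 : γ < 1 := by rw [hγ]; linarith
  have hγ0 : 0 < γ := by rw [hγ]; linarith
  have hγp : 0 < γ * (1 + p) - 1 := by
    have : 1 / (1 + p) < γ := by rw [hγ]; linarith
    rw [div_lt_iff₀ (by linarith)] at this
    linarith
  have L2 := max_whp hξ hβ1 hβ2 γ hγ0 hγ1
  have L3 : Tendsto (fun n => degPi n ξ {d | ∀ i, 1 ≤ d i}ᶜ) atTop (nhds 0) := by
    simp_rw [degPi_pos hξ hβ1]; exact tendsto_const_nhds
  refine ⟨_, inter_whp (inter_whp L1 L2) L3, ?_⟩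
  have hgrow : Tendsto (fun n : ℕ => (n:ℝ) ^ (γ * (1+p) - 1)) atTop atTop :=
    (tendsto_rpow_atTop hγp).comp tendsto_natCast_atTop_atTop
  filter_upwards [eventually_ge_atTop 1, hgrow.eventually_ge_atTop (|K| * C)] with n hn hnK
  rintro d ⟨⟨h1, h2⟩, h3⟩ hd
  simp only [Set.mem_ofPred_eq] at h1 h2 h3
  rw [formula_prob n d hd]
  apply ENNReal.ofReal_le_ofReal
  have hnR : (1:ℝ) ≤ n := by exact_mod_cast hn
  have hSn := sum_ge_n h3
  have hcard := clones_card n d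
  have : Nonempty (Fin n) := ⟨⟨0, by omega⟩⟩
  obtain ⟨v, hv⟩ := Finite.exists_max d
  refine hC (Clones n d) (Fin n) Sigma.fst v ?_ ?_ ?_
  · rw [hcard]; exact even_iff_two_dvd.2 hd
  · rw [hcard]; omega
  · rw [hcard, clonesOf_card]
    obtain ⟨i, hi⟩ := h2
    have hD : (n:ℝ)^γ ≤ d v := hi.trans (by exact_mod_cast hv i)
    have hD1 : (1:ℝ) ≤ d v := by exact_mod_cast h3 v
    rw [Finset.sum_sub_distrib] at h1
    simp at h1
    have hS : ((∑ i, d i : ℕ) : ℝ) ≤ (d v : ℝ)^(1-p) * (n * C) := by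
      calc ((∑ i, d i : ℕ) : ℝ) = ∑ i, (d i : ℝ) := by push_cast; rfl
        _ ≤ ∑ i, (d v : ℝ)^(1-p) * (d i : ℝ)^p := by
          refine Finset.sum_le_sum fun i _ => ?_
          have hi1 : (0:ℝ) < d i := by exact_mod_cast h3 i
          calc (d i : ℝ) = (d i : ℝ)^(1-p) * (d i : ℝ)^p := by
                rw [← Real.rpow_add hi1]; simp
            _ ≤ _ := by
                gcongr
                · exact hv i
        _ = (d v : ℝ)^(1-p) * ∑ i, (d i : ℝ)^p := by rw [Finset.mul_sum]
        _ ≤ _ := by gcongr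
    have hpow : |K| * C * n ≤ (d v : ℝ)^(1+p) := by
      calc |K| * C * n ≤ (n:ℝ) ^ (γ * (1+p) - 1) * n := by gcongr
        _ = (n:ℝ) ^ (γ * (1+p)) := by
          rw [Real.rpow_sub (by linarith), Real.rpow_one]; field_simp
        _ = ((n:ℝ)^γ)^(1+p) := by rw [Real.rpow_mul (by linarith)]
        _ ≤ _ := by gcongr
    calc K * ((∑ i, d i : ℕ) : ℝ) ≤ |K| * ((∑ i, d i : ℕ) : ℝ) := by
          gcongr; exact le_abs_self K
      _ ≤ |K| * ((d v : ℝ)^(1-p) * (n * C)) := by gcongr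
      _ = (d v : ℝ)^(1-p) * (|K| * C * n) := by ring
      _ ≤ (d v : ℝ)^(1-p) * (d v : ℝ)^(1+p) := by gcongr
      _ = (d v : ℝ)^2 := by
        rw [← Real.rpow_add (by linarith), ← Real.rpow_natCast]; congr 1; push_cast; ring

end RegimeC


section Threshold

/-- `Q β = ζ(β-2) - 3 ζ(β-1)` for `β > 3`. -/
noncomputable def Q (β : ℝ) : ℝ := ∑' k : ℕ, ((k:ℝ)^2 - 3 * k) * (k:ℝ)^(-β)

lemma zeta_shift (j : ℕ) (β : ℝ) (hβ : (j:ℝ) + 1 < β) :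
    zetaR (β - j) = ∑' k : ℕ, (k:ℝ)^j * (k:ℝ)^(-β) := by
  rw [zetaR_eq (by linarith)]
  refine tsum_congr fun k => ?_
  rcases Nat.eq_zero_or_pos k with rfl | hk
  · have h1 : -(β - j) ≠ 0 := by linarith
    have h2 : -β ≠ 0 := by have : (0:ℝ) ≤ j := by positivity
                           linarith
    rw [Nat.cast_zero, Real.zero_rpow h1, Real.zero_rpow h2, mul_zero]
  · rw [← Real.rpow_natCast, ← Real.rpow_add (by exact_mod_cast hk)]
    congr 1; ring

lemma Q_term (β : ℝ) (k : ℕ) : ((k:ℝ)^2 - 3 * k) * (k:ℝ)^(-β) =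
    (k:ℝ)^2 * (k:ℝ)^(-β) - 3 * ((k:ℝ)^1 * (k:ℝ)^(-β)) := by ring

lemma Q_summable {β : ℝ} (hβ : 3 < β) : Summable fun k : ℕ => ((k:ℝ)^2 - 3 * k) * (k:ℝ)^(-β) :=
  ((summable_pow_zeta (β := β) 2 (by norm_num; linarith)).sub
    ((summable_pow_zeta (β := β) 1 (by norm_num; linarith)).mul_left 3)).congr
      fun k => (Q_term β k).symm

lemma Q_eq {β : ℝ} (hβ : 3 < β) : Q β = (∑' k : ℕ, (k:ℝ)^2 * (k:ℝ)^(-β)) -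
    3 * ∑' k : ℕ, (k:ℝ)^1 * (k:ℝ)^(-β) := by
  unfold Q
  rw [tsum_congr (Q_term β), (summable_pow_zeta (β := β) 2 (by norm_num; linarith)).tsum_sub
    ((summable_pow_zeta (β := β) 1 (by norm_num; linarith)).mul_left 3), tsum_mul_left]

lemma Q_lt {β β' : ℝ} (hβ : 3 < β) (h : β < β') : Q β' < (3:ℝ)^(-(β' - β)) * Q β := by
  unfold Q
  rw [← tsum_mul_left]
  have key : ∀ k : ℕ, 1 ≤ k → (k:ℝ)^(-β') = (k:ℝ)^(-(β'-β)) * (k:ℝ)^(-β) := by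
    intro k hk
    rw [← Real.rpow_add (by exact_mod_cast hk)]; congr 1; ring
  refine Summable.tsum_lt_tsum (i := 1) (fun k => ?_) ?_ (Q_summable (hβ.trans h))
    ((Q_summable hβ).mul_left _)
  · rcases Nat.eq_zero_or_pos k with rfl | hk
    · simp
    rw [key k hk]
    have hkR : (1:ℝ) ≤ k := by exact_mod_cast hk
    have h0 : 0 ≤ (k:ℝ)^(-β) := by positivity
    rcases le_or_gt k 3 with h3 | h3
    · have h3R : (k:ℝ) ≤ 3 := by exact_mod_cast h3
      have hp : (3:ℝ)^(-(β'-β)) ≤ (k:ℝ)^(-(β'-β)) :=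
        Real.rpow_le_rpow_of_nonpos (by linarith) h3R (by linarith)
      have hneg : ((k:ℝ)^2 - 3 * k) * (k:ℝ)^(-β) ≤ 0 :=
        mul_nonpos_of_nonpos_of_nonneg (by nlinarith) h0
      calc _ = (k:ℝ)^(-(β'-β)) * (((k:ℝ)^2 - 3 * k) * (k:ℝ)^(-β)) := by ring
        _ ≤ _ := mul_le_mul_of_nonpos_right hp hneg
    · have h3R : (3:ℝ) ≤ k := by exact_mod_cast h3.le
      have hp : (k:ℝ)^(-(β'-β)) ≤ (3:ℝ)^(-(β'-β)) :=
        Real.rpow_le_rpow_of_nonpos (by linarith) h3R (by linarith)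
      have hneg : 0 ≤ ((k:ℝ)^2 - 3 * k) * (k:ℝ)^(-β) :=
        mul_nonneg (by nlinarith) h0
      calc _ = (k:ℝ)^(-(β'-β)) * (((k:ℝ)^2 - 3 * k) * (k:ℝ)^(-β)) := by ring
        _ ≤ _ := mul_le_mul_of_nonneg_right hp hneg
  · have : (3:ℝ)^(-(β'-β)) < 1 := Real.rpow_lt_one_of_one_lt_of_neg (by norm_num) (by linarith)
    simp only [Nat.cast_one, Real.one_rpow]
    linarith

lemma Q_cont {a : ℝ} (ha : 3 < a) : ContinuousOn Q (Set.Ici a) := by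
  unfold Q
  refine continuousOn_tsum (u := fun k : ℕ => 4 * ((k:ℝ)^2 * (k:ℝ)^(-a))) ?_
    ((summable_pow_zeta (β := a) 2 (by norm_num; linarith)).mul_left 4) ?_
  · intro k
    rcases Nat.eq_zero_or_pos k with rfl | hk
    · simp; exact continuousOn_const
    · apply Continuous.continuousOn
      exact continuous_const.mul ((Real.continuous_const_rpow (by positivity)).comp continuous_neg)
  · intro k x hx
    rcases Nat.eq_zero_or_pos k with rfl | hk
    · simp
    have hkR : (1:ℝ) ≤ k := by exact_mod_cast hk
    rw [Real.norm_eq_abs, abs_mul, abs_of_nonneg (show 0 ≤ (k:ℝ)^(-x) by positivity), ← mul_assoc]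
    have h1 : (k:ℝ)^(-x) ≤ (k:ℝ)^(-a) := Real.rpow_le_rpow_of_exponent_le hkR (by linarith [Set.mem_Ici.1 hx])
    have h2 : |(k:ℝ)^2 - 3 * k| ≤ 4 * (k:ℝ)^2 := by
      rw [abs_le]; constructor <;> nlinarith
    gcongr

lemma Q_four : Q 4 < 0 := by
  rw [Q_eq (by norm_num)]
  have h2 : ∑' k : ℕ, (k:ℝ)^2 * (k:ℝ)^(-(4:ℝ)) = Real.pi^2 / 6 := by
    rw [← hasSum_zeta_two.tsum_eq]
    refine tsum_congr fun k => ?_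
    rw [Real.rpow_neg (by positivity)]
    have : (k:ℝ)^(4:ℝ) = (k:ℝ)^4 := by norm_cast
    rw [this]
    rcases Nat.eq_zero_or_pos k with rfl | hk
    · simp
    · field_simp
  have s1 := summable_pow_zeta (β := 4) 1 (by norm_num)
  have h1 : 1 ≤ ∑' k : ℕ, (k:ℝ)^1 * (k:ℝ)^(-(4:ℝ)) := by
    have := s1.sum_le_tsum {1} (fun i _ => by positivity)
    simpa using this
  rw [h2]
  have := Real.pi_lt_d2
  have := Real.pi_pos
  nlinarith

lemma trunc_diverge {β : ℝ} (h2 : 2 < β) (h3 : β ≤ 3) :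
    Tendsto (fun M => ∑ k ∈ Finset.range M, ((k:ℝ)^2 - k) * (k : ℝ) ^ (-β)) atTop atTop := by
  rw [← not_summable_iff_tendsto_nat_atTop_of_nonneg]
  · intro hs
    have s1 := summable_pow_zeta (β := β) 1 (by norm_num; linarith)
    have s2 : Summable fun k : ℕ => (k:ℝ)^(-(β-2)) := by
      refine (hs.add s1).congr fun k => ?_
      rcases Nat.eq_zero_or_pos k with rfl | hk
      · have h1 : -(β - 2) ≠ 0 := by linarith
        rw [Nat.cast_zero, Real.zero_rpow h1]; simp
      · have : (k:ℝ)^(-(β-2)) = (k:ℝ)^2 * (k:ℝ)^(-β) := by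
          rw [← Real.rpow_natCast, ← Real.rpow_add (by exact_mod_cast hk)]
          congr 1; push_cast; ring
        rw [this]; ring
    rw [Real.summable_nat_rpow] at s2
    linarith
  · intro k
    apply mul_nonneg _ (by positivity)
    rcases Nat.eq_zero_or_pos k with rfl | hk
    · simp
    · have hkR : (1:ℝ) ≤ k := by exact_mod_cast hk
      nlinarith

lemma Q_pos_exists : ∃ a : ℝ, 3 < a ∧ a < 4 ∧ 0 < Q a := by
  have hd := trunc_diverge (β := 3) (by norm_num) le_rfl
  have s1 := summable_pow_zeta (β := 3) 1 (by norm_num)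
  obtain ⟨M, hM, hM4⟩ := ((hd.eventually_gt_atTop (2 * ∑' k : ℕ, (k:ℝ)^1 * (k:ℝ)^(-(3:ℝ)))).and
    (eventually_ge_atTop 4)).exists
  let F : ℝ → ℝ := fun β => ∑ k ∈ Finset.range M, ((k:ℝ)^2 - 3 * k) * (k:ℝ)^(-β)
  have hF3 : 0 < F 3 := by
    have h1 := s1.sum_le_tsum (Finset.range M) (fun i _ => by positivity)
    have h2 : F 3 = ∑ k ∈ Finset.range M, ((k:ℝ)^2 - k) * (k : ℝ) ^ (-(3:ℝ)) -
        2 * ∑ k ∈ Finset.range M, (k:ℝ)^1 * (k:ℝ)^(-(3:ℝ)) := by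
      rw [Finset.mul_sum, ← Finset.sum_sub_distrib]
      exact Finset.sum_congr rfl fun k _ => by ring
    rw [h2]; linarith
  have hFc : Continuous F := by
    refine continuous_finsetSum _ fun k _ => ?_
    rcases Nat.eq_zero_or_pos k with rfl | hk
    · simp; exact continuous_const
    · exact continuous_const.mul ((Real.continuous_const_rpow (by positivity)).comp continuous_neg)
  have hev : ∀ᶠ x in nhdsWithin (3:ℝ) (Set.Ioi 3), 0 < F x ∧ x < 4 ∧ 3 < x := by
    have e1 : ∀ᶠ x in nhds (3:ℝ), 0 < F x := hFc.continuousAt.eventually (lt_mem_nhds hF3)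
    have e2 : ∀ᶠ x in nhds (3:ℝ), x < 4 := gt_mem_nhds (by norm_num)
    filter_upwards [e1.filter_mono nhdsWithin_le_nhds, e2.filter_mono nhdsWithin_le_nhds,
      self_mem_nhdsWithin] with x h1 h2 h3
    exact ⟨h1, h2, h3⟩
  obtain ⟨a, h1, h2, h3⟩ := hev.exists
  refine ⟨a, h3, h2, h1.trans_le ?_⟩
  refine (Q_summable h3).sum_le_tsum _ fun k hk => ?_
  have hk' : 4 ≤ k := by
    rw [Finset.mem_range] at hk; omega
  have hkR : (4:ℝ) ≤ k := by exact_mod_cast hk'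
  exact mul_nonneg (by nlinarith) (by positivity)

lemma threshold_exists : ∃ β₀ : ℝ, 3 < β₀ ∧ Q β₀ = 0 := by
  obtain ⟨a, h3, h4, hpos⟩ := Q_pos_exists
  have := intermediate_value_Icc' h4.le ((Q_cont h3).mono Set.Icc_subset_Ici_self)
  obtain ⟨b, hb, hb0⟩ := this ⟨Q_four.le, hpos.le⟩
  exact ⟨b, h3.trans_le hb.1, hb0⟩

end Threshold

theorem main_thm :
    ∃ β₀ : ℝ, 3 < β₀ ∧ zetaR (β₀ - 2) = 3 * zetaR (β₀ - 1) ∧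
      ∀ (β : ℝ) (ξ : PMF ℕ), IsZeta ξ β →
        ((1 < β ∧ β < β₀ →
            Tendsto (fun n => configurationModel n 2 ξ {φ | Satisfiable φ})
              atTop (nhds 0)) ∧
         (β₀ < β →
            Tendsto (fun n => configurationModel n 2 ξ {φ | Satisfiable φ})
              atTop (nhds 1))) := by
  obtain ⟨β₀, hβ₀, hQ⟩ := threshold_exists
  refine ⟨β₀, hβ₀, ?_, ?_⟩
  · have h2 := zeta_shift 2 β₀ (by norm_num; linarith)
    have h1 := zeta_shift 1 β₀ (by norm_num; linarith)
    rw [Q_eq hβ₀, ← h2, ← h1] at hQ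
    push_cast at hQ
    linarith
  · intro β ξ hξ
    constructor
    · rintro ⟨h1, h2⟩
      rcases le_or_gt β 2 with hβ2 | hβ2
      · exact regime_C hξ h1 hβ2
      have s1 := summable_pow_zeta (β := β) 1 (by norm_num; linarith)
      rcases le_or_gt β 3 with hβ3 | hβ3
      · have hd := (tendsto_add_atTop_iff_nat 1).2 (trunc_diverge hβ2 hβ3)
        obtain ⟨M, hM⟩ := (hd.eventually_gt_atTop ((2 + 1) * ∑' k : ℕ, (k:ℝ)^1 * (k:ℝ)^(-β))).exists
        exact regime_B hξ hβ2 M 1 one_pos hM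
      · have hpos : 0 < Q β := by
          have := Q_lt hβ3 h2
          rw [hQ] at this
          exact pos_of_mul_pos_right this (by positivity)
        rw [Q_eq hβ3] at hpos
        have s2 := summable_pow_zeta (β := β) 2 (by norm_num; linarith)
        have hT : 0 < ∑' k : ℕ, (k:ℝ)^1 * (k : ℝ) ^ (-β) :=
          s1.tsum_pos (fun i => by positivity) 1 (by simp)
        have hs : HasSum (fun k : ℕ => ((k:ℝ)^2 - k) * (k : ℝ) ^ (-β))
            ((∑' k : ℕ, (k:ℝ)^2 * (k:ℝ)^(-β)) - ∑' k : ℕ, (k:ℝ)^1 * (k:ℝ)^(-β)) := by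
          have := s2.hasSum.sub s1.hasSum
          have he : (fun k : ℕ => ((k:ℝ)^2 - k) * (k : ℝ) ^ (-β)) =
              fun k : ℕ => (k:ℝ)^2 * (k:ℝ)^(-β) - (k:ℝ)^1 * (k:ℝ)^(-β) := by
            funext k; ring
          rw [he]; exact this
        have ht := (tendsto_add_atTop_iff_nat 1).2 hs.tendsto_sum_nat
        set T := ∑' k : ℕ, (k:ℝ)^1 * (k : ℝ) ^ (-β)
        set U := ∑' k : ℕ, (k:ℝ)^2 * (k : ℝ) ^ (-β)
        obtain ⟨ε, hε, hεT⟩ : ∃ ε : ℝ, 0 < ε ∧ (2 + ε) * T < U - T := by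
          refine ⟨(U - 3 * T) / (2 * T), by positivity, ?_⟩
          have : (U - 3 * T) / (2 * T) * T = (U - 3 * T) / 2 := by field_simp
          rw [add_mul, this]; linarith
        obtain ⟨M, hM⟩ := (ht.eventually (lt_mem_nhds hεT)).exists
        exact regime_B hξ hβ2 M ε hε hM
    · intro h
      have hneg : Q β < 0 := by
        have := Q_lt hβ₀ h
        rwa [hQ, mul_zero] at this
      refine regime_sat hξ (hβ₀.trans h) ?_
      have : ∑' k : ℕ, (3 * (k:ℝ) - (k:ℝ)^2) * (k : ℝ) ^ (-β) = - Q β := by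
        unfold Q
        rw [← tsum_neg]
        exact tsum_congr fun k => by ring
      rw [this]; linarith


/-- **Satisfiability threshold for zeta-distributed random 2-SAT in the
configuration model.**  There is a critical exponent `β₀ > 3`, the solution of
`ζ(β₀ − 2) = 3 ζ(β₀ − 1)` (equivalently `E[ξ²] = 3 E[ξ]`, numerically
`β₀ ≈ 3.26`), such that a random 2-CNF `φ ∼ C_n^2(ξ)` with zeta-distributed
degrees is unsatisfiable w.h.p. for `1 < β < β₀` and satisfiable w.h.p. for
`β > β₀`. -/
theorem zeta_twoSat_threshold :
    ∃ β₀ : ℝ, 3 < β₀ ∧ zetaR (β₀ - 2) = 3 * zetaR (β₀ - 1) ∧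
      ∀ (β : ℝ) (ξ : PMF ℕ), IsZeta ξ β →
        ((1 < β ∧ β < β₀ →
            Tendsto (fun n => configurationModel n 2 ξ {φ | Satisfiable φ})
              atTop (nhds 0)) ∧
         (β₀ < β →
            Tendsto (fun n => configurationModel n 2 ξ {φ | Satisfiable φ})
              atTop (nhds 1))) := by
  exact main_thm

end RandomSat
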